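/- (L¹-contraction.) Let T > 0, let φ : ℝ → ℝ be continuous and nondecreasing, let μ be a Lévy measure on ℝ^N \ {0}, and let u₀, û₀ ∈ L^∞(ℝ^N) ∩ L¹(ℝ^N). Let u and û be distributional solutions in L^∞(Q_T) ∩ L¹(Q_T) ∩ C([0,T]; L¹_loc(ℝ^N)) of ∂_t v − L^μ[φ(v)] = 0 in Q_T with initial data u₀ and û₀ respectively. Then for every t ∈ [0,T], ∫_{ℝ^N} ( u(x,t) − û(x,t) )⁺ dx ≤ ∫_{ℝ^N} ( u₀(x) − û₀(x) )⁺ dx, where r⁺ = max{r,0}. -/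

import Mathlib

open MeasureTheory Set Filter

noncomputable section

/-- Euclidean space `ℝ^N`. -/
abbrev Euc (N : ℕ) := EuclideanSpace ℝ (Fin N)

variable {N : ℕ}

/-- `μ` is a (symmetric) Lévy measure on `ℝ^N ∖ {0}` : it is a nonnegative measure giving no
mass to `{0}`, symmetric (`μ(−B) = μ(B)`), and `∫ min(|z|²,1) dμ(z) < ∞`. -/
def IsLevyMeasure (μ : Measure (Euc N)) : Prop :=
  μ {0} = 0 ∧ μ.map (fun z => -z) = μ ∧
    ∫⁻ z, ENNReal.ofReal (min (‖z‖ ^ 2) 1) ∂μ ≠ ⊤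

/-- The nonlocal operator
`L^μ[ψ](x) = ∫ (ψ(x+z) − ψ(x) − z·Dψ(x) 1_{|z|≤1}) dμ(z)`. -/
def Lop (μ : Measure (Euc N)) (ψ : Euc N → ℝ) (x : Euc N) : ℝ :=
  ∫ z, (ψ (x + z) - ψ x - (if ‖z‖ ≤ 1 then fderiv ℝ ψ x z else 0)) ∂μ

/-- `ψ ∈ C_c^∞(ℝ^N)`. -/
def IsTestFn (ψ : Euc N → ℝ) : Prop :=
  ContDiff ℝ (⊤ : ℕ∞) ψ ∧ HasCompactSupport ψ

/-- `ψ ∈ C_c^∞(ℝ^N × [0,T))` : smooth, compactly supported, and the support stays away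
from `t = T` (but may touch `t = 0`). -/
def IsSTTestFn (T : ℝ) (ψ : Euc N → ℝ → ℝ) : Prop :=
  ContDiff ℝ (⊤ : ℕ∞) (Function.uncurry ψ) ∧ HasCompactSupport (Function.uncurry ψ) ∧
    tsupport (Function.uncurry ψ) ⊆ {p : Euc N × ℝ | p.2 < T}

/-- `ψ ∈ C_c^∞(Q_T)` : smooth, compactly supported inside the open cylinder
`ℝ^N × (0,T)`. -/
def IsIntTestFn (T : ℝ) (ψ : Euc N → ℝ → ℝ) : Prop :=
  ContDiff ℝ (⊤ : ℕ∞) (Function.uncurry ψ) ∧ HasCompactSupport (Function.uncurry ψ) ∧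
    tsupport (Function.uncurry ψ) ⊆ {p : Euc N × ℝ | 0 < p.2 ∧ p.2 < T}

/-- The natural measure on the cylinder `Q_T = ℝ^N × (0,T)`. -/
def QTvol (N : ℕ) (T : ℝ) : Measure (Euc N × ℝ) :=
  (volume : Measure (Euc N)).prod ((volume : Measure ℝ).restrict (Ioo 0 T))

/-- `u ∈ L^∞(Q_T)`. -/
def MemLinfQT (T : ℝ) (u : Euc N → ℝ → ℝ) : Prop :=
  AEStronglyMeasurable (fun p : Euc N × ℝ => u p.1 p.2) (QTvol N T) ∧
    ∃ C : ℝ, ∀ᵐ p ∂(QTvol N T), |u p.1 p.2| ≤ C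

/-- `u ∈ L¹(Q_T)`. -/
def MemL1QT (T : ℝ) (u : Euc N → ℝ → ℝ) : Prop :=
  Integrable (fun p : Euc N × ℝ => u p.1 p.2) (QTvol N T)

/-- `u ∈ C([0,T]; L¹_loc(ℝ^N))` : for every compact `K`, `t ↦ u(·,t)` is continuous
from `[0,T]` into `L¹(K)`. -/
def MemCL1loc (T : ℝ) (u : Euc N → ℝ → ℝ) : Prop :=
  ∀ K : Set (Euc N), IsCompact K →
    (∀ t ∈ Icc (0 : ℝ) T, IntegrableOn (fun x => u x t) K) ∧
    ∀ t ∈ Icc (0 : ℝ) T,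
      Tendsto (fun s => ∫ x in K, |u x s - u x t|) (nhdsWithin t (Icc 0 T)) (nhds 0)

/-- `u` is a distributional solution of `∂_t u − A[φ(u)] = 0` in `Q_T` with initial
datum `u0` : for all `ψ ∈ C_c^∞(ℝ^N × [0,T))`,
`∫₀^T ∫ (u ∂_t ψ + φ(u) A[ψ(·,t)]) dx dt + ∫ u0(x) ψ(x,0) dx = 0`. -/
def IsDistSolOp (T : ℝ) (A : (Euc N → ℝ) → Euc N → ℝ) (φ : ℝ → ℝ)
    (u0 : Euc N → ℝ) (u : Euc N → ℝ → ℝ) : Prop :=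
  ∀ ψ : Euc N → ℝ → ℝ, IsSTTestFn T ψ →
    (∫ t in Ioo (0 : ℝ) T, ∫ x,
        (u x t * deriv (ψ x) t + φ (u x t) * A (fun y => ψ y t) x))
      + ∫ x, u0 x * ψ x 0 = 0

/-- `u0 ∈ L^∞(ℝ^N)`. -/
def MemLinfRn (u0 : Euc N → ℝ) : Prop :=
  AEStronglyMeasurable u0 (volume : Measure (Euc N)) ∧
    ∃ C : ℝ, ∀ᵐ x : Euc N ∂volume, |u0 x| ≤ C

end

open MeasureTheory Set Filter Topology

noncomputable section JumpOperator

variable {N : ℕ}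

/-- Bounded Borel functions on `ℝ^N`. -/
structure IsBddMeas (f : Euc N → ℝ) : Prop where
  meas : Measurable f
  bdd : ∃ C, ∀ x, |f x| ≤ C

namespace IsBddMeas

variable {f g : Euc N → ℝ}

lemma const (c : ℝ) : IsBddMeas (fun _ : Euc N => c) := ⟨measurable_const, |c|, fun _ => le_rfl⟩

lemma add (hf : IsBddMeas f) (hg : IsBddMeas g) : IsBddMeas (fun x => f x + g x) := by
  obtain ⟨C, hC⟩ := hf.bdd
  obtain ⟨D, hD⟩ := hg.bdd
  exact ⟨hf.meas.add hg.meas, C + D,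
    fun x => (abs_add_le _ _).trans (add_le_add (hC x) (hD x))⟩

lemma const_mul (c : ℝ) (hf : IsBddMeas f) : IsBddMeas (fun x => c * f x) := by
  obtain ⟨C, hC⟩ := hf.bdd
  exact ⟨hf.meas.const_mul c, |c| * C,
    fun x => by rw [abs_mul]; exact mul_le_mul_of_nonneg_left (hC x) (abs_nonneg c)⟩

lemma sub (hf : IsBddMeas f) (hg : IsBddMeas g) : IsBddMeas (fun x => f x - g x) := by
  have := hf.add (hg.const_mul (-1))
  simpa [sub_eq_add_neg] using this

lemma mul (hf : IsBddMeas f) (hg : IsBddMeas g) : IsBddMeas (fun x => f x * g x) := by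
  obtain ⟨C, hC⟩ := hf.bdd
  obtain ⟨D, hD⟩ := hg.bdd
  refine ⟨hf.meas.mul hg.meas, C * D, fun x => ?_⟩
  rw [abs_mul]
  exact mul_le_mul (hC x) (hD x) (abs_nonneg _) ((abs_nonneg _).trans (hC x))

lemma comp_continuous {φ : ℝ → ℝ} (hφ : Continuous φ) (hf : IsBddMeas f) :
    IsBddMeas (fun x => φ (f x)) := by
  obtain ⟨C, hC⟩ := hf.bdd
  obtain ⟨D, hD⟩ := (isCompact_Icc (a := -C) (b := C)).exists_bound_of_continuousOn
    hφ.continuousOn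
  exact ⟨hφ.measurable.comp hf.meas, D, fun x => hD _ (abs_le.mp (hC x))⟩

lemma integrable_mul {m : Measure (Euc N)} (hg : IsBddMeas g) (hf : Integrable f m) :
    Integrable (fun x => f x * g x) m := by
  obtain ⟨D, hD⟩ := hg.bdd
  exact hf.mul_bdd (c := D) hg.meas.aestronglyMeasurable (Eventually.of_forall hD)

lemma integrable_shift {ν : Measure (Euc N)} [IsFiniteMeasure ν] (hf : IsBddMeas f)
    (x : Euc N) : Integrable (fun z => f (x + z)) ν := by
  obtain ⟨C, hC⟩ := hf.bdd
  exact Integrable.of_bound (hf.meas.comp (measurable_const_add x)).aestronglyMeasurable C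
    (Eventually.of_forall fun z => hC _)

end IsBddMeas

/-- The averaging operator `f ↦ ∫ f(· + z) dν(z)`. -/
def avgOp (ν : Measure (Euc N)) (f : Euc N → ℝ) (x : Euc N) : ℝ := ∫ z, f (x + z) ∂ν

/-- The jump operator `f ↦ ∫ (f(· + z) - f) dν(z)` of a finite measure. -/
def jumpOp (ν : Measure (Euc N)) (f : Euc N → ℝ) (x : Euc N) : ℝ :=
  avgOp ν f x - ν.real univ * f x

variable {ν : Measure (Euc N)} [IsFiniteMeasure ν] {f g : Euc N → ℝ}

lemma abs_avgOp_le {C : ℝ} (hC : ∀ x, |f x| ≤ C) (x : Euc N) :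
    |avgOp ν f x| ≤ ν.real univ * C := by
  have := norm_integral_le_of_norm_le_const (μ := ν) (f := fun z => f (x + z)) (C := C)
    (Eventually.of_forall fun z => hC _)
  rw [mul_comm]; exact this

lemma IsBddMeas.avgOp (hf : IsBddMeas f) : IsBddMeas (avgOp ν f) := by
  obtain ⟨C, hC⟩ := hf.bdd
  refine ⟨?_, _, abs_avgOp_le hC⟩
  exact (StronglyMeasurable.integral_prod_right (f := fun x z => f (x + z))
    (hf.meas.comp (measurable_fst.add measurable_snd)).stronglyMeasurable).measurable

lemma IsBddMeas.jumpOp (hf : IsBddMeas f) : IsBddMeas (jumpOp ν f) :=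
  hf.avgOp.sub (hf.const_mul _)

lemma avgOp_sub (hf : IsBddMeas f) (hg : IsBddMeas g) (x : Euc N) :
    avgOp ν (fun y => f y - g y) x = avgOp ν f x - avgOp ν g x :=
  integral_sub (hf.integrable_shift x) (hg.integrable_shift x)

lemma avgOp_const (c : ℝ) (x : Euc N) : avgOp ν (fun _ => c) x = ν.real univ * c := by
  simp [avgOp]

lemma jumpOp_const (c : ℝ) (x : Euc N) : jumpOp ν (fun _ => c) x = 0 := by
  simp [jumpOp, avgOp_const]

lemma jumpOp_sub (hf : IsBddMeas f) (hg : IsBddMeas g) (x : Euc N) :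
    jumpOp ν (fun y => f y - g y) x = jumpOp ν f x - jumpOp ν g x := by
  simp only [jumpOp, avgOp_sub hf hg]; ring

lemma avgOp_mono (hf : IsBddMeas f) (hg : IsBddMeas g) (h : ∀ x, f x ≤ g x) (x : Euc N) :
    avgOp ν f x ≤ avgOp ν g x :=
  integral_mono (hf.integrable_shift x) (hg.integrable_shift x) fun _ => h _

lemma integrable_prod_shift (hf : Measurable f) (hfi : Integrable f) :
    Integrable (fun p : Euc N × Euc N => f (p.1 + p.2)) (volume.prod ν) := by
  have hm : AEStronglyMeasurable (fun p : Euc N × Euc N => f (p.1 + p.2)) (volume.prod ν) :=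
    (hf.comp (measurable_fst.add measurable_snd)).aestronglyMeasurable
  rw [integrable_prod_iff' hm]
  refine ⟨Eventually.of_forall fun z => hfi.comp_add_right z, ?_⟩
  have : (fun z => ∫ x, ‖f (x + z)‖) = fun _ : Euc N => ∫ x, ‖f x‖ := by
    ext z; exact integral_add_right_eq_self (fun x => ‖f x‖) z
  simp only [this]
  exact integrable_const _

lemma integrable_avgOp (hf : Measurable f) (hfi : Integrable f) : Integrable (avgOp ν f) :=
  (integrable_prod_shift hf hfi).integral_prod_left

lemma integral_avgOp (hf : Measurable f) (hfi : Integrable f) :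
    ∫ x, avgOp ν f x = ν.real univ * ∫ x, f x := by
  unfold avgOp
  rw [integral_integral_swap (integrable_prod_shift hf hfi)]
  simp only [integral_add_right_eq_self]
  simp

lemma integrable_jumpOp (hf : Measurable f) (hfi : Integrable f) : Integrable (jumpOp ν f) :=
  (integrable_avgOp hf hfi).sub (hfi.const_mul _)

lemma integral_jumpOp (hf : Measurable f) (hfi : Integrable f) : ∫ x, jumpOp ν f x = 0 := by
  unfold jumpOp
  rw [integral_sub (integrable_avgOp hf hfi) (hfi.const_mul _), integral_avgOp hf hfi,
    integral_const_mul, sub_self]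

lemma integral_abs_avgOp_le (hf : IsBddMeas f) (hfi : Integrable f) :
    ∫ x, |avgOp ν f x| ≤ ν.real univ * ∫ x, |f x| := by
  rw [← integral_avgOp hf.meas.abs hfi.abs]
  refine integral_mono (integrable_avgOp hf.meas hfi).abs
    (integrable_avgOp hf.meas.abs hfi.abs) fun x => ?_
  exact abs_integral_le_integral_abs

/-- Self-adjointness of the averaging operator of a symmetric measure. -/
lemma integral_avgOp_mul (hν : ν.map (fun z => -z) = ν) (hf : IsBddMeas f)
    (hfi : Integrable f) (hg : IsBddMeas g) :
    ∫ x, avgOp ν f x * g x = ∫ x, f x * avgOp ν g x := by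
  have h1 : Integrable (fun p : Euc N × Euc N => f (p.1 + p.2) * g p.1) (volume.prod ν) := by
    obtain ⟨D, hD⟩ := hg.bdd
    exact (integrable_prod_shift hf.meas hfi).mul_bdd (c := D)
      (hg.meas.comp measurable_fst).aestronglyMeasurable (Eventually.of_forall fun p => hD _)
  calc ∫ x, avgOp ν f x * g x = ∫ x, ∫ z, f (x + z) * g x ∂ν := by
        simp only [avgOp, integral_mul_const]
    _ = ∫ z, ∫ x, f (x + z) * g x ∂volume ∂ν := integral_integral_swap h1
    _ = ∫ z, ∫ x, f x * g (x + -z) ∂volume ∂ν := by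
        congr 1; ext z
        rw [← integral_add_right_eq_self (fun x => f x * g (x + -z)) z]
        simp
    _ = ∫ z, ∫ x, f x * g (x + z) ∂volume ∂ν := by
        conv_rhs => rw [← hν]
        rw [integral_map measurable_neg.aemeasurable]
        have : StronglyMeasurable (fun z : Euc N => ∫ x, f x * g (x + z)) :=
          StronglyMeasurable.integral_prod_right (f := fun z x => f x * g (x + z))
            (((hf.meas.comp measurable_snd).mul
              (hg.meas.comp (measurable_snd.add measurable_fst))).stronglyMeasurable)
        exact this.aestronglyMeasurable
    _ = ∫ x, ∫ z, f x * g (x + z) ∂ν := by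
        rw [integral_integral_swap]
        obtain ⟨D, hD⟩ := hg.bdd
        have : Integrable (fun p : Euc N × Euc N => f p.2 * g (p.2 + p.1)) (ν.prod volume) :=
          (hfi.comp_snd ν).mul_bdd (c := D)
            (hg.meas.comp (measurable_snd.add measurable_fst)).aestronglyMeasurable
            (Eventually.of_forall fun p => hD _)
        exact this
    _ = ∫ x, f x * avgOp ν g x := by simp only [avgOp, integral_const_mul]

lemma integral_jumpOp_mul (hν : ν.map (fun z => -z) = ν) (hf : IsBddMeas f)
    (hfi : Integrable f) (hg : IsBddMeas g) :
    ∫ x, jumpOp ν f x * g x = ∫ x, f x * jumpOp ν g x := by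
  have e1 : ∀ x, jumpOp ν f x * g x = avgOp ν f x * g x - ν.real univ * (f x * g x) :=
    fun x => by unfold jumpOp; ring
  have e2 : ∀ x, f x * jumpOp ν g x = f x * avgOp ν g x - ν.real univ * (f x * g x) :=
    fun x => by unfold jumpOp; ring
  simp only [e1, e2]
  rw [integral_sub (hg.integrable_mul (integrable_avgOp hf.meas hfi))
      ((hg.integrable_mul hfi).const_mul _),
    integral_sub (hf := hg.avgOp.integrable_mul hfi) ((hg.integrable_mul hfi).const_mul _),
    integral_avgOp_mul hν hf hfi hg]

/-- The jump operator is dissipative. -/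
lemma integral_mul_jumpOp_nonpos (hf : IsBddMeas f) (hfi : Integrable f) :
    ∫ x, f x * jumpOp ν f x ≤ 0 := by
  have hf2 : Integrable (fun x => f x * f x) := hf.integrable_mul hfi
  have hm := hf.mul hf
  have key : ∀ x, f x * jumpOp ν f x ≤ (1 / 2) * jumpOp ν (fun y => f y * f y) x := by
    intro x
    have h1 : f x * avgOp ν f x ≤ (1 / 2) * (ν.real univ * (f x * f x)
        + avgOp ν (fun y => f y * f y) x) := by
      unfold avgOp
      have : ν.real univ * (f x * f x) = ∫ _, f x * f x ∂ν := by simp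
      rw [this, ← integral_add (integrable_const _) (hm.integrable_shift x),
        ← integral_const_mul, ← integral_const_mul]
      refine integral_mono ((hf.integrable_shift x).const_mul _)
        (((integrable_const _).add (hm.integrable_shift x)).const_mul _) fun z => ?_
      simp only
      nlinarith [sq_nonneg (f x - f (x + z))]
    unfold jumpOp
    nlinarith
  calc ∫ x, f x * jumpOp ν f x ≤ ∫ x, (1 / 2) * jumpOp ν (fun y => f y * f y) x :=
        integral_mono (hf.jumpOp.integrable_mul hfi)
          ((integrable_jumpOp hm.meas hf2).const_mul _) key
    _ = 0 := by rw [integral_const_mul, integral_jumpOp hm.meas hf2, mul_zero]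

end JumpOperator

noncomputable section Resolvent

variable {N : ℕ} {ν : Measure (Euc N)} [IsFiniteMeasure ν] {f g : Euc N → ℝ}

/-- Solvability of `ε g - L g = f` for the jump operator `L` of a finite measure, with the
contraction bounds in `L^∞` and in `L¹`. -/
lemma exists_resolvent {ε : ℝ} (hε : 0 < ε) (hf : IsBddMeas f) (hfi : Integrable f) {C : ℝ}
    (hC : ∀ x, |f x| ≤ C) :
    ∃ g : Euc N → ℝ, IsBddMeas g ∧ Integrable g ∧ (∀ x, ε * g x - jumpOp ν g x = f x) ∧
      (∀ x, ε * |g x| ≤ C) ∧ ε * ∫ x, |g x| ≤ ∫ x, |f x| := by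
  set m := ν.real univ with hm
  have hm0 : 0 ≤ m := measureReal_nonneg
  have hem : 0 < ε + m := by linarith
  set c := (ε + m)⁻¹ with hc
  have hc0 : 0 < c := inv_pos.mpr hem
  have hcem : c * (ε + m) = 1 := inv_mul_cancel₀ hem.ne'
  have hq0 : 0 ≤ c * m := by positivity
  have hq1 : c * m < 1 := by nlinarith
  have hB : ∀ k, IsBddMeas ((avgOp ν)^[k] f) := by
    intro k
    induction k with
    | zero => exact hf
    | succ k ih => rw [Function.iterate_succ_apply']; exact ih.avgOp
  have hI : ∀ k, Integrable ((avgOp ν)^[k] f) := by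
    intro k
    induction k with
    | zero => exact hfi
    | succ k ih => rw [Function.iterate_succ_apply']; exact integrable_avgOp (hB k).meas ih
  have hb : ∀ k x, |(avgOp ν)^[k] f x| ≤ m ^ k * C := by
    intro k
    induction k with
    | zero => simpa using hC
    | succ k ih =>
      intro x
      rw [Function.iterate_succ_apply']
      exact (abs_avgOp_le ih x).trans_eq (by rw [pow_succ]; ring)
  have hL : ∀ k, ∫ x, |(avgOp ν)^[k] f x| ≤ m ^ k * ∫ x, |f x| := by
    intro k
    induction k with
    | zero => simp
    | succ k ih =>
      rw [Function.iterate_succ_apply']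
      calc _ ≤ m * ∫ x, |(avgOp ν)^[k] f x| := integral_abs_avgOp_le (hB k) (hI k)
        _ ≤ m * (m ^ k * ∫ x, |f x|) := by gcongr
        _ = _ := by rw [pow_succ]; ring
  set s : ℕ → Euc N → ℝ := fun k x => c ^ (k + 1) * (avgOp ν)^[k] f x with hs
  have hsB : ∀ k, IsBddMeas (s k) := fun k => (hB k).const_mul _
  have hsI : ∀ k, Integrable (s k) := fun k => (hI k).const_mul _
  have hsb : ∀ k x, |s k x| ≤ (c * C) * (c * m) ^ k := by
    intro k x
    simp only [hs, abs_mul, abs_of_pos (pow_pos hc0 (k + 1))]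
    calc _ ≤ c ^ (k + 1) * (m ^ k * C) := by gcongr; exact hb k x
      _ = _ := by rw [mul_pow, pow_succ]; ring
  have hgeo : Summable fun k : ℕ => (c * C) * (c * m) ^ k :=
    (summable_geometric_of_lt_one hq0 hq1).mul_left _
  have hsum : ∀ x, Summable fun k => s k x := fun x =>
    Summable.of_norm_bounded hgeo (fun k => hsb k x)
  set G : Euc N → ℝ := fun x => ∑' k, s k x with hG
  have hGmeas : Measurable G := by
    refine measurable_of_tendsto_metrizable (f := fun n x => ∑ k ∈ Finset.range n, s k x)
      (fun n => Finset.measurable_fun_sum _ fun k _ => (hsB k).meas) ?_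
    exact tendsto_pi_nhds.mpr fun x => (hsum x).hasSum.tendsto_sum_nat
  have hsumq : c * C * (1 - c * m)⁻¹ = C / ε := by
    have : 1 - c * m = c * ε := by linarith
    rw [this, mul_inv]; field_simp
  have hGb : ∀ x, |G x| ≤ C / ε := by
    intro x
    rw [← hsumq, ← tsum_geometric_of_lt_one hq0 hq1, ← tsum_mul_left]
    exact tsum_of_norm_bounded (f := fun k => s k x) hgeo.hasSum (fun k => hsb k x)
  have hGB : IsBddMeas G := ⟨hGmeas, _, hGb⟩
  have hGI : Integrable G := by
    refine ⟨hGmeas.aestronglyMeasurable, ?_⟩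
    have hfin : ∑' k, ∫⁻ x, ‖s k x‖ₑ < ⊤ := by
      have h1 : ∀ k, ∫⁻ x, ‖s k x‖ₑ ≤ ENNReal.ofReal ((c * ∫ x, |f x|) * (c * m) ^ k) := by
        intro k
        rw [← ofReal_integral_norm_eq_lintegral_enorm (hsI k)]
        apply ENNReal.ofReal_le_ofReal
        simp only [hs, Real.norm_eq_abs, abs_mul, abs_of_pos (pow_pos hc0 (k + 1))]
        rw [integral_const_mul]
        calc _ ≤ c ^ (k + 1) * (m ^ k * ∫ x, |f x|) := by gcongr; exact hL k
          _ = _ := by rw [mul_pow, pow_succ]; ring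
      have h2 : Summable fun k : ℕ => (c * ∫ x, |f x|) * (c * m) ^ k :=
        (summable_geometric_of_lt_one hq0 hq1).mul_left _
      calc _ ≤ ∑' k, ENNReal.ofReal ((c * ∫ x, |f x|) * (c * m) ^ k) :=
            ENNReal.tsum_le_tsum h1
        _ = ENNReal.ofReal (∑' k, (c * ∫ x, |f x|) * (c * m) ^ k) :=
            (ENNReal.ofReal_tsum_of_nonneg (fun k => by
              have : 0 ≤ ∫ x, |f x| := integral_nonneg fun x => abs_nonneg _
              positivity) h2).symm
        _ < ⊤ := ENNReal.ofReal_lt_top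
    calc ∫⁻ x, ‖G x‖ₑ ≤ ∫⁻ x, ∑' k, ‖s k x‖ₑ :=
          lintegral_mono fun x => enorm_tsum_le_tsum_enorm
      _ = ∑' k, ∫⁻ x, ‖s k x‖ₑ :=
          lintegral_tsum fun k => (hsB k).meas.enorm.aemeasurable
      _ < ⊤ := hfin
  have havg : ∀ x, avgOp ν G x = ∑' k, avgOp ν (s k) x := by
    intro x
    refine (integral_tsum_of_summable_integral_norm (F := fun k z => s k (x + z))
      (fun k => (hsB k).integrable_shift x) ?_).symm
    refine Summable.of_nonneg_of_le (fun k => integral_nonneg fun z => norm_nonneg _)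
      (fun k => ?_) (hgeo.mul_left m)
    calc ∫ z, ‖s k (x + z)‖ ∂ν ≤ ∫ _, (c * C) * (c * m) ^ k ∂ν :=
          integral_mono ((hsB k).integrable_shift x).norm (integrable_const _)
            fun z => hsb k _
      _ = _ := by simp [hm]
  have hshift : ∀ k x, c * avgOp ν (s k) x = s (k + 1) x := by
    intro k x
    simp only [hs, avgOp, integral_const_mul, Function.iterate_succ_apply']
    ring
  have heq : ∀ x, G x = c * f x + c * avgOp ν G x := by
    intro x
    rw [havg, ← tsum_mul_left]
    simp only [hshift]
    rw [hG]
    simp only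
    rw [(hsum x).tsum_eq_zero_add]
    simp [hs]
  have heq' : ∀ x, (ε + m) * G x = f x + avgOp ν G x := by
    intro x
    have := heq x
    have h2 : (ε + m) * G x = (c * (ε + m)) * (f x + avgOp ν G x) := by rw [this]; ring
    rw [h2, hcem, one_mul]
  refine ⟨G, hGB, hGI, fun x => ?_, fun x => ?_, ?_⟩
  · unfold jumpOp; linarith [heq' x]
  · have := hGb x
    rw [le_div_iff₀ hε] at this; linarith
  · have h1 : (ε + m) * ∫ x, |G x| ≤ (∫ x, |f x|) + m * ∫ x, |G x| := by
      have h2 : ∀ x, (ε + m) * |G x| ≤ |f x| + |avgOp ν G x| := fun x => by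
        rw [← abs_of_pos hem, ← abs_mul, heq' x]; exact abs_add_le _ _
      have hAi := integrable_avgOp (ν := ν) hGB.meas hGI
      calc (ε + m) * ∫ x, |G x| = ∫ x, (ε + m) * |G x| := (integral_const_mul _ _).symm
        _ ≤ ∫ x, (|f x| + |avgOp ν G x|) :=
            integral_mono (hGI.abs.const_mul _) (hfi.abs.add hAi.abs) h2
        _ = (∫ x, |f x|) + ∫ x, |avgOp ν G x| := integral_add hfi.abs hAi.abs
        _ ≤ _ := by linarith [integral_abs_avgOp_le (ν := ν) hGB hGI]
    linarith

/-- The quadratic form `⟨g, (ε - L) k⟩` of a symmetric jump operator is symmetric. -/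
lemma resolvent_form_symm (hν : ν.map (fun z => -z) = ν) {ε : ℝ} {k : Euc N → ℝ}
    (hg : IsBddMeas g) (hgi : Integrable g) (hk : IsBddMeas k) :
    ∫ x, g x * (ε * k x - jumpOp ν k x) = ∫ x, k x * (ε * g x - jumpOp ν g x) := by
  have e1 : ∀ x, g x * (ε * k x - jumpOp ν k x) = ε * (g x * k x) - g x * jumpOp ν k x :=
    fun x => by ring
  have e2 : ∀ x, k x * (ε * g x - jumpOp ν g x) = ε * (g x * k x) - jumpOp ν g x * k x :=
    fun x => by ring
  simp only [e1, e2]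
  rw [integral_sub ((hk.integrable_mul hgi).const_mul _) (hk.jumpOp.integrable_mul hgi),
    integral_sub ((hk.integrable_mul hgi).const_mul _)
      (hk.integrable_mul (integrable_jumpOp hg.meas hgi)),
    integral_jumpOp_mul hν hg hgi hk]

/-- Coercivity of the quadratic form `⟨g, (ε - L) g⟩`. -/
lemma resolvent_form_coercive {ε : ℝ} (hg : IsBddMeas g) (hgi : Integrable g) :
    ε * ∫ x, g x ^ 2 ≤ ∫ x, g x * (ε * g x - jumpOp ν g x) := by
  have e1 : ∀ x, g x * (ε * g x - jumpOp ν g x) = ε * g x ^ 2 - g x * jumpOp ν g x :=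
    fun x => by ring
  have hsq : Integrable (fun x => g x ^ 2) := by
    simpa only [sq] using hg.integrable_mul hgi
  simp only [e1]
  rw [integral_sub (hsq.const_mul _) (hg.jumpOp.integrable_mul hgi), integral_const_mul]
  linarith [integral_mul_jumpOp_nonpos (ν := ν) hg hgi]

end Resolvent

noncomputable section Energy

variable {N : ℕ} {ν : Measure (Euc N)} [IsFiniteMeasure ν] {g g' W W' : Euc N → ℝ} {ε : ℝ}

lemma resolvent_energy_sub_le (hν : ν.map (fun z => -z) = ν) (hε : 0 ≤ ε)
    (hg : IsBddMeas g) (hgi : Integrable g) (hg' : IsBddMeas g') (hgi' : Integrable g')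
    (hW : IsBddMeas W) (hW' : IsBddMeas W')
    (hgW : ∀ x, ε * g x - jumpOp ν g x = W x) (hgW' : ∀ x, ε * g' x - jumpOp ν g' x = W' x) :
    (∫ x, g x * W x) - ∫ x, g' x * W' x ≤ 2 * ∫ x, g x * (W x - W' x) := by
  have hsym : ∫ x, g x * W' x = ∫ x, g' x * W x := by
    simp only [← hgW, ← hgW']
    exact resolvent_form_symm hν hg hgi hg'
  have hpos := resolvent_form_coercive (ν := ν) (ε := ε) (hg.sub hg') (hgi.sub hgi')
  have h0 : 0 ≤ ε * ∫ x, (g x - g' x) ^ 2 :=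
    mul_nonneg hε (integral_nonneg fun x => sq_nonneg _)
  have e1 : ∀ x, (g x - g' x) * (ε * (g x - g' x) - jumpOp ν (fun y => g y - g' y) x)
      = (g x * W x - g x * W' x) - (g' x * W x - g' x * W' x) := fun x => by
    rw [jumpOp_sub hg hg', ← hgW, ← hgW']; ring
  simp only [e1] at hpos
  have i1 := hW.integrable_mul hgi
  have i2 := hW'.integrable_mul hgi
  have i3 := hW.integrable_mul hgi'
  have i4 := hW'.integrable_mul hgi'
  have i12 : Integrable (fun x => g x * W x - g x * W' x) := i1.sub i2
  have i34 : Integrable (fun x => g' x * W x - g' x * W' x) := i3.sub i4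
  rw [integral_sub i12 i34, integral_sub i1 i2, integral_sub i3 i4] at hpos
  simp only [mul_sub]
  rw [integral_sub i1 i2]
  linarith

/-- Cauchy–Schwarz inequality for the form `⟨g, (ε - L) θ⟩`. -/
lemma sq_integral_mul_le_resolvent_energy (hν : ν.map (fun z => -z) = ν) (hε : 0 ≤ ε)
    (hg : IsBddMeas g) (hgi : Integrable g) (hW : IsBddMeas W)
    (hgW : ∀ x, ε * g x - jumpOp ν g x = W x) {θ : Euc N → ℝ} (hθ : IsBddMeas θ)
    (hθi : Integrable θ) :
    (∫ x, θ x * W x) ^ 2 ≤ (∫ x, g x * W x) * ∫ x, θ x * (ε * θ x - jumpOp ν θ x) := by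
  set Θ : Euc N → ℝ := fun x => ε * θ x - jumpOp ν θ x with hΘ
  have hΘB : IsBddMeas Θ := (hθ.const_mul ε).sub hθ.jumpOp
  have hsym : ∫ x, g x * Θ x = ∫ x, θ x * W x := by
    simp only [← hgW, hΘ]
    exact resolvent_form_symm hν hg hgi hθ
  have key : ∀ s : ℝ, 0 ≤ (∫ x, θ x * Θ x) * (s * s) + (-2 * ∫ x, θ x * W x) * s
      + ∫ x, g x * W x := by
    intro s
    have hsθ := hθ.const_mul s
    have hsθi := hθi.const_mul s
    have hpos := resolvent_form_coercive (ν := ν) (ε := ε) (hg.sub hsθ) (hgi.sub hsθi)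
    have h0 : 0 ≤ ε * ∫ x, (g x - s * θ x) ^ 2 :=
      mul_nonneg hε (integral_nonneg fun x => sq_nonneg _)
    have hj : ∀ x, jumpOp ν (fun y => s * θ y) x = s * jumpOp ν θ x := fun x => by
      simp only [jumpOp, avgOp, integral_const_mul]; ring
    have e1 : ∀ x, (g x - s * θ x) * (ε * (g x - s * θ x)
        - jumpOp ν (fun y => g y - s * θ y) x)
        = (g x * W x - s * (g x * Θ x)) - (s * (θ x * W x) - s * s * (θ x * Θ x)) := fun x => by
      rw [jumpOp_sub hg hsθ, hj, ← hgW, hΘ]; ring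
    simp only [e1] at hpos
    have i1 := hW.integrable_mul hgi
    have i2 := (hΘB.integrable_mul hgi).const_mul s
    have i3 := (hW.integrable_mul hθi).const_mul s
    have i4 := (hΘB.integrable_mul hθi).const_mul (s * s)
    have i12 : Integrable (fun x => g x * W x - s * (g x * Θ x)) := i1.sub i2
    have i34 : Integrable (fun x => s * (θ x * W x) - s * s * (θ x * Θ x)) := i3.sub i4
    rw [integral_sub i12 i34, integral_sub i1 i2, integral_sub i3 i4,
      integral_const_mul, integral_const_mul, integral_const_mul, hsym] at hpos
    linarith
  have := discrim_le_zero key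
  unfold discrim at this
  nlinarith

/-- One step of the energy estimate for the difference of two approximate solutions. -/
lemma resolvent_energy_step (hν : ν.map (fun z => -z) = ν) (hε : 0 < ε)
    {φ : ℝ → ℝ} (hφm : Monotone φ) {M δ K : ℝ} (hδ : 0 ≤ δ) (hK : 0 < K)
    (hmod : ∀ a b, |a| ≤ M → |b| ≤ M → |φ a - φ b| ≤ δ + K * |a - b|)
    {U w : Euc N → ℝ} (hUb : ∀ x, |U x| ≤ M) (hwb : ∀ x, |w x| ≤ M)
    (hWUw : ∀ x, W x = U x - w x) (hW : IsBddMeas W) (hWi : Integrable W) (hW' : IsBddMeas W')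
    (hg : IsBddMeas g) (hgi : Integrable g) (hg' : IsBddMeas g') (hgi' : Integrable g')
    (hgW : ∀ x, ε * g x - jumpOp ν g x = W x) (hgW' : ∀ x, ε * g' x - jumpOp ν g' x = W' x)
    (hgb : ∀ x, ε * |g x| ≤ 2 * M) (hg1 : ε * ∫ x, |g x| ≤ ∫ x, |W x|)
    {P e R : Euc N → ℝ} {h η : ℝ} (hh : 0 ≤ h) (hP : IsBddMeas P) (he : IsBddMeas e)
    (heb : ∀ x, |e x| ≤ η) (hstep : ∀ x, W x - W' x = h * (jumpOp ν P x + e x))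
    (hR : Integrable R) (hR0 : ∀ x, 0 ≤ R x)
    (hPR : ∀ x, |P x - (φ (U x) - φ (w x))| ≤ 3 * δ + R x) :
    (∫ x, g x * W x) - ∫ x, g' x * W' x ≤ 2 * h * ((8 * δ + η / ε) * (∫ x, |W x|)
      + 4 * M * (∫ x, R x) + K / 2 * ε * ∫ x, g x * W x) := by
  have hsub := resolvent_energy_sub_le hν hε.le hg hgi hg' hgi' hW hW' hgW hgW'
  have hη : 0 ≤ η := (abs_nonneg _).trans (heb 0)
  have hsplit : ∫ x, g x * (W x - W' x)
      = h * ((∫ x, (ε * g x - W x) * P x) + ∫ x, g x * e x) := by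
    have e1 : ∀ x, g x * (W x - W' x) = h * (g x * jumpOp ν P x + g x * e x) := fun x => by
      rw [hstep]; ring
    have e2 : ∀ x, (ε * g x - W x) * P x = jumpOp ν g x * P x := fun x => by
      rw [← hgW]; ring
    simp only [e1, e2]
    rw [integral_const_mul, integral_add (hP.jumpOp.integrable_mul hgi)
      (he.integrable_mul hgi), integral_jumpOp_mul hν hg hgi hP]
  have hpt : ∀ x, (ε * g x - W x) * P x ≤ 5 * δ * ε * |g x| + K / 2 * ε ^ 2 * g x ^ 2
      + 3 * δ * |W x| + 4 * M * R x := by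
    intro x
    set b := ε * g x with hb
    set F := φ (U x) - φ (w x) with hF
    have hbabs : |b| = ε * |g x| := by rw [hb, abs_mul, abs_of_pos hε]
    have hWF : 0 ≤ W x * F := by
      rw [hWUw]
      rcases le_total (w x) (U x) with h1 | h1
      · exact mul_nonneg (by linarith) (by linarith [hφm h1])
      · exact mul_nonneg_of_nonpos_of_nonpos (by linarith) (by linarith [hφm h1])
    have hFW : |F| ≤ δ + K * |W x| := by rw [hWUw]; exact hmod _ _ (hUb x) (hwb x)
    have hbF : b * F ≤ |b| * |F| := (le_abs_self _).trans (abs_mul b F).le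
    have hmain : (b - W x) * F ≤ 2 * δ * |b| + K / 2 * b ^ 2 := by
      by_cases hcase : |F| ≤ 2 * δ
      · have : |b| * |F| ≤ |b| * (2 * δ) := by gcongr
        nlinarith [mul_nonneg hK.le (sq_nonneg b)]
      · push Not at hcase
        have h1 : |F| ≤ 2 * K * |W x| := by linarith
        have h2 : |F| ^ 2 ≤ 2 * K * (W x * F) := by
          have : W x * F = |W x| * |F| := by rw [← abs_mul, abs_of_nonneg hWF]
          rw [this]
          nlinarith [abs_nonneg F]
        have h3 : 2 * K * (|b| * |F|) ≤ K ^ 2 * b ^ 2 + |F| ^ 2 := by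
          nlinarith [sq_nonneg (K * |b| - |F|), sq_abs b]
        have h4 : 2 * K * ((b - W x) * F) ≤ 2 * K * (K / 2 * b ^ 2) := by nlinarith
        have h5 := le_of_mul_le_mul_left h4 (by positivity)
        nlinarith [abs_nonneg b, mul_nonneg hδ (abs_nonneg b)]
    have herr : (b - W x) * (P x - F) ≤ (|b| + |W x|) * (3 * δ) + 4 * M * R x := by
      have h1 : |b - W x| ≤ |b| + |W x| := abs_sub _ _
      have hWb : |W x| ≤ 2 * M := by
        rw [hWUw]; linarith [abs_sub (U x) (w x), hUb x, hwb x]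
      have h2 : |b - W x| ≤ 4 * M := by linarith [hgb x]
      calc (b - W x) * (P x - F) ≤ |b - W x| * |P x - F| := by
            rw [← abs_mul]; exact le_abs_self _
        _ ≤ |b - W x| * (3 * δ + R x) := by gcongr; exact hPR x
        _ = |b - W x| * (3 * δ) + |b - W x| * R x := by ring
        _ ≤ _ := by gcongr; exact hR0 x
    have : (b - W x) * P x = (b - W x) * F + (b - W x) * (P x - F) := by ring
    rw [this]
    have hb2 : b ^ 2 = ε ^ 2 * g x ^ 2 := by rw [hb]; ring
    rw [hb2, hbabs] at hmain
    rw [hbabs] at herr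
    linarith
  have hsq : Integrable (fun x => g x ^ 2) := by
    simpa only [sq] using hg.integrable_mul hgi
  have hInt : ∫ x, (ε * g x - W x) * P x ≤ 8 * δ * (∫ x, |W x|) + 4 * M * (∫ x, R x)
      + K / 2 * ε * ∫ x, g x * W x := by
    have i1 : Integrable (fun x => 5 * δ * ε * |g x|) := hgi.abs.const_mul _
    have i2 : Integrable (fun x => K / 2 * ε ^ 2 * g x ^ 2) := hsq.const_mul _
    have i3 : Integrable (fun x => 3 * δ * |W x|) := hWi.abs.const_mul _
    have i4 : Integrable (fun x => 4 * M * R x) := hR.const_mul _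
    have i12 : Integrable (fun x => 5 * δ * ε * |g x| + K / 2 * ε ^ 2 * g x ^ 2) := i1.add i2
    have i123 : Integrable (fun x => 5 * δ * ε * |g x| + K / 2 * ε ^ 2 * g x ^ 2
      + 3 * δ * |W x|) := i12.add i3
    have igW : Integrable (fun x => ε * g x - W x) := (hgi.const_mul ε).sub hWi
    have hle := integral_mono (hP.integrable_mul igW) (i123.add i4) hpt
    simp only [Pi.add_apply] at hle
    rw [integral_add i123 i4, integral_add i12 i3, integral_add i1 i2,
      integral_const_mul, integral_const_mul, integral_const_mul, integral_const_mul] at hle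
    have hco := resolvent_form_coercive (ν := ν) (ε := ε) hg hgi
    simp only [hgW] at hco
    have h5 : 5 * δ * ε * (∫ x, |g x|) ≤ 5 * δ * ∫ x, |W x| := by
      rw [mul_assoc]; gcongr
    have h6 : K / 2 * ε ^ 2 * (∫ x, g x ^ 2) ≤ K / 2 * ε * ∫ x, g x * W x := by
      calc _ = K / 2 * ε * (ε * ∫ x, g x ^ 2) := by ring
        _ ≤ _ := by gcongr
    exact hle.trans (by linarith)
  have hge : ∫ x, g x * e x ≤ η / ε * ∫ x, |W x| := by
    calc ∫ x, g x * e x ≤ ∫ x, η * |g x| := by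
          refine integral_mono (he.integrable_mul hgi) (hgi.abs.const_mul _) fun x => ?_
          calc g x * e x ≤ |g x| * |e x| := by rw [← abs_mul]; exact le_abs_self _
            _ ≤ |g x| * η := by gcongr; exact heb x
            _ = _ := mul_comm _ _
      _ = η / ε * (ε * ∫ x, |g x|) := by rw [integral_const_mul]; field_simp
      _ ≤ _ := by gcongr
  calc _ ≤ 2 * ∫ x, g x * (W x - W' x) := hsub
    _ = 2 * h * ((∫ x, (ε * g x - W x) * P x) + ∫ x, g x * e x) := by rw [hsplit]; ring
    _ ≤ 2 * h * ((8 * δ * (∫ x, |W x|) + 4 * M * (∫ x, R x)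
      + K / 2 * ε * ∫ x, g x * W x) + η / ε * ∫ x, |W x|) := by gcongr
    _ = _ := by ring

end Energy

noncomputable section Euler

variable {N : ℕ}

/-- One step of the explicit Euler scheme for `∂_t w = L[ψ(w)]`, with `L` the jump operator of
the finite measure `ν`. -/
def eulerStep (ν : Measure (Euc N)) (ψ : ℝ → ℝ) (h : ℝ) (w : Euc N → ℝ) (x : Euc N) : ℝ :=
  w x + h * jumpOp ν (fun y => ψ (w y)) x

/-- The nonlinearity `ψ` is nondecreasing and Lipschitz, vanishes at zero, and satisfies with the
time step `h` the CFL condition for the jump operator of `ν`. -/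
structure IsCFL (ν : Measure (Euc N)) (ψ : ℝ → ℝ) (Λ h : ℝ) : Prop where
  mono : Monotone ψ
  lip : ∀ a b, |ψ a - ψ b| ≤ Λ * |a - b|
  zero : ψ 0 = 0
  nonneg : 0 ≤ h
  cfl : h * ν.real univ * Λ ≤ 1

variable {ν : Measure (Euc N)} {ψ : ℝ → ℝ} {Λ h : ℝ} {w w₁ w₂ : Euc N → ℝ}

namespace IsCFL

lemma lip_nonneg (H : IsCFL ν ψ Λ h) : 0 ≤ Λ := by
  have := (abs_nonneg _).trans (H.lip 1 0)
  simpa using this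

lemma continuous (H : IsCFL ν ψ Λ h) : Continuous ψ :=
  (LipschitzWith.of_dist_le_mul (K := Λ.toNNReal) fun a b => by
    rw [Real.coe_toNNReal _ H.lip_nonneg]; exact H.lip a b).continuous

lemma abs_le (H : IsCFL ν ψ Λ h) (a : ℝ) : |ψ a| ≤ Λ * |a| := by
  simpa [H.zero] using H.lip a 0

lemma comp (H : IsCFL ν ψ Λ h) (hw : IsBddMeas w) : IsBddMeas (fun x => ψ (w x)) :=
  hw.comp_continuous H.continuous

lemma integrable_comp (H : IsCFL ν ψ Λ h) (hw : IsBddMeas w) (hwi : Integrable w) :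
    Integrable (fun x => ψ (w x)) :=
  Integrable.mono' (hwi.abs.const_mul Λ) (H.comp hw).meas.aestronglyMeasurable
    (Eventually.of_forall fun _ => H.abs_le _)

variable [IsFiniteMeasure ν]

lemma eulerStep_bddMeas (H : IsCFL ν ψ Λ h) (hw : IsBddMeas w) :
    IsBddMeas (eulerStep ν ψ h w) :=
  hw.add ((H.comp hw).jumpOp.const_mul h)

lemma eulerStep_integrable (H : IsCFL ν ψ Λ h) (hw : IsBddMeas w) (hwi : Integrable w) :
    Integrable (eulerStep ν ψ h w) :=
  hwi.add ((integrable_jumpOp (H.comp hw).meas (H.integrable_comp hw hwi)).const_mul h)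

lemma eulerStep_mono (H : IsCFL ν ψ Λ h) (h₁ : IsBddMeas w₁) (h₂ : IsBddMeas w₂)
    (hle : ∀ x, w₁ x ≤ w₂ x) (x : Euc N) : eulerStep ν ψ h w₁ x ≤ eulerStep ν ψ h w₂ x := by
  have h1 := mul_le_mul_of_nonneg_left (avgOp_mono (ν := ν) (H.comp h₁) (H.comp h₂)
    (fun y => H.mono (hle y)) x) H.nonneg
  have h2 : ψ (w₂ x) - ψ (w₁ x) ≤ Λ * (w₂ x - w₁ x) := by
    have := (le_abs_self _).trans (H.lip (w₂ x) (w₁ x))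
    rwa [abs_of_nonneg (sub_nonneg.2 (hle x))] at this
  have hm : 0 ≤ h * ν.real univ := mul_nonneg H.nonneg measureReal_nonneg
  have h3 := mul_le_mul_of_nonneg_left h2 hm
  have h4 := mul_le_mul_of_nonneg_right H.cfl (sub_nonneg.2 (hle x))
  unfold eulerStep jumpOp
  nlinarith

lemma eulerStep_const (c : ℝ) (x : Euc N) : eulerStep ν ψ h (fun _ => c) x = c := by
  simp [eulerStep, jumpOp_const]

lemma abs_eulerStep_le (H : IsCFL ν ψ Λ h) (hw : IsBddMeas w) {M : ℝ} (hM : ∀ x, |w x| ≤ M)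
    (x : Euc N) : |eulerStep ν ψ h w x| ≤ M := by
  rw [_root_.abs_le]
  constructor
  · rw [← eulerStep_const (ν := ν) (ψ := ψ) (h := h) (-M) x]
    exact H.eulerStep_mono (IsBddMeas.const _) hw (fun y => (_root_.abs_le.1 (hM y)).1) x
  · rw [← eulerStep_const (ν := ν) (ψ := ψ) (h := h) M x]
    exact H.eulerStep_mono hw (IsBddMeas.const _) (fun y => (_root_.abs_le.1 (hM y)).2) x

lemma integral_eulerStep_sub (H : IsCFL ν ψ Λ h) (h₁ : IsBddMeas w₁) (i₁ : Integrable w₁)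
    (h₂ : IsBddMeas w₂) (i₂ : Integrable w₂) :
    ∫ x, (eulerStep ν ψ h w₁ x - eulerStep ν ψ h w₂ x) = ∫ x, (w₁ x - w₂ x) := by
  have key : ∀ {w : Euc N → ℝ}, IsBddMeas w → Integrable w →
      ∫ x, eulerStep ν ψ h w x = ∫ x, w x := fun {w} hw hwi => by
    unfold eulerStep
    rw [integral_add hwi ((integrable_jumpOp (H.comp hw).meas
      (H.integrable_comp hw hwi)).const_mul h), integral_const_mul,
      integral_jumpOp (H.comp hw).meas (H.integrable_comp hw hwi), mul_zero, add_zero]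
  rw [integral_sub (H.eulerStep_integrable h₁ i₁) (H.eulerStep_integrable h₂ i₂), key h₁ i₁,
    key h₂ i₂, integral_sub i₁ i₂]

/-- The Euler step is a `T`-contraction of `L¹`. -/
lemma integral_posPart_eulerStep_le (H : IsCFL ν ψ Λ h) (h₁ : IsBddMeas w₁)
    (i₁ : Integrable w₁) (h₂ : IsBddMeas w₂) (i₂ : Integrable w₂) :
    ∫ x, max (eulerStep ν ψ h w₁ x - eulerStep ν ψ h w₂ x) 0 ≤ ∫ x, max (w₁ x - w₂ x) 0 := by
  set w : Euc N → ℝ := fun x => max (w₁ x) (w₂ x) with hw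
  have hwB : IsBddMeas w := by
    obtain ⟨C, hC⟩ := h₁.bdd
    obtain ⟨D, hD⟩ := h₂.bdd
    exact ⟨h₁.meas.max h₂.meas, max C D, fun x =>
      abs_max_le_max_abs_abs.trans (max_le_max (hC x) (hD x))⟩
  have hwi : Integrable w := i₁.sup i₂
  have e : ∀ x, max (w₁ x - w₂ x) 0 = w x - w₂ x := fun x => by
    rw [hw, ← max_sub_sub_right, sub_self]
  simp only [e]
  rw [← H.integral_eulerStep_sub hwB hwi h₂ i₂]
  refine integral_mono
    ((H.eulerStep_integrable h₁ i₁).sub (H.eulerStep_integrable h₂ i₂)).pos_part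
    ((H.eulerStep_integrable hwB hwi).sub (H.eulerStep_integrable h₂ i₂)) fun x => ?_
  refine max_le ?_ ?_
  · exact sub_le_sub_right (H.eulerStep_mono h₁ hwB (fun y => le_max_left _ _) x) _
  · exact sub_nonneg.2 (H.eulerStep_mono h₂ hwB (fun y => le_max_right _ _) x)

lemma integral_abs_eulerStep_le (H : IsCFL ν ψ Λ h) (hw : IsBddMeas w) (hwi : Integrable w) :
    ∫ x, |eulerStep ν ψ h w x| ≤ ∫ x, |w x| := by
  have h0 : ∀ f : Euc N → ℝ, Integrable f →
      ∫ x, |f x| = (∫ x, max (f x - 0) 0) + ∫ x, max (0 - f x) 0 := fun f hf => by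
    rw [← integral_add (by simpa using hf.pos_part) (by simpa using hf.neg_part)]
    congr 1; ext x
    rcases le_total 0 (f x) with h | h
    · rw [abs_of_nonneg h, max_eq_left (by linarith), max_eq_right (by linarith)]; ring
    · rw [abs_of_nonpos h, max_eq_right (by linarith), max_eq_left (by linarith)]; ring
  rw [h0 _ hwi, h0 _ (H.eulerStep_integrable hw hwi)]
  have a := H.integral_posPart_eulerStep_le hw hwi (IsBddMeas.const 0)
    (integrable_zero (Euc N) ℝ volume)
  have b := H.integral_posPart_eulerStep_le (IsBddMeas.const 0)
    (integrable_zero (Euc N) ℝ volume) hw hwi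
  simp only [eulerStep_const] at a b
  exact add_le_add a b

lemma integral_abs_eulerStep_sub_le (H : IsCFL ν ψ Λ h) (hw : IsBddMeas w)
    (hwi : Integrable w) :
    ∫ x, |eulerStep ν ψ h w x - w x| ≤ 2 * h * ν.real univ * Λ * ∫ x, |w x| := by
  have hψi := H.integrable_comp hw hwi
  have h1 : ∫ x, |jumpOp ν (fun y => ψ (w y)) x| ≤ 2 * ν.real univ * ∫ x, |ψ (w x)| := by
    calc _ ≤ ∫ x, (|avgOp ν (fun y => ψ (w y)) x| + ν.real univ * |ψ (w x)|) := by
          refine integral_mono (integrable_jumpOp (H.comp hw).meas hψi).abs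
            ((integrable_avgOp (H.comp hw).meas hψi).abs.add (hψi.abs.const_mul _)) fun x => ?_
          refine (abs_sub _ _).trans (le_of_eq ?_)
          rw [abs_mul, abs_of_nonneg measureReal_nonneg]
      _ = (∫ x, |avgOp ν (fun y => ψ (w y)) x|) + ν.real univ * ∫ x, |ψ (w x)| := by
          rw [integral_add (integrable_avgOp (H.comp hw).meas hψi).abs (hψi.abs.const_mul _),
            integral_const_mul]
      _ ≤ _ := by linarith [integral_abs_avgOp_le (ν := ν) (H.comp hw) hψi]
  have h2 : ∫ x, |ψ (w x)| ≤ Λ * ∫ x, |w x| := by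
    rw [← integral_const_mul]
    exact integral_mono hψi.abs (hwi.abs.const_mul _) fun x => H.abs_le _
  have h3 : ∀ x, |eulerStep ν ψ h w x - w x| = h * |jumpOp ν (fun y => ψ (w y)) x| := fun x => by
    rw [eulerStep, add_sub_cancel_left, abs_mul, abs_of_nonneg H.nonneg]
  simp only [h3]
  rw [integral_const_mul]
  have hm : 0 ≤ ν.real univ := measureReal_nonneg
  calc _ ≤ h * (2 * ν.real univ * (Λ * ∫ x, |w x|)) := by
        have := H.nonneg
        gcongr
        exact h1.trans (by gcongr)
    _ = _ := by ring

section Iterates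

lemma iterate_bddMeas (H : IsCFL ν ψ Λ h) (hw : IsBddMeas w) (n : ℕ) :
    IsBddMeas ((eulerStep ν ψ h)^[n] w) := by
  induction n with
  | zero => exact hw
  | succ n ih => rw [Function.iterate_succ_apply']; exact H.eulerStep_bddMeas ih

lemma iterate_integrable (H : IsCFL ν ψ Λ h) (hw : IsBddMeas w) (hwi : Integrable w) (n : ℕ) :
    Integrable ((eulerStep ν ψ h)^[n] w) := by
  induction n with
  | zero => exact hwi
  | succ n ih =>
    rw [Function.iterate_succ_apply']; exact H.eulerStep_integrable (H.iterate_bddMeas hw n) ih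

lemma abs_iterate_le (H : IsCFL ν ψ Λ h) (hw : IsBddMeas w) {M : ℝ} (hM : ∀ x, |w x| ≤ M)
    (n : ℕ) (x : Euc N) : |(eulerStep ν ψ h)^[n] w x| ≤ M := by
  induction n generalizing x with
  | zero => exact hM x
  | succ n ih =>
    rw [Function.iterate_succ_apply']; exact H.abs_eulerStep_le (H.iterate_bddMeas hw n) ih x

lemma integral_abs_iterate_le (H : IsCFL ν ψ Λ h) (hw : IsBddMeas w) (hwi : Integrable w)
    (n : ℕ) : ∫ x, |(eulerStep ν ψ h)^[n] w x| ≤ ∫ x, |w x| := by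
  induction n with
  | zero => exact le_rfl
  | succ n ih =>
    rw [Function.iterate_succ_apply']
    exact (H.integral_abs_eulerStep_le (H.iterate_bddMeas hw n)
      (H.iterate_integrable hw hwi n)).trans ih

lemma integral_posPart_iterate_le (H : IsCFL ν ψ Λ h) (h₁ : IsBddMeas w₁)
    (i₁ : Integrable w₁) (h₂ : IsBddMeas w₂) (i₂ : Integrable w₂) (n : ℕ) :
    ∫ x, max ((eulerStep ν ψ h)^[n] w₁ x - (eulerStep ν ψ h)^[n] w₂ x) 0
      ≤ ∫ x, max (w₁ x - w₂ x) 0 := by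
  induction n with
  | zero => exact le_rfl
  | succ n ih =>
    simp only [Function.iterate_succ_apply']
    exact (H.integral_posPart_eulerStep_le (H.iterate_bddMeas h₁ n)
      (H.iterate_integrable h₁ i₁ n) (H.iterate_bddMeas h₂ n)
      (H.iterate_integrable h₂ i₂ n)).trans ih

end Iterates

end IsCFL

end Euler

noncomputable section Modulus

/-- An affine modulus of continuity on bounded intervals. -/
lemma exists_affine_modulus {φ : ℝ → ℝ} (hφ : Continuous φ) (M : ℝ) {δ : ℝ} (hδ : 0 < δ) :
    ∃ K, 0 < K ∧ ∀ a b, |a| ≤ M → |b| ≤ M → |φ a - φ b| ≤ δ + K * |a - b| := by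
  obtain ⟨B, hB⟩ := (isCompact_Icc (a := -M) (b := M)).exists_bound_of_continuousOn
    hφ.continuousOn
  have huc := (isCompact_Icc (a := -M) (b := M)).uniformContinuousOn_of_continuous
    hφ.continuousOn
  obtain ⟨r, hr, H⟩ := Metric.uniformContinuousOn_iff.1 huc δ hδ
  refine ⟨(2 * |B| + 1) / r, by positivity, fun a b ha hb => ?_⟩
  rcases lt_or_ge |a - b| r with h | h
  · have := H a (abs_le.1 ha) b (abs_le.1 hb) h
    rw [Real.dist_eq] at this
    have : 0 ≤ (2 * |B| + 1) / r * |a - b| := by positivity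
    linarith
  · have h1 : |φ a - φ b| ≤ 2 * |B| := by
      have e1 : |φ a| ≤ B := hB a (abs_le.1 ha)
      have e2 : |φ b| ≤ B := hB b (abs_le.1 hb)
      linarith [abs_sub (φ a) (φ b), le_abs_self B]
    have h2 : (2 * |B| + 1) ≤ (2 * |B| + 1) / r * |a - b| := by
      rw [div_mul_eq_mul_div, le_div_iff₀ hr]
      gcongr
    linarith

/-- Approximation of a nondecreasing function, up to a constant, by nondecreasing Lipschitz
functions vanishing at zero. -/
lemma exists_monotone_lipschitz_approx {φ : ℝ → ℝ} (hφ : Monotone φ) {M δ K : ℝ}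
    (hM : 0 ≤ M) (hδ : 0 ≤ δ) (hK : 0 < K)
    (hmod : ∀ a b, |a| ≤ M → |b| ≤ M → |φ a - φ b| ≤ δ + K * |a - b|) :
    ∃ (ψ : ℝ → ℝ) (c : ℝ), Monotone ψ ∧ (∀ a b, |ψ a - ψ b| ≤ K * |a - b|) ∧ ψ 0 = 0 ∧
      ∀ s, |s| ≤ M → |φ s - c - ψ s| ≤ δ := by
  set q : ℝ → ℝ := fun s => max (min M s) (-M) with hq
  have hqm : Monotone q := fun a b h => max_le_max_right _ (min_le_min_left _ h)
  have hqb : ∀ s, |q s| ≤ M := fun s => abs_le.2 ⟨le_max_right _ _,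
    max_le (min_le_left _ _) (by linarith)⟩
  have hqs : ∀ s, |s| ≤ M → q s = s := fun s hs => by
    rw [hq]; simp only [min_eq_right (abs_le.1 hs).2, max_eq_left (abs_le.1 hs).1]
  have hqd : ∀ a b, |q a - q b| ≤ |a - b| := fun a b =>
    (abs_max_sub_max_le_abs _ _ _).trans (by
      simpa [min_comm] using abs_min_sub_min_le_max M a M b)
  have hmodq : ∀ a b, φ (q a) ≤ φ (q b) + K * |a - b| + δ := fun a b => by
    have h1 := (le_abs_self _).trans (hmod _ _ (hqb a) (hqb b))
    have h2 := mul_le_mul_of_nonneg_left (hqd a b) hK.le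
    linarith
  have hlow : ∀ s, BddBelow (range fun b => φ (q b) + K * |s - b|) := fun s =>
    ⟨φ (q s) - δ, by rintro _ ⟨b, rfl⟩; linarith [hmodq s b]⟩
  set ψ₀ : ℝ → ℝ := fun s => ⨅ b, (φ (q b) + K * |s - b|) with hψ₀
  have hlip : ∀ a b, ψ₀ a - ψ₀ b ≤ K * |a - b| := fun a b => by
    rw [sub_le_iff_le_add', ← sub_le_iff_le_add]
    refine le_ciInf fun d => ?_
    have h1 : ψ₀ a ≤ φ (q d) + K * |a - d| := ciInf_le (hlow a) d
    have h2 := mul_le_mul_of_nonneg_left (abs_sub_le a b d) hK.le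
    linarith
  have hmono : Monotone ψ₀ := fun a b hab => by
    refine le_ciInf fun d => ?_
    refine (ciInf_le (hlow a) (d - (b - a))).trans ?_
    have h1 : a - (d - (b - a)) = b - d := by ring
    rw [h1]
    gcongr
    exact hφ (hqm (by linarith))
  refine ⟨fun s => ψ₀ s - ψ₀ 0, ψ₀ 0, fun a b h => sub_le_sub_right (hmono h) _, fun a b => ?_,
    sub_self _, fun s hs => ?_⟩
  · have e : ψ₀ a - ψ₀ 0 - (ψ₀ b - ψ₀ 0) = ψ₀ a - ψ₀ b := by ring
    rw [e, abs_le]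
    have := hlip b a
    rw [abs_sub_comm] at this
    exact ⟨by linarith, hlip a b⟩
  · have e : φ s - ψ₀ 0 - (ψ₀ s - ψ₀ 0) = φ s - ψ₀ s := by ring
    have h1 : ψ₀ s ≤ φ s := by
      have := ciInf_le (hlow s) s
      simpa [hqs s hs] using this
    have h2 : φ s - δ ≤ ψ₀ s := le_ciInf fun b => by
      have := hmodq s b
      rw [hqs s hs] at this
      linarith
    rw [e, abs_le]
    constructor <;> linarith

end Modulus

noncomputable section Levy

variable {N : ℕ} {μ : Measure (Euc N)}

/-- The part of `μ` carried by the jumps of size larger than `r`. -/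
def levyTail (μ : Measure (Euc N)) (r : ℝ) : Measure (Euc N) := μ.restrict {z | r < ‖z‖}

lemma measurableSet_lt_norm (r : ℝ) : MeasurableSet {z : Euc N | r < ‖z‖} :=
  measurableSet_lt measurable_const measurable_norm

namespace IsLevyMeasure

lemma integrable_min (hμ : IsLevyMeasure μ) : Integrable (fun z => min (‖z‖ ^ 2) 1) μ := by
  refine ⟨(by fun_prop : Measurable fun z : Euc N => min (‖z‖ ^ 2) 1).aestronglyMeasurable, ?_⟩
  rw [hasFiniteIntegral_iff_ofReal (Eventually.of_forall fun z => by positivity)]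
  exact hμ.2.2.lt_top

lemma isFiniteMeasure_levyTail (hμ : IsLevyMeasure μ) {r : ℝ} (hr : 0 < r) :
    IsFiniteMeasure (levyTail μ r) := by
  refine ⟨?_⟩
  rw [levyTail, Measure.restrict_apply_univ]
  refine lt_of_le_of_lt (measure_mono ?_)
    (hμ.integrable_min.measure_ge_lt_top (ε := min (r ^ 2) 1) (by positivity))
  intro z hz
  have : r < ‖z‖ := hz
  simp only [mem_ofPred_eq]
  gcongr

lemma map_neg_levyTail (hμ : IsLevyMeasure μ) (r : ℝ) :
    (levyTail μ r).map (fun z => -z) = levyTail μ r := by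
  have h : MeasurePreserving (fun z : Euc N => -z) μ μ := ⟨measurable_neg, hμ.2.1⟩
  have := (h.restrict_preimage (measurableSet_lt_norm r)).map_eq
  simpa [levyTail] using this

end IsLevyMeasure

namespace IsTestFn

variable {ρ : Euc N → ℝ}

lemma bddMeas (hρ : IsTestFn ρ) : IsBddMeas ρ := by
  obtain ⟨C, hC⟩ := hρ.1.continuous.bounded_above_of_compact_support hρ.2
  exact ⟨hρ.1.continuous.measurable, C, hC⟩

lemma integrable (hρ : IsTestFn ρ) : Integrable ρ :=
  hρ.1.continuous.integrable_of_hasCompactSupport hρ.2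

lemma exists_taylor_bound (hρ : IsTestFn ρ) :
    ∃ C, 0 ≤ C ∧ ∀ y z, |ρ (y + z) - ρ y - fderiv ℝ ρ y z| ≤ C * ‖z‖ ^ 2 := by
  have h1 : ContDiff ℝ 1 (fderiv ℝ ρ) := hρ.1.fderiv_right (by norm_cast)
  obtain ⟨C, hC⟩ := h1.lipschitzWith_of_hasCompactSupport (hρ.2.fderiv (𝕜 := ℝ)) (by simp)
  refine ⟨C, C.2, fun y z => ?_⟩
  have hd : ∀ x ∈ segment ℝ y (y + z), HasFDerivWithinAt ρ (fderiv ℝ ρ x)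
      (segment ℝ y (y + z)) x := fun x _ =>
    (hρ.1.differentiable (by simp) x).hasFDerivAt.hasFDerivWithinAt
  have hb : ∀ x ∈ segment ℝ y (y + z), ‖fderiv ℝ ρ x - fderiv ℝ ρ y‖ ≤ C * ‖z‖ := fun x hx => by
    refine (hC.norm_sub_le x y).trans ?_
    gcongr
    have := norm_sub_le_of_mem_segment hx
    simpa using this
  have := (convex_segment y (y + z)).norm_image_sub_le_of_norm_hasFDerivWithin_le' hd hb
    (left_mem_segment ℝ y (y + z)) (right_mem_segment ℝ y (y + z))
  simpa [sq, mul_assoc] using this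

lemma integrand_bound (hρ : IsTestFn ρ) :
    ∃ C, 0 ≤ C ∧ ∀ y z, |ρ (y + z) - ρ y - (if ‖z‖ ≤ 1 then fderiv ℝ ρ y z else 0)|
      ≤ C * min (‖z‖ ^ 2) 1 := by
  obtain ⟨C, hC0, hC⟩ := hρ.exists_taylor_bound
  obtain ⟨D, hD⟩ := hρ.bddMeas.bdd
  have hD0 : 0 ≤ D := (abs_nonneg _).trans (hD 0)
  refine ⟨C + 2 * D, by positivity, fun y z => ?_⟩
  split_ifs with hz
  · have : ‖z‖ ^ 2 ≤ 1 := pow_le_one₀ (norm_nonneg z) hz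
    rw [min_eq_left this]
    refine (hC y z).trans ?_
    gcongr
    linarith
  · push Not at hz
    have : 1 ≤ ‖z‖ ^ 2 := one_le_pow₀ hz.le
    rw [min_eq_right this, sub_zero]
    linarith [abs_sub (ρ (y + z)) (ρ y), hD (y + z), hD y]

end IsTestFn

namespace IsLevyMeasure

variable {ρ : Euc N → ℝ}

lemma measurable_integrand (hρ : IsTestFn ρ) (y : Euc N) :
    Measurable fun z => ρ (y + z) - ρ y - (if ‖z‖ ≤ 1 then fderiv ℝ ρ y z else 0) := by
  have h1 := hρ.1.continuous
  have h2 : MeasurableSet {z : Euc N | ‖z‖ ≤ 1} := measurableSet_le measurable_norm measurable_const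
  have h3 : Measurable fun z => fderiv ℝ ρ y z := (fderiv ℝ ρ y).continuous.measurable
  exact ((h1.comp (continuous_const_add y)).measurable.sub_const _).sub
    (Measurable.ite h2 h3 measurable_const)

lemma integrable_integrand (hμ : IsLevyMeasure μ) (hρ : IsTestFn ρ) (y : Euc N) :
    Integrable (fun z => ρ (y + z) - ρ y - (if ‖z‖ ≤ 1 then fderiv ℝ ρ y z else 0)) μ := by
  obtain ⟨C, _, hC⟩ := hρ.integrand_bound
  exact (hμ.integrable_min.const_mul C).mono' (measurable_integrand hρ y).aestronglyMeasurable
    (Eventually.of_forall fun z => hC y z)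

lemma integral_drift_eq_zero (hμ : IsLevyMeasure μ) (r : ℝ) (A : Euc N →L[ℝ] ℝ) :
    ∫ z, (if ‖z‖ ≤ 1 then A z else 0) ∂(levyTail μ r) = 0 := by
  have h := hμ.map_neg_levyTail r
  have h1 : ∫ z, (if ‖z‖ ≤ 1 then A z else 0) ∂(levyTail μ r)
      = ∫ z, (if ‖-z‖ ≤ 1 then A (-z) else 0) ∂(levyTail μ r) := by
    conv_lhs => rw [← h]
    exact (Homeomorph.neg (Euc N)).measurableEmbedding.integral_map _
  have h2 : ∀ z : Euc N, (if ‖-z‖ ≤ 1 then A (-z) else 0) = -(if ‖z‖ ≤ 1 then A z else 0) :=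
    fun z => by rw [norm_neg, map_neg]; split_ifs <;> simp
  simp only [h2, integral_neg] at h1
  linarith

lemma lop_sub_jumpOp (hμ : IsLevyMeasure μ) (hρ : IsTestFn ρ) {r : ℝ} (hr : 0 < r)
    (y : Euc N) : Lop μ ρ y - jumpOp (levyTail μ r) ρ y
      = ∫ z in {z : Euc N | r < ‖z‖}ᶜ,
        (ρ (y + z) - ρ y - (if ‖z‖ ≤ 1 then fderiv ℝ ρ y z else 0)) ∂μ := by
  have := hμ.isFiniteMeasure_levyTail hr
  rw [Lop, ← integral_add_compl (measurableSet_lt_norm r) (hμ.integrable_integrand hρ y)]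
  have h1 : ∫ z in {z : Euc N | r < ‖z‖},
      (ρ (y + z) - ρ y - (if ‖z‖ ≤ 1 then fderiv ℝ ρ y z else 0)) ∂μ
      = jumpOp (levyTail μ r) ρ y := by
    change ∫ z, _ ∂(levyTail μ r) = _
    have i1 : Integrable (fun z => ρ (y + z) - ρ y) (levyTail μ r) :=
      (hρ.bddMeas.integrable_shift y).sub (integrable_const _)
    have i2 : Integrable (fun z => if ‖z‖ ≤ 1 then fderiv ℝ ρ y z else 0) (levyTail μ r) := by
      have i3 : Integrable (fun z => ρ (y + z) - ρ y - (if ‖z‖ ≤ 1 then fderiv ℝ ρ y z else 0))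
        (levyTail μ r) := (hμ.integrable_integrand hρ y).restrict
      refine (i1.sub i3).congr (Eventually.of_forall fun z => ?_)
      simp
    rw [integral_sub i1 i2, hμ.integral_drift_eq_zero, sub_zero,
      integral_sub (hρ.bddMeas.integrable_shift y) (integrable_const _)]
    simp [jumpOp, avgOp]
  rw [h1, add_sub_cancel_left]

/-- The contribution of the small jumps to the second moment. -/
lemma tendsto_smallJumps (hμ : IsLevyMeasure μ) :
    Tendsto (fun r => ∫ z in {z : Euc N | r < ‖z‖}ᶜ, min (‖z‖ ^ 2) 1 ∂μ) (𝓝[>] 0) (𝓝 0) := by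
  rw [show 𝓝 (0 : ℝ) = 𝓝 (∫ _ : Euc N, (0 : ℝ) ∂μ) by simp]
  simp only [← integral_indicator (measurableSet_lt_norm _).compl]
  refine tendsto_integral_filter_of_dominated_convergence (fun z => min (‖z‖ ^ 2) 1)
    (Eventually.of_forall fun r => ?_) (Eventually.of_forall fun r => ?_) hμ.integrable_min ?_
  · exact ((by fun_prop : Measurable fun z : Euc N => min (‖z‖ ^ 2) 1).indicator
      (measurableSet_lt_norm r).compl).aestronglyMeasurable
  · refine Eventually.of_forall fun z => ?_
    rw [Set.indicator]
    split_ifs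
    · rw [Real.norm_of_nonneg (by positivity)]
    · simp
  · refine Eventually.of_forall fun z => ?_
    refine tendsto_const_nhds.congr' ?_
    by_cases hz : z = 0
    · subst hz
      refine Eventually.of_forall fun r => ?_
      simp [Set.indicator]
    · have : Iio ‖z‖ ∈ 𝓝[>] (0 : ℝ) := mem_nhdsWithin_of_mem_nhds (Iio_mem_nhds (norm_pos_iff.2 hz))
      filter_upwards [this] with r hr
      rw [Set.indicator_of_notMem]
      simpa using hr

/-- Away from a fixed bounded set, cutting off the small jumps has no effect on a test function,
and on that set the effect is controlled by the second moment of the small jumps. -/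
lemma exists_abs_lop_sub_jumpOp_le (hμ : IsLevyMeasure μ) (hρ : IsTestFn ρ) :
    ∃ C R, 0 ≤ C ∧ ∀ r, 0 < r → r ≤ 1 → ∀ y, |Lop μ ρ y - jumpOp (levyTail μ r) ρ y|
      ≤ (Metric.closedBall (0 : Euc N) R).indicator
        (fun _ => C * ∫ z in {z : Euc N | r < ‖z‖}ᶜ, min (‖z‖ ^ 2) 1 ∂μ) y := by
  obtain ⟨C, hC0, hC⟩ := hρ.integrand_bound
  obtain ⟨R, hR⟩ := hρ.2.isBounded.subset_closedBall 0
  refine ⟨C, R + 1, hC0, fun r hr hr1 y => ?_⟩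
  rw [hμ.lop_sub_jumpOp hρ hr]
  by_cases hy : y ∈ Metric.closedBall (0 : Euc N) (R + 1)
  · rw [indicator_of_mem hy, ← integral_const_mul]
    refine (abs_integral_le_integral_abs).trans ?_
    exact integral_mono (hμ.integrable_integrand hρ y).norm.restrict
      (hμ.integrable_min.const_mul C).restrict fun z => hC y z
  · rw [indicator_of_notMem hy]
    simp only [Metric.mem_closedBall, dist_zero_right, not_le] at hy
    have h0 : ∀ x : Euc N, R < ‖x‖ → x ∉ tsupport ρ := fun x hx hxs => by
      have := hR hxs
      simp at this; linarith
    rw [setIntegral_eq_zero_of_forall_eq_zero, abs_zero]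
    intro z hz
    have hz1 : ‖z‖ ≤ r := by simpa using hz
    have h1 : ρ (y + z) = 0 := image_eq_zero_of_notMem_tsupport (h0 _ (by
      have := norm_sub_le (y + z) z
      rw [add_sub_cancel_right] at this
      linarith))
    have h2 : ρ y = 0 := image_eq_zero_of_notMem_tsupport (h0 _ (by linarith))
    have h3 : fderiv ℝ ρ y = 0 := by
      by_contra hne
      exact h0 y (by linarith) (support_fderiv_subset ℝ hne)
    simp [h1, h2, h3]

lemma tendsto_jumpOp (hμ : IsLevyMeasure μ) (hρ : IsTestFn ρ) (y : Euc N) :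
    Tendsto (fun r => jumpOp (levyTail μ r) ρ y) (𝓝[>] 0) (𝓝 (Lop μ ρ y)) := by
  obtain ⟨C, R, hC, H⟩ := hμ.exists_abs_lop_sub_jumpOp_le hρ
  rw [tendsto_iff_norm_sub_tendsto_zero]
  have h1 := hμ.tendsto_smallJumps.const_mul C
  rw [mul_zero] at h1
  refine squeeze_zero' (Eventually.of_forall fun r => norm_nonneg _) ?_ h1
  have : Ioc (0 : ℝ) 1 ∈ 𝓝[>] (0 : ℝ) := Ioc_mem_nhdsGT one_pos
  filter_upwards [this] with r hr
  rw [norm_sub_rev]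
  refine (H r hr.1 hr.2 y).trans (indicator_le_self' (fun _ _ => ?_) y)
  exact mul_nonneg hC (integral_nonneg fun z => by positivity)

lemma measurable_lop (hμ : IsLevyMeasure μ) (hρ : IsTestFn ρ) : Measurable (Lop μ ρ) := by
  have hs : Tendsto (fun n : ℕ => 1 / ((n : ℝ) + 1)) atTop (𝓝[>] 0) :=
    tendsto_nhdsWithin_iff.2 ⟨tendsto_one_div_add_atTop_nhds_zero_nat,
      Eventually.of_forall fun n => by simp only [mem_Ioi]; positivity⟩
  refine measurable_of_tendsto_metrizable
    (f := fun n : ℕ => jumpOp (levyTail μ (1 / ((n : ℝ) + 1))) ρ) (fun n => ?_)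
    (tendsto_pi_nhds.2 fun y => (hμ.tendsto_jumpOp hρ y).comp hs)
  have := hμ.isFiniteMeasure_levyTail (r := 1 / ((n : ℝ) + 1)) (by positivity)
  exact hρ.bddMeas.jumpOp.meas

lemma integrable_lop_sub (hμ : IsLevyMeasure μ) (hρ : IsTestFn ρ) {r : ℝ} (hr : 0 < r)
    (hr1 : r ≤ 1) : Integrable (fun y => Lop μ ρ y - jumpOp (levyTail μ r) ρ y) := by
  have := hμ.isFiniteMeasure_levyTail hr
  obtain ⟨C, R, hC, H⟩ := hμ.exists_abs_lop_sub_jumpOp_le hρ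
  refine Integrable.mono' (g := (Metric.closedBall (0 : Euc N) R).indicator
        (fun _ => C * ∫ z in {z : Euc N | r < ‖z‖}ᶜ, min (‖z‖ ^ 2) 1 ∂μ)) ?_
    ((hμ.measurable_lop hρ).sub hρ.bddMeas.jumpOp.meas).aestronglyMeasurable
    (Eventually.of_forall fun y => H r hr hr1 y)
  rw [integrable_indicator_iff measurableSet_closedBall]
  exact integrableOn_const measure_closedBall_lt_top.ne

lemma integrable_lop (hμ : IsLevyMeasure μ) (hρ : IsTestFn ρ) : Integrable (Lop μ ρ) := by
  have := hμ.isFiniteMeasure_levyTail one_pos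
  have := (hμ.integrable_lop_sub hρ one_pos le_rfl).add
    (integrable_jumpOp (ν := levyTail μ 1) hρ.bddMeas.meas hρ.integrable)
  refine this.congr (Eventually.of_forall fun y => ?_)
  simp

/-- The truncated operators converge in `L¹` on test functions. -/
lemma tendsto_integral_abs_lop_sub (hμ : IsLevyMeasure μ) (hρ : IsTestFn ρ) :
    Tendsto (fun r => ∫ y, |Lop μ ρ y - jumpOp (levyTail μ r) ρ y|) (𝓝[>] 0) (𝓝 0) := by
  obtain ⟨C, R, hC, H⟩ := hμ.exists_abs_lop_sub_jumpOp_le hρ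
  have h1 := (hμ.tendsto_smallJumps.const_mul C).const_mul
    (volume.real (Metric.closedBall (0 : Euc N) R))
  rw [mul_zero, mul_zero] at h1
  refine squeeze_zero' (Eventually.of_forall fun r => integral_nonneg fun _ => abs_nonneg _) ?_ h1
  filter_upwards [(Ioc_mem_nhdsGT one_pos : Ioc (0 : ℝ) 1 ∈ 𝓝[>] (0 : ℝ))] with r hr
  calc _ ≤ ∫ y, (Metric.closedBall (0 : Euc N) R).indicator
        (fun _ => C * ∫ z in {z : Euc N | r < ‖z‖}ᶜ, min (‖z‖ ^ 2) 1 ∂μ) y := by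
        refine integral_mono (hμ.integrable_lop_sub hρ hr.1 hr.2).abs ?_ (H r hr.1 hr.2)
        rw [integrable_indicator_iff measurableSet_closedBall]
        exact integrableOn_const measure_closedBall_lt_top.ne
    _ = _ := by
        rw [integral_indicator measurableSet_closedBall, setIntegral_const, smul_eq_mul]

/-- The Dirichlet forms of the truncated operators are uniformly bounded on a test function. -/
lemma eventually_dirichlet_le (hμ : IsLevyMeasure μ) {θ : Euc N → ℝ} (hθ : IsTestFn θ) :
    ∃ C, 0 ≤ C ∧ ∀ᶠ r in 𝓝[>] (0 : ℝ), ∀ ε, 0 ≤ ε → ε ≤ 1 →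
      ∫ x, θ x * (ε * θ x - jumpOp (levyTail μ r) θ x) ≤ C := by
  obtain ⟨D, hD⟩ := hθ.bddMeas.bdd
  have hD0 : 0 ≤ D := (abs_nonneg _).trans (hD 0)
  have hL := hμ.integrable_lop hθ
  have i0 : 0 ≤ ∫ x, |θ x| := integral_nonneg fun _ => abs_nonneg _
  have i1 : 0 ≤ ∫ x, |Lop μ θ x| := integral_nonneg fun _ => abs_nonneg _
  refine ⟨D * (∫ x, |θ x|) + D * ((∫ x, |Lop μ θ x|) + 1), by positivity, ?_⟩
  filter_upwards [(Ioc_mem_nhdsGT one_pos : Ioc (0 : ℝ) 1 ∈ 𝓝[>] (0 : ℝ)),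
    (hμ.tendsto_integral_abs_lop_sub hθ).eventually_le_const one_pos] with r hr hr2 ε hε0 hε1
  have := hμ.isFiniteMeasure_levyTail hr.1
  have hj := integrable_jumpOp (ν := levyTail μ r) hθ.bddMeas.meas hθ.integrable
  have hd := hμ.integrable_lop_sub hθ hr.1 hr.2
  have ia : Integrable (fun x => D * |θ x|) := hθ.integrable.abs.const_mul D
  have ib : Integrable (fun x => |Lop μ θ x| + |Lop μ θ x - jumpOp (levyTail μ r) θ x|) :=
    hL.abs.add hd.abs
  have ic : Integrable (fun x => ε * θ x - jumpOp (levyTail μ r) θ x) :=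
    (hθ.integrable.const_mul ε).sub hj
  calc ∫ x, θ x * (ε * θ x - jumpOp (levyTail μ r) θ x)
      ≤ ∫ x, (D * |θ x| + D * (|Lop μ θ x| + |Lop μ θ x - jumpOp (levyTail μ r) θ x|)) := by
        refine integral_mono ?_ (ia.add (ib.const_mul D)) fun x => ?_
        · refine (hθ.bddMeas.integrable_mul ic).congr (Eventually.of_forall fun x => mul_comm _ _)
        · have h1 : |ε * θ x - jumpOp (levyTail μ r) θ x| ≤ |θ x| + (|Lop μ θ x|
              + |Lop μ θ x - jumpOp (levyTail μ r) θ x|) := by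
            have a1 := abs_sub (ε * θ x) (jumpOp (levyTail μ r) θ x)
            have a2 := abs_sub (Lop μ θ x) (Lop μ θ x - jumpOp (levyTail μ r) θ x)
            rw [sub_sub_cancel] at a2
            have a3 : |ε * θ x| ≤ |θ x| := by
              rw [abs_mul, abs_of_nonneg hε0]
              exact mul_le_of_le_one_left (abs_nonneg _) hε1
            linarith
          calc _ ≤ |θ x| * |ε * θ x - jumpOp (levyTail μ r) θ x| := by
                rw [← abs_mul]; exact le_abs_self _
            _ ≤ D * (|θ x| + (|Lop μ θ x|
              + |Lop μ θ x - jumpOp (levyTail μ r) θ x|)) := by gcongr; exact hD x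
            _ = _ := by ring
    _ = D * (∫ x, |θ x|) + D * ((∫ x, |Lop μ θ x|)
        + ∫ x, |Lop μ θ x - jumpOp (levyTail μ r) θ x|) := by
        rw [integral_add ia (ib.const_mul D), integral_const_mul, integral_const_mul,
          integral_add hL.abs hd.abs]
    _ ≤ _ := by gcongr

end IsLevyMeasure

/-- The nonlocal operator commutes with translations and multiplication by constants. -/
lemma lop_translate (μ : Measure (Euc N)) (ρ : Euc N → ℝ) (c : ℝ) (x y : Euc N) :
    Lop μ (fun y => ρ (y - x) * c) y = c * Lop μ ρ (y - x) := by
  unfold Lop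
  rw [← integral_const_mul]
  congr 1; ext z
  have h : fderiv ℝ (fun y => ρ (y - x) * c) y = c • fderiv ℝ ρ (y - x) := by
    have e : (fun y => ρ (y - x) * c) = c • (fun y' => ρ (y' - x)) := by
      ext; simp [mul_comm]
    rw [e, fderiv_const_smul_field]
    rw [Pi.smul_apply, fderiv_comp_sub]
  simp only [h, add_sub_right_comm]
  split_ifs <;> simp <;> ring

end Levy

noncomputable section TimeCutoff

lemma smoothTransition_hasDerivAt (s : ℝ) :
    HasDerivAt Real.smoothTransition (deriv Real.smoothTransition s) s :=
  ((Real.smoothTransition.contDiff (n := 1)).differentiable (by simp) s).hasDerivAt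

lemma continuous_deriv_smoothTransition : Continuous (deriv Real.smoothTransition) :=
  (Real.smoothTransition.contDiff (n := 1)).continuous_deriv le_rfl

lemma deriv_smoothTransition_nonneg (s : ℝ) : 0 ≤ deriv Real.smoothTransition s :=
  Real.smoothTransition.monotone.deriv_nonneg

lemma deriv_smoothTransition_of_nonpos {s : ℝ} (hs : s ≤ 0) :
    deriv Real.smoothTransition s = 0 := by
  have h1 : ∀ s ∈ Iio (0 : ℝ), deriv Real.smoothTransition s = 0 := fun s hs => by
    have : Real.smoothTransition =ᶠ[𝓝 s] fun _ => 0 := by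
      filter_upwards [Iio_mem_nhds hs] with x hx
      exact Real.smoothTransition.zero_of_nonpos (le_of_lt hx)
    rw [this.deriv_eq, deriv_const]
  have h2 : closure (Iio (0 : ℝ)) ⊆ {s | deriv Real.smoothTransition s = 0} :=
    closure_minimal h1 (isClosed_eq continuous_deriv_smoothTransition continuous_const)
  rw [closure_Iio] at h2
  exact h2 hs

lemma deriv_smoothTransition_of_one_le {s : ℝ} (hs : 1 ≤ s) :
    deriv Real.smoothTransition s = 0 := by
  have h1 : ∀ s ∈ Ioi (1 : ℝ), deriv Real.smoothTransition s = 0 := fun s hs => by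
    have : Real.smoothTransition =ᶠ[𝓝 s] fun _ => 1 := by
      filter_upwards [Ioi_mem_nhds hs] with x hx
      exact Real.smoothTransition.one_of_one_le (le_of_lt hx)
    rw [this.deriv_eq, deriv_const]
  have h2 : closure (Ioi (1 : ℝ)) ⊆ {s | deriv Real.smoothTransition s = 0} :=
    closure_minimal h1 (isClosed_eq continuous_deriv_smoothTransition continuous_const)
  rw [closure_Ioi] at h2
  exact h2 hs

lemma exists_deriv_smoothTransition_le : ∃ C, 0 < C ∧ ∀ s, deriv Real.smoothTransition s ≤ C := by
  obtain ⟨C, hC⟩ := (isCompact_Icc (a := (0 : ℝ)) (b := 1)).exists_bound_of_continuousOn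
    continuous_deriv_smoothTransition.continuousOn
  refine ⟨|C| + 1, by positivity, fun s => ?_⟩
  rcases le_total s 0 with h | h
  · rw [deriv_smoothTransition_of_nonpos h]; positivity
  rcases le_total 1 s with h' | h'
  · rw [deriv_smoothTransition_of_one_le h']; positivity
  · have := hC s ⟨h, h'⟩
    rw [Real.norm_eq_abs] at this
    linarith [le_abs_self (deriv Real.smoothTransition s), le_abs_self C]

/-- The smooth time bump of unit mass carried by `[a h, (a + 1) h]`. -/
def timeBump (h a s : ℝ) : ℝ := deriv Real.smoothTransition (s / h - a) / h

/-- The smooth time hat carried by `[(a - 1) h, (a + 1) h]`. -/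
def timeHat (h a s : ℝ) : ℝ :=
    Real.smoothTransition (s / h - a + 1) - Real.smoothTransition (s / h - a)

variable {h : ℝ} {a s : ℝ}

lemma timeBump_nonneg (hh : 0 < h) (a s : ℝ) : 0 ≤ timeBump h a s :=
  div_nonneg (deriv_smoothTransition_nonneg _) hh.le

lemma continuous_timeBump (h a : ℝ) : Continuous (timeBump h a) :=
  (continuous_deriv_smoothTransition.comp
    ((continuous_id.div_const h).sub continuous_const)).div_const h

lemma timeBump_eq_zero (hh : 0 < h) (hs : s ∉ Ioo (a * h) ((a + 1) * h)) :
    timeBump h a s = 0 := by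
  unfold timeBump
  rw [mem_Ioo, not_and_or, not_lt, not_lt] at hs
  rcases hs with hs | hs
  · rw [deriv_smoothTransition_of_nonpos, zero_div]
    rw [sub_nonpos, div_le_iff₀ hh]; exact hs
  · rw [deriv_smoothTransition_of_one_le, zero_div]
    rw [le_sub_iff_add_le, add_comm, le_div_iff₀ hh]; exact hs

lemma integral_deriv_smoothTransition : ∫ s, deriv Real.smoothTransition s = 1 := by
  have h1 : ∫ s, deriv Real.smoothTransition s =
      ∫ s in (0 : ℝ)..1, deriv Real.smoothTransition s := by
    rw [intervalIntegral.integral_of_le zero_le_one,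
        setIntegral_eq_integral_of_forall_compl_eq_zero]
    intro s hs
    rw [mem_Ioc, not_and_or, not_lt, not_le] at hs
    rcases hs with hs | hs
    · exact deriv_smoothTransition_of_nonpos hs
    · exact deriv_smoothTransition_of_one_le hs.le
  rw [h1, intervalIntegral.integral_deriv_eq_sub'  _ rfl
    (fun s _ => (smoothTransition_hasDerivAt s).differentiableAt)
    continuous_deriv_smoothTransition.continuousOn]
  simp

lemma integral_timeBump (hh : 0 < h) (a : ℝ) : ∫ s, timeBump h a s = 1 := by
  unfold timeBump
  rw [integral_div]
  have h1 := Measure.integral_comp_div (fun s => deriv Real.smoothTransition (s - a)) h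
  rw [h1, integral_sub_right_eq_self (fun s => deriv Real.smoothTransition s) a,
      integral_deriv_smoothTransition,
    abs_of_pos hh]
  simp [hh.ne']

lemma hasCompactSupport_timeBump (hh : 0 < h) (a : ℝ) : HasCompactSupport (timeBump h a) :=
  HasCompactSupport.intro (isCompact_Icc (a := a * h) (b := (a + 1) * h)) fun _ hs =>
    timeBump_eq_zero hh fun hs' => hs (Ioo_subset_Icc_self hs')

lemma integrable_timeBump (hh : 0 < h) (a : ℝ) : Integrable (timeBump h a) :=
  (continuous_timeBump h a).integrable_of_hasCompactSupport (hasCompactSupport_timeBump hh a)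

lemma timeHat_nonneg (h a s : ℝ) : 0 ≤ timeHat h a s :=
  sub_nonneg.2 (Real.smoothTransition.monotone (by linarith))

lemma timeHat_le_one (h a s : ℝ) : timeHat h a s ≤ 1 := by
  unfold timeHat
  linarith [Real.smoothTransition.le_one (s / h - a + 1), Real.smoothTransition.nonneg (s / h - a)]

lemma contDiff_timeHat (h a : ℝ) : ContDiff ℝ (⊤ : ℕ∞) (timeHat h a) := by
  have h1 : ContDiff ℝ (⊤ : ℕ∞) fun s : ℝ => s / h - a :=
    (contDiff_id.div_const h).sub contDiff_const
  exact (Real.smoothTransition.contDiff.comp (h1.add contDiff_const)).sub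
    (Real.smoothTransition.contDiff.comp h1)

lemma timeHat_eq_zero (hh : 0 < h) (hs : s ∉ Ioo ((a - 1) * h) ((a + 1) * h)) :
    timeHat h a s = 0 := by
  unfold timeHat
  rw [mem_Ioo, not_and_or, not_lt, not_lt] at hs
  rcases hs with hs | hs
  · have : s / h ≤ a - 1 := by rwa [div_le_iff₀ hh]
    rw [Real.smoothTransition.zero_of_nonpos (by linarith),
      Real.smoothTransition.zero_of_nonpos (by linarith), sub_zero]
  · have : a + 1 ≤ s / h := by rwa [le_div_iff₀ hh]
    rw [Real.smoothTransition.one_of_one_le (by linarith),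
      Real.smoothTransition.one_of_one_le (by linarith), sub_self]

lemma hasCompactSupport_timeHat (hh : 0 < h) (a : ℝ) : HasCompactSupport (timeHat h a) :=
  HasCompactSupport.intro (isCompact_Icc (a := (a - 1) * h) (b := (a + 1) * h)) fun _ hs =>
    timeHat_eq_zero hh fun hs' => hs (Ioo_subset_Icc_self hs')

lemma integrable_timeHat (hh : 0 < h) (a : ℝ) : Integrable (timeHat h a) :=
  (contDiff_timeHat h a).continuous.integrable_of_hasCompactSupport (hasCompactSupport_timeHat hh a)

lemma hasDerivAt_timeHat (h a s : ℝ) :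
    HasDerivAt (timeHat h a) (timeBump h (a - 1) s - timeBump h a s) s := by
  have h1 : HasDerivAt (fun s : ℝ => s / h - a) (1 / h) s :=
    ((hasDerivAt_id s).div_const h).sub_const a
  have h2 : HasDerivAt (fun s : ℝ => s / h - a + 1) (1 / h) s := h1.add_const 1
  have := ((smoothTransition_hasDerivAt (s / h - a + 1)).comp s h2).sub
    ((smoothTransition_hasDerivAt (s / h - a)).comp s h1)
  refine this.congr_deriv ?_
  unfold timeBump
  rw [← sub_add]
  ring

lemma integral_timeHat (hh : 0 < h) (a : ℝ) : ∫ s, timeHat h a s = h := by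
  have h0 : ∫ s, (Real.smoothTransition (s + 1) - Real.smoothTransition s) = 1 := by
    have e : ∫ s, (Real.smoothTransition (s + 1) - Real.smoothTransition s) =
        ∫ s in (-1 : ℝ)..1, (Real.smoothTransition (s + 1) - Real.smoothTransition s) := by
      rw [intervalIntegral.integral_of_le (by norm_num),
        setIntegral_eq_integral_of_forall_compl_eq_zero]
      intro s hs
      rw [mem_Ioc, not_and_or, not_lt, not_le] at hs
      rcases hs with hs | hs
      · rw [Real.smoothTransition.zero_of_nonpos (by linarith),
          Real.smoothTransition.zero_of_nonpos (by linarith), sub_zero]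
      · rw [Real.smoothTransition.one_of_one_le (by linarith),
          Real.smoothTransition.one_of_one_le (by linarith), sub_self]
    have hc : Continuous Real.smoothTransition := Real.smoothTransition.continuous
    have hi : ∀ b c, IntervalIntegrable Real.smoothTransition volume b c :=
        fun b c => hc.intervalIntegrable b c
    have hc' : Continuous fun s => Real.smoothTransition (s + 1) :=
        hc.comp (continuous_id.add continuous_const)
    rw [e, intervalIntegral.integral_sub (hc'.intervalIntegrable _ _) (hi _ _),
      intervalIntegral.integral_comp_add_right (fun s => Real.smoothTransition s),
      ← intervalIntegral.integral_add_adjacent_intervals (hi (-1 + 1) 1) (hi 1 (1 + 1)),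
      ← intervalIntegral.integral_add_adjacent_intervals (hi (-1) (-1 + 1)) (hi (-1 + 1) 1)]
    have e1 : ∫ s in (1 : ℝ)..(1 + 1), Real.smoothTransition s = ∫ s in (1 : ℝ)..(1 + 1), (1 : ℝ) :=
      intervalIntegral.integral_congr fun s hs => by
        rw [uIcc_of_le (by norm_num)] at hs
        exact Real.smoothTransition.one_of_one_le hs.1
    have e2 : ∫ s in (-1 : ℝ)..(-1 + 1), Real.smoothTransition s =
        ∫ s in (-1 : ℝ)..(-1 + 1), (0 : ℝ) :=
      intervalIntegral.integral_congr fun s hs => by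
        rw [uIcc_of_le (by norm_num)] at hs
        exact Real.smoothTransition.zero_of_nonpos (by linarith [hs.2])
    rw [e1, e2]
    simp
  unfold timeHat
  have h1 := Measure.integral_comp_div
      (fun s => Real.smoothTransition (s - a + 1) - Real.smoothTransition (s - a)) h
  rw [h1, integral_sub_right_eq_self (fun s => Real.smoothTransition (s + 1) - Real.smoothTransition s) a,
      h0, abs_of_pos hh]
  simp

/-- The bumps attached to distinct integers have disjoint supports. -/
lemma sum_timeBump_le {C : ℝ} (hh : 0 < h) (hC0 : 0 ≤ C)
    (hC : ∀ s, deriv Real.smoothTransition s ≤ C)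
    (J : Finset ℕ) (s : ℝ) : ∑ j ∈ J, timeBump h j s ≤ C / h := by
  by_cases hex : ∃ i ∈ J, timeBump h i s ≠ 0
  · obtain ⟨i, hi, hne⟩ := hex
    have hmem : ∀ j : ℕ, timeBump h j s ≠ 0 → s / h ∈ Ioo (j : ℝ) (j + 1) := fun j hj => by
      have : s ∈ Ioo (j * h) ((j + 1) * h) := by
        by_contra hcon; exact hj (timeBump_eq_zero hh hcon)
      exact ⟨by rw [lt_div_iff₀ hh]; exact this.1, by rw [div_lt_iff₀ hh]; exact this.2⟩
    rw [Finset.sum_eq_single_of_mem i hi]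
    · exact div_le_div_of_nonneg_right (hC _) hh.le
    · intro j _ hji
      by_contra hj
      have h1 := hmem j hj
      have h2 := hmem i hne
      have a1 : (j : ℝ) < i + 1 := h1.1.trans h2.2
      have a2 : (i : ℝ) < j + 1 := h2.1.trans h1.2
      norm_cast at a1 a2
      omega
  · push Not at hex
    rw [Finset.sum_eq_zero hex]
    positivity

lemma sum_timeHat_mul_timeBump_le {C : ℝ} (hh : 0 < h) (hC0 : 0 ≤ C)
    (hC : ∀ s, deriv Real.smoothTransition s ≤ C)
    (J : Finset ℕ) (s d : ℝ) : ∑ j ∈ J, timeHat h j (s + d) * timeBump h j s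
      ≤ (Icc (-(2 * h)) (2 * h)).indicator (fun _ => C / h) d := by
  by_cases hd : d ∈ Icc (-(2 * h)) (2 * h)
  · rw [indicator_of_mem hd]
    refine (Finset.sum_le_sum fun j _ => ?_).trans (sum_timeBump_le hh hC0 hC J s)
    exact mul_le_of_le_one_left (timeBump_nonneg hh _ _) (timeHat_le_one _ _ _)
  · rw [indicator_of_notMem hd]
    refine (Finset.sum_eq_zero fun j _ => ?_).le
    by_contra hne
    rw [mul_eq_zero, not_or] at hne
    have h1 : s + d ∈ Ioo ((j - 1) * h) ((j + 1) * h) := by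
      by_contra hcon; exact hne.1 (timeHat_eq_zero hh hcon)
    have h2 : s ∈ Ioo (j * h) ((j + 1) * h) := by
      by_contra hcon; exact hne.2 (timeBump_eq_zero hh hcon)
    refine hd ⟨?_, ?_⟩ <;> nlinarith [h1.1, h1.2, h2.1, h2.2]

end TimeCutoff

noncomputable section SpaceTimeAverage

variable {N : ℕ}

/-- The average of the space-time function `f` with the space kernel `a` centred at `x` and the
time kernel `k`. -/
def stAvg (a : Euc N → ℝ) (k : ℝ → ℝ) (f : Euc N × ℝ → ℝ) (x : Euc N) : ℝ :=
  ∫ p : Euc N × ℝ, f p * (a (p.1 - x) * k p.2)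

variable {a b : Euc N → ℝ} {k : ℝ → ℝ} {f : Euc N × ℝ → ℝ} {C : ℝ}

lemma integrable_stKernel (ha : Integrable a) (hk : Integrable k) (x : Euc N) :
    Integrable (fun p : Euc N × ℝ => a (p.1 - x) * k p.2) :=
  (ha.comp_sub_right x).mul_prod hk

lemma integrable_mul_stKernel (hf : Measurable f) (hfC : ∀ p, |f p| ≤ C) (ha : Integrable a)
    (hk : Integrable k) (x : Euc N) :
    Integrable (fun p : Euc N × ℝ => f p * (a (p.1 - x) * k p.2)) :=
  (integrable_stKernel ha hk x).bdd_mul (c := C) hf.aestronglyMeasurable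
    (Eventually.of_forall hfC)

lemma integral_stKernel (a : Euc N → ℝ) (k : ℝ → ℝ) (x : Euc N) :
    ∫ p : Euc N × ℝ, a (p.1 - x) * k p.2 = (∫ y, a y) * ∫ s, k s := by
  rw [Measure.volume_eq_prod, integral_prod_mul (fun y => a (y - x)) k,
    integral_sub_right_eq_self a x]

lemma abs_stAvg_le (hfC : ∀ p, |f p| ≤ C) (ha : Integrable a)
    (hk : Integrable k) (x : Euc N) :
    |stAvg a k f x| ≤ C * ((∫ y, |a y|) * ∫ s, |k s|) := by
  rw [← integral_stKernel (fun y => |a y|) (fun s => |k s|) x, ← integral_const_mul, stAvg]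
  rw [← Real.norm_eq_abs]
  refine (norm_integral_le_of_norm_le
    ((integrable_stKernel ha.abs hk.abs x).const_mul C) (Eventually.of_forall fun p => ?_))
  rw [Real.norm_eq_abs, abs_mul, abs_mul]
  gcongr
  exact hfC p

lemma measurable_stKernel (ha : Measurable a) (hk : Measurable k) (hf : Measurable f) :
    Measurable (fun q : Euc N × (Euc N × ℝ) => f q.2 * (a (q.2.1 - q.1) * k q.2.2)) := by
  fun_prop

lemma bddMeas_stAvg (hf : Measurable f) (hfC : ∀ p, |f p| ≤ C) (ham : Measurable a)
    (ha : Integrable a) (hkm : Measurable k) (hk : Integrable k) : IsBddMeas (stAvg a k f) :=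
  ⟨(StronglyMeasurable.integral_prod_right'
    (measurable_stKernel ham hkm hf).stronglyMeasurable).measurable,
    _, abs_stAvg_le hfC ha hk⟩

lemma stAvg_sub (hf : Measurable f) (hfC : ∀ p, |f p| ≤ C) (ha : Integrable a)
    (hb : Integrable b) (hk : Integrable k) (x : Euc N) :
    stAvg (fun y => a y - b y) k f x = stAvg a k f x - stAvg b k f x := by
  unfold stAvg
  rw [← integral_sub (integrable_mul_stKernel hf hfC ha hk x)
    (integrable_mul_stKernel hf hfC hb hk x)]
  congr 1; ext p; ring

lemma avgOp_eq_integral_sub {ν : Measure (Euc N)} (hν : ν.map (fun z => -z) = ν)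
    (a : Euc N → ℝ) (y : Euc N) : avgOp ν a y = ∫ z, a (y - z) ∂ν := by
  unfold avgOp
  conv_lhs => rw [← hν]
  refine ((Homeomorph.neg (Euc N)).measurableEmbedding.integral_map _).trans ?_
  simp [sub_eq_add_neg]

/-- Jump operators act on averages through the space kernel. -/
lemma jumpOp_stAvg {ν : Measure (Euc N)} [IsFiniteMeasure ν] (hν : ν.map (fun z => -z) = ν)
    (hf : Measurable f) (hfC : ∀ p, |f p| ≤ C) (ha : IsBddMeas a) (hai : Integrable a)
    (hkm : Measurable k) (hk : Integrable k) (x : Euc N) :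
    jumpOp ν (stAvg a k f) x = stAvg (jumpOp ν a) k f x := by
  have hsym := avgOp_eq_integral_sub hν a
  have h1 : avgOp ν (stAvg a k f) x = stAvg (avgOp ν a) k f x := by
    unfold stAvg
    conv_rhs => simp only [hsym, ← integral_mul_const, ← integral_const_mul]
    unfold avgOp
    rw [integral_integral_swap]
    · simp only [sub_sub]
    · obtain ⟨D, hD⟩ := ha.bdd
      have ham := ha.meas
      refine (integrable_prod_iff' ?_).2 ⟨?_, ?_⟩
      · exact (by fun_prop : Measurable fun q : Euc N × (Euc N × ℝ) =>
          f q.2 * (a (q.2.1 - (x + q.1)) * k q.2.2)).aestronglyMeasurable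
      · refine Eventually.of_forall fun p => ?_
        refine Integrable.of_bound (C := |f p| * (D * |k p.2|)) (Measurable.aestronglyMeasurable
          (by fun_prop)) (Eventually.of_forall fun z => ?_)
        simp only [Function.uncurry, norm_mul, Real.norm_eq_abs]
        gcongr
        exact hD _
      · have hInt : Integrable (fun p : Euc N × ℝ =>
            C * (avgOp ν (fun y => |a y|) (p.1 - x) * |k p.2|)) :=
          (integrable_stKernel (integrable_avgOp ham.abs hai.abs) hk.abs x).const_mul C
        refine hInt.mono' ?_ (Eventually.of_forall fun p => ?_)
        · refine (StronglyMeasurable.integral_prod_left' (μ := ν) (f := fun q :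
            Euc N × (Euc N × ℝ) => ‖f q.2 * (a (q.2.1 - (x + q.1)) * k q.2.2)‖) ?_).aestronglyMeasurable
          exact (by fun_prop : Measurable _).stronglyMeasurable
        · have e : ∀ z, ‖f p * (a (p.1 - (x + z)) * k p.2)‖
              = |a (p.1 - x - z)| * (|f p| * |k p.2|) := fun z => by
            simp only [norm_mul, Real.norm_eq_abs, sub_sub]; ring
          simp only [Function.uncurry, e]
          rw [integral_mul_const]
          rw [← avgOp_eq_integral_sub hν (fun y => |a y|) (p.1 - x)]
          have h0 : 0 ≤ avgOp ν (fun y => |a y|) (p.1 - x) :=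
            integral_nonneg fun _ => abs_nonneg _
          rw [Real.norm_of_nonneg (by positivity)]
          calc _ = |f p| * (avgOp ν (fun y => |a y|) (p.1 - x) * |k p.2|) := by ring
            _ ≤ _ := by gcongr; exact hfC p
  have h2 := stAvg_sub hf hfC (integrable_avgOp (ν := ν) ha.meas hai)
    (hai.const_mul (ν.real univ)) hk x
  have h3 : stAvg (fun y => ν.real univ * a y) k f x = ν.real univ * stAvg a k f x := by
    unfold stAvg
    rw [← integral_const_mul]
    congr 1; ext p; ring
  change _ = stAvg (fun y => avgOp ν a y - ν.real univ * a y) k f x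
  rw [h2, h3, ← h1, jumpOp]

lemma integrable_prod_stKernel (hf : Measurable f) (hfi : Integrable f) (ham : Measurable a)
    (ha : Integrable a) (hkm : Measurable k) {D : ℝ} (hkD : ∀ s, |k s| ≤ D) :
    Integrable (fun q : Euc N × (Euc N × ℝ) => f q.2 * (a (q.2.1 - q.1) * k q.2.2))
      (volume.prod volume) := by
  refine (integrable_prod_iff' (measurable_stKernel ham hkm hf).aestronglyMeasurable).2 ⟨?_, ?_⟩
  · refine Eventually.of_forall fun p => ?_
    exact ((ha.comp_sub_left p.1).mul_const (k p.2)).const_mul (f p)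
  · have e' : ∀ p : Euc N × ℝ, ∫ x, ‖f p * (a (p.1 - x) * k p.2)‖
        = |f p| * (|k p.2| * ∫ y, |a y|) := fun p => by
      have e1 : ∀ x, ‖f p * (a (p.1 - x) * k p.2)‖ = |a (p.1 - x)| * (|f p| * |k p.2|) :=
        fun x => by simp only [norm_mul, Real.norm_eq_abs]; ring
      simp only [e1]
      rw [integral_mul_const, integral_sub_left_eq_self (fun y => |a y|) volume p.1]
      ring
    simp only [e']
    refine (hfi.abs.mul_bdd (c := D * ∫ y, |a y|) (Measurable.aestronglyMeasurable (by fun_prop))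
      (Eventually.of_forall fun p => ?_))
    have : 0 ≤ ∫ y, |a y| := integral_nonneg fun _ => abs_nonneg _
    rw [Real.norm_of_nonneg (by positivity)]
    gcongr
    exact hkD _

lemma integrable_stAvg (hf : Measurable f) (hfi : Integrable f) (ham : Measurable a)
    (ha : Integrable a) (hkm : Measurable k) {D : ℝ} (hkD : ∀ s, |k s| ≤ D) :
    Integrable (stAvg a k f) :=
  (integrable_prod_stKernel hf hfi ham ha hkm hkD).integral_prod_left

lemma integral_abs_stAvg_le (hf : Measurable f) (hfi : Integrable f) (ham : Measurable a)
    (ha : Integrable a) (hkm : Measurable k) {D : ℝ} (hkD : ∀ s, |k s| ≤ D) :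
    ∫ x, |stAvg a k f x| ≤ (∫ y, |a y|) * ∫ p, |f p| * |k p.2| := by
  have hi := integrable_prod_stKernel hf hfi ham ha hkm hkD
  calc ∫ x, |stAvg a k f x| ≤ ∫ x, ∫ p : Euc N × ℝ, |f p * (a (p.1 - x) * k p.2)| := by
        refine integral_mono hi.integral_prod_left.abs hi.abs.integral_prod_left fun x => ?_
        exact abs_integral_le_integral_abs
    _ = ∫ p : Euc N × ℝ, ∫ x, |f p * (a (p.1 - x) * k p.2)| := integral_integral_swap hi.abs
    _ = ∫ p : Euc N × ℝ, (∫ y, |a y|) * (|f p| * |k p.2|) := by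
        congr 1; ext p
        have e1 : ∀ x, |f p * (a (p.1 - x) * k p.2)| = |a (p.1 - x)| * (|f p| * |k p.2|) :=
          fun x => by simp only [abs_mul]; ring
        simp only [e1]
        rw [integral_mul_const, integral_sub_left_eq_self (fun y => |a y|) volume p.1]
    _ = _ := integral_const_mul _ _

end SpaceTimeAverage

noncomputable section CylinderSolution

variable {N : ℕ}

/-- A bounded integrable Borel function on `ℝ^N × ℝ`, vanishing outside the cylinder, which
satisfies the weak formulation tested with (translates of) products of test functions. -/
structure IsCylSol (μ : Measure (Euc N)) (φ : ℝ → ℝ) (T M : ℝ) (u₀ : Euc N → ℝ)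
    (w : Euc N × ℝ → ℝ) : Prop where
  meas : Measurable w
  bdd : ∀ p, |w p| ≤ M
  zero_off : ∀ p : Euc N × ℝ, p.2 ∉ Ioo 0 T → w p = 0
  integrable : Integrable w
  meas₀ : Measurable u₀
  bdd₀ : ∀ x, |u₀ x| ≤ M
  integrable₀ : Integrable u₀
  weak : ∀ ρ : Euc N → ℝ, IsTestFn ρ → ∀ (l l' : ℝ → ℝ) (c d : ℝ), ContDiff ℝ (⊤ : ℕ∞) l →
    (∀ s, s ∉ Ioo c d → l s = 0) → d < T → (∀ s, HasDerivAt l (l' s) s) → ∀ x,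
    stAvg ρ l' w x + stAvg (Lop μ ρ) ((Ioo 0 T).indicator l) (fun p => φ (w p)) x
      + (∫ y, u₀ y * ρ (y - x)) * l 0 = 0

lemma QTvol_eq_restrict (N : ℕ) (T : ℝ) :
    QTvol N T = (volume : Measure (Euc N × ℝ)).restrict (univ ×ˢ Ioo 0 T) := by
  rw [QTvol, Measure.volume_eq_prod, ← Measure.prod_restrict, Measure.restrict_univ]

lemma isSTTestFn_translate_mul {ρ : Euc N → ℝ} (hρ : IsTestFn ρ) {l : ℝ → ℝ} {T c d : ℝ}
    (hl : ContDiff ℝ (⊤ : ℕ∞) l) (hl0 : ∀ s, s ∉ Ioo c d → l s = 0) (hd : d < T) (x : Euc N) :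
    IsSTTestFn T (fun y t => ρ (y - x) * l t) := by
  have hK : IsCompact (((fun y => y + x) '' tsupport ρ) ×ˢ Icc c d) :=
    (hρ.2.isCompact.image (continuous_add_const x)).prod isCompact_Icc
  have h0 : ∀ p : Euc N × ℝ, p ∉ ((fun y => y + x) '' tsupport ρ) ×ˢ Icc c d →
      Function.uncurry (fun y t => ρ (y - x) * l t) p = 0 := by
    rintro ⟨y, t⟩ hp
    simp only [Function.uncurry, mul_eq_zero]
    by_contra! hne
    refine hp ⟨⟨y - x, subset_tsupport _ hne.1, by simp⟩, ?_⟩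
    by_contra hcon
    exact hne.2 (hl0 t fun h => hcon (Ioo_subset_Icc_self h))
  refine ⟨?_, HasCompactSupport.intro hK h0, ?_⟩
  · exact (hρ.1.comp (contDiff_fst.sub contDiff_const)).mul (hl.comp contDiff_snd)
  · have hsub : tsupport (Function.uncurry (fun y t => ρ (y - x) * l t)) ⊆
        ((fun y => y + x) '' tsupport ρ) ×ˢ Icc c d :=
      closure_minimal (fun p hp => by by_contra hcon; exact hp (h0 p hcon)) hK.isClosed
    exact fun p hp => lt_of_le_of_lt (hsub hp).2.2 hd

/-- Distributional solutions have good Borel representatives. -/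
lemma exists_isCylSol {μ : Measure (Euc N)} (hμ : IsLevyMeasure μ) {φ : ℝ → ℝ}
    (hφ : Continuous φ) {T : ℝ} {u₀ : Euc N → ℝ} {u : Euc N → ℝ → ℝ}
    (h0inf : MemLinfRn u₀) (h01 : Integrable u₀) (huinf : MemLinfQT T u) (hu1 : MemL1QT T u)
    (hsol : IsDistSolOp T (Lop μ) φ u₀ u) :
    ∃ M₀, ∀ M, M₀ ≤ M → ∃ (w₀ : Euc N → ℝ) (w : Euc N × ℝ → ℝ), IsCylSol μ φ T M w₀ w ∧
      w₀ =ᵐ[volume] u₀ ∧ ∀ᵐ p ∂(QTvol N T), w p = u p.1 p.2 := by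
  obtain ⟨hm0, C0, hC0⟩ := h0inf
  obtain ⟨hm, C, hC⟩ := huinf
  refine ⟨max 0 (max C0 C), fun M hM => ?_⟩
  have hM0 : 0 ≤ M := (le_max_left _ _).trans hM
  have hMC0 : C0 ≤ M := (le_max_left _ _).trans ((le_max_right _ _).trans hM)
  have hMC : C ≤ M := (le_max_right _ _).trans ((le_max_right _ _).trans hM)
  set g₀ := hm0.mk u₀ with hg₀
  have hg₀m : Measurable g₀ := hm0.stronglyMeasurable_mk.measurable
  set g := hm.mk _ with hg
  have hgm : Measurable g := hm.stronglyMeasurable_mk.measurable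
  set w₀ : Euc N → ℝ := {x | |g₀ x| ≤ M}.indicator g₀ with hw₀
  set S : Set (Euc N × ℝ) := univ ×ˢ Ioo 0 T with hS
  have hSm : MeasurableSet S := MeasurableSet.univ.prod measurableSet_Ioo
  set w : Euc N × ℝ → ℝ := S.indicator ({p | |g p| ≤ M}.indicator g) with hw
  have hw₀m : Measurable w₀ := hg₀m.indicator (measurableSet_le hg₀m.abs measurable_const)
  have hwm : Measurable w :=
    (hgm.indicator (measurableSet_le hgm.abs measurable_const)).indicator hSm
  have hw₀u : w₀ =ᵐ[volume] u₀ := by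
    filter_upwards [hm0.ae_eq_mk, hC0] with x hx hx'
    have : |g₀ x| ≤ M := by rw [hg₀, ← hx]; exact hx'.trans hMC0
    rw [hw₀, indicator_of_mem (by exact this), hx]
  have hwu : ∀ᵐ p ∂(QTvol N T), w p = u p.1 p.2 := by
    have hSae : ∀ᵐ p ∂(QTvol N T), p ∈ S := by
      rw [QTvol_eq_restrict]; exact ae_restrict_mem hSm
    filter_upwards [hm.ae_eq_mk, hC, hSae] with p hp hp' hpS
    have : |g p| ≤ M := by rw [hg, ← hp]; exact hp'.trans hMC
    rw [hw, indicator_of_mem hpS, indicator_of_mem (by exact this), hp]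
  have hwb : ∀ p, |w p| ≤ M := fun p => by
    rw [hw]
    by_cases hp : p ∈ S
    · rw [indicator_of_mem hp]
      by_cases hp' : |g p| ≤ M
      · rw [indicator_of_mem (by exact hp')]; exact hp'
      · rw [indicator_of_notMem (by exact hp'), abs_zero]; exact hM0
    · rw [indicator_of_notMem hp, abs_zero]; exact hM0
  have hwz : ∀ p : Euc N × ℝ, p.2 ∉ Ioo 0 T → w p = 0 := fun p hp => by
    rw [hw, indicator_of_notMem]
    exact fun h => hp h.2
  have hwi : Integrable w := by
    have h1 : IntegrableOn w S := by
      have : Integrable w (QTvol N T) := hu1.congr (hwu.mono fun p hp => hp.symm)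
      rwa [QTvol_eq_restrict] at this
    have h2 := (integrable_indicator_iff hSm).2 h1
    refine h2.congr (Eventually.of_forall fun p => ?_)
    rw [hw, indicator_indicator, inter_self]
  refine ⟨w₀, w, ⟨hwm, hwb, hwz, hwi, hw₀m, fun x => ?_, h01.congr hw₀u.symm, ?_⟩, hw₀u, hwu⟩
  · rw [hw₀]
    by_cases hp' : |g₀ x| ≤ M
    · rw [indicator_of_mem (by exact hp')]; exact hp'
    · rw [indicator_of_notMem (by exact hp'), abs_zero]; exact hM0
  intro ρ hρ l l' c d hl hl0 hd hder x
  have hsolψ := hsol _ (isSTTestFn_translate_mul hρ hl hl0 hd x)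
  have hl'c : Continuous l' := by
    have : l' = deriv l := funext fun s => (hder s).deriv.symm
    rw [this]
    exact hl.continuous_deriv (by simp)
  have hlK : HasCompactSupport l := HasCompactSupport.intro (isCompact_Icc (a := c) (b := d))
    fun _ hs => hl0 _ fun hs' => hs (Ioo_subset_Icc_self hs')
  have hl'K : HasCompactSupport l' := by
    have : l' = deriv l := funext fun s => (hder s).deriv.symm
    rw [this]; exact hlK.deriv
  have hli : Integrable l := hl.continuous.integrable_of_hasCompactSupport hlK
  have hl'i : Integrable l' := hl'c.integrable_of_hasCompactSupport hl'K
  have hφw : Measurable fun p => φ (w p) := hφ.measurable.comp hwm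
  obtain ⟨B, hB⟩ := (isCompact_Icc (a := -M) (b := M)).exists_bound_of_continuousOn
    hφ.continuousOn
  have hφb : ∀ p, |φ (w p)| ≤ B := fun p => hB _ (abs_le.1 (hwb p))
  have i1 := integrable_mul_stKernel hwm hwb hρ.integrable hl'i x
  have i2 := integrable_mul_stKernel hφw hφb (hμ.integrable_lop hρ) hli x
  have hF : (fun p : Euc N × ℝ => u p.1 p.2 * deriv (fun t => ρ (p.1 - x) * l t) p.2
      + φ (u p.1 p.2) * Lop μ (fun y => ρ (y - x) * l p.2) p.1) =ᵐ[QTvol N T]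
      fun p => w p * (ρ (p.1 - x) * l' p.2) + φ (w p) * (Lop μ ρ (p.1 - x) * l p.2) := by
    filter_upwards [hwu] with p hp
    rw [← hp, lop_translate, ((hder p.2).const_mul _).deriv, mul_comm (l p.2)]
  have i12 : Integrable (fun p : Euc N × ℝ => w p * (ρ (p.1 - x) * l' p.2)
      + φ (w p) * (Lop μ ρ (p.1 - x) * l p.2)) (QTvol N T) := by
    rw [QTvol_eq_restrict]
    exact (i1.add i2).restrict
  have e1 : (∫ t in Ioo (0 : ℝ) T, ∫ y, (u y t * deriv (fun t => ρ (y - x) * l t) t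
      + φ (u y t) * Lop μ (fun y' => ρ (y' - x) * l t) y))
      = stAvg ρ l' w x + stAvg (Lop μ ρ) ((Ioo 0 T).indicator l) (fun p => φ (w p)) x := by
    rw [← integral_prod_symm _ (i12.congr hF.symm)]
    change ∫ p, _ ∂(QTvol N T) = _
    rw [integral_congr_ae hF, QTvol_eq_restrict, integral_add i1.restrict i2.restrict]
    congr 1
    · rw [setIntegral_eq_integral_of_forall_compl_eq_zero, stAvg]
      intro p hp
      rw [hwz p fun h => hp ⟨mem_univ _, h⟩, zero_mul]
    · rw [← integral_indicator hSm, stAvg]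
      congr 1; ext p
      by_cases hp : p.2 ∈ Ioo 0 T
      · rw [indicator_of_mem (show p ∈ S from ⟨mem_univ _, hp⟩), indicator_of_mem hp]
      · rw [indicator_of_notMem (show p ∉ S from fun h => hp h.2), indicator_of_notMem hp]
        simp
  have e2 : ∫ y, u₀ y * (ρ (y - x) * l 0) = (∫ y, w₀ y * ρ (y - x)) * l 0 := by
    rw [← integral_mul_const]
    refine integral_congr_ae ?_
    filter_upwards [hw₀u] with y hy
    rw [hy]; ring
  rw [e1, e2] at hsolψ
  exact hsolψ

end CylinderSolution

noncomputable section Regularisation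

variable {N : ℕ}

/-- A nonnegative test function of unit mass carried by the ball of radius `κ`. -/
structure IsMollifier (ρ : Euc N → ℝ) (κ : ℝ) : Prop where
  test : IsTestFn ρ
  nonneg : ∀ y, 0 ≤ ρ y
  integral_eq_one : ∫ y, ρ y = 1
  zero_off : ∀ y, κ < ‖y‖ → ρ y = 0

lemma exists_isMollifier {κ : ℝ} (hκ : 0 < κ) : ∃ ρ : Euc N → ℝ, IsMollifier ρ κ := by
  let f : ContDiffBump (0 : Euc N) := ⟨κ / 2, κ, by positivity, by linarith⟩
  refine ⟨f.normed volume, ⟨f.contDiff_normed, f.hasCompactSupport_normed⟩,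
    f.nonneg_normed, f.integral_normed, fun y hy => ?_⟩
  have : y ∉ Function.support (f.normed volume) := by
    rw [f.support_normed_eq]
    simpa [Metric.mem_ball] using hy.le
  simpa using this

lemma IsMollifier.integral_abs {ρ : Euc N → ℝ} {κ : ℝ} (hρ : IsMollifier ρ κ) :
    ∫ y, |ρ y| = 1 := by
  simp only [abs_of_nonneg (hρ.nonneg _), hρ.integral_eq_one]

/-- The mollified initial datum. -/
def molInit (ρ u₀ : Euc N → ℝ) (x : Euc N) : ℝ := ∫ y, u₀ y * ρ (y - x)

section molInit

variable {ρ f g : Euc N → ℝ} {κ M : ℝ}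

lemma integrable_prod_molInit (hρ : IsMollifier ρ κ) (hf : Measurable f) (hfi : Integrable f) :
    Integrable (fun q : Euc N × Euc N => f q.2 * ρ (q.2 - q.1)) (volume.prod volume) := by
  have hm := hρ.test.bddMeas.meas
  refine (integrable_prod_iff' (by fun_prop : Measurable _).aestronglyMeasurable).2 ⟨?_, ?_⟩
  · exact Eventually.of_forall fun y => (hρ.test.integrable.comp_sub_left y).const_mul (f y)
  · have e : ∀ y : Euc N, ∫ x, ‖f y * ρ (y - x)‖ = |f y| := fun y => by
      simp only [norm_mul, Real.norm_eq_abs]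
      rw [integral_const_mul, integral_sub_left_eq_self (fun y => |ρ y|) volume y,
        hρ.integral_abs, mul_one]
    simp only [e]
    exact hfi.abs

lemma integrable_molInit (hρ : IsMollifier ρ κ) (hf : Measurable f) (hfi : Integrable f) :
    Integrable (molInit ρ f) := (integrable_prod_molInit hρ hf hfi).integral_prod_left

lemma integrable_mul_mollifier (hρ : IsMollifier ρ κ) (hfi : Integrable f) (x : Euc N) :
    Integrable (fun y => f y * ρ (y - x)) := by
  obtain ⟨C, hC⟩ := hρ.test.bddMeas.bdd
  have hm := hρ.test.bddMeas.meas
  exact hfi.mul_bdd (c := C) (by fun_prop : Measurable _).aestronglyMeasurable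
    (Eventually.of_forall fun y => hC _)

lemma abs_molInit_le (hρ : IsMollifier ρ κ) (hfM : ∀ x, |f x| ≤ M) (x : Euc N) :
    |molInit ρ f x| ≤ M := by
  have h := norm_integral_le_of_norm_le (f := fun y => f y * ρ (y - x))
    ((hρ.test.integrable.comp_sub_right x).const_mul M) (Eventually.of_forall fun y => by
      rw [norm_mul, Real.norm_eq_abs, Real.norm_of_nonneg (hρ.nonneg _)]
      exact mul_le_mul_of_nonneg_right (hfM y) (hρ.nonneg _))
  rwa [integral_const_mul, integral_sub_right_eq_self ρ x, hρ.integral_eq_one, mul_one] at h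

lemma bddMeas_molInit (hρ : IsMollifier ρ κ) (hf : Measurable f) (hfM : ∀ x, |f x| ≤ M) :
    IsBddMeas (molInit ρ f) := by
  have hm := hρ.test.bddMeas.meas
  exact ⟨(StronglyMeasurable.integral_prod_right' (f := fun q : Euc N × Euc N =>
    f q.2 * ρ (q.2 - q.1)) (by fun_prop : Measurable _).stronglyMeasurable).measurable,
    M, abs_molInit_le hρ hfM⟩

lemma integral_posPart_molInit_sub_le (hρ : IsMollifier ρ κ) (hf : Measurable f)
    (hfi : Integrable f) (hg : Measurable g) (hgi : Integrable g) :
    ∫ x, max (molInit ρ f x - molInit ρ g x) 0 ≤ ∫ x, max (f x - g x) 0 := by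
  have hd : Integrable (fun x => max (f x - g x) 0) := (hfi.sub hgi).pos_part
  have hdm : Measurable (fun x => max (f x - g x) 0) := (hf.sub hg).max measurable_const
  have hP := integrable_prod_molInit hρ hdm hd
  have hle : ∀ x, max (molInit ρ f x - molInit ρ g x) 0
      ≤ molInit ρ (fun x => max (f x - g x) 0) x := fun x => by
    refine max_le ?_ (integral_nonneg fun y => mul_nonneg (le_max_right _ _) (hρ.nonneg _))
    unfold molInit
    rw [← integral_sub (integrable_mul_mollifier hρ hfi x) (integrable_mul_mollifier hρ hgi x)]
    refine integral_mono ((integrable_mul_mollifier hρ hfi x).sub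
      (integrable_mul_mollifier hρ hgi x)) (integrable_mul_mollifier hρ hd x) fun y => ?_
    simp only
    rw [← sub_mul]
    exact mul_le_mul_of_nonneg_right (le_max_left _ _) (hρ.nonneg _)
  calc _ ≤ ∫ x, molInit ρ (fun x => max (f x - g x) 0) x :=
        integral_mono ((integrable_molInit hρ hf hfi).sub (integrable_molInit hρ hg hgi)).pos_part
          (integrable_molInit hρ hdm hd) hle
    _ = ∫ y, ∫ x, max (f y - g y) 0 * ρ (y - x) := integral_integral_swap hP
    _ = _ := by
        congr 1; ext y
        rw [integral_const_mul, integral_sub_left_eq_self ρ volume y, hρ.integral_eq_one, mul_one]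

end molInit

/-- The regularised solution at the time step `a`. -/
def regSol (ρ : Euc N → ℝ) (h : ℝ) (w : Euc N × ℝ → ℝ) (a : ℝ) : Euc N → ℝ :=
  stAvg ρ (timeBump h a) w

/-- The regularised flux at the time step `a`. -/
def regFlux (ρ : Euc N → ℝ) (h : ℝ) (φ : ℝ → ℝ) (w : Euc N × ℝ → ℝ) (a : ℝ) (x : Euc N) : ℝ :=
  h⁻¹ * stAvg ρ (timeHat h a) (fun p => φ (w p)) x

/-- The consistency error of the truncated operator. -/
def regErr (μ : Measure (Euc N)) (r : ℝ) (ρ : Euc N → ℝ) (h : ℝ) (φ : ℝ → ℝ)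
    (w : Euc N × ℝ → ℝ) (a : ℝ) (x : Euc N) : ℝ :=
  h⁻¹ * stAvg (fun y => Lop μ ρ y - jumpOp (levyTail μ r) ρ y) (timeHat h a) (fun p => φ (w p)) x

namespace IsCylSol

variable {μ : Measure (Euc N)} {φ : ℝ → ℝ} {T M : ℝ} {u₀ : Euc N → ℝ} {w : Euc N × ℝ → ℝ}
  {ρ : Euc N → ℝ} {κ h r B : ℝ}

lemma abs_regSol_le (H : IsCylSol μ φ T M u₀ w) (hρ : IsMollifier ρ κ) (hh : 0 < h) (a : ℝ)
    (x : Euc N) : |regSol ρ h w a x| ≤ M := by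
  have := abs_stAvg_le H.bdd hρ.test.integrable (integrable_timeBump hh a) x
  simpa only [regSol, hρ.integral_abs, abs_of_nonneg (timeBump_nonneg hh a _),
    integral_timeBump hh, mul_one] using this

lemma bddMeas_regSol (H : IsCylSol μ φ T M u₀ w) (hρ : IsMollifier ρ κ) (hh : 0 < h) (a : ℝ) :
    IsBddMeas (regSol ρ h w a) :=
  bddMeas_stAvg H.meas H.bdd hρ.test.bddMeas.meas hρ.test.integrable
    (continuous_timeBump h a).measurable (integrable_timeBump hh a)

lemma exists_timeBump_le (hh : 0 < h) (a : ℝ) : ∃ D, ∀ s, |timeBump h a s| ≤ D :=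
  (continuous_timeBump h a).bounded_above_of_compact_support (hasCompactSupport_timeBump hh a)

lemma integrable_regSol (H : IsCylSol μ φ T M u₀ w) (hρ : IsMollifier ρ κ) (hh : 0 < h) (a : ℝ) :
    Integrable (regSol ρ h w a) := by
  obtain ⟨D, hD⟩ := exists_timeBump_le hh a
  exact integrable_stAvg H.meas H.integrable hρ.test.bddMeas.meas hρ.test.integrable
    (continuous_timeBump h a).measurable hD

lemma integral_abs_regSol_le (H : IsCylSol μ φ T M u₀ w) (hρ : IsMollifier ρ κ) (hh : 0 < h)
    (a : ℝ) : ∫ x, |regSol ρ h w a x| ≤ ∫ p : Euc N × ℝ, |w p| * timeBump h a p.2 := by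
  obtain ⟨D, hD⟩ := exists_timeBump_le hh a
  have := integral_abs_stAvg_le H.meas H.integrable hρ.test.bddMeas.meas hρ.test.integrable
    (continuous_timeBump h a).measurable hD
  simpa only [regSol, hρ.integral_abs, one_mul, abs_of_nonneg (timeBump_nonneg hh a _)] using this

lemma measurable_flux (H : IsCylSol μ φ T M u₀ w) (hφ : Continuous φ) :
    Measurable fun p => φ (w p) := hφ.measurable.comp H.meas

lemma bddMeas_regFlux (H : IsCylSol μ φ T M u₀ w) (hφ : Continuous φ)
    (hB : ∀ s, |s| ≤ M → |φ s| ≤ B) (hρ : IsMollifier ρ κ) (hh : 0 < h) (a : ℝ) :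
    IsBddMeas (regFlux ρ h φ w a) :=
  (bddMeas_stAvg (H.measurable_flux hφ) (fun p => hB _ (H.bdd p)) hρ.test.bddMeas.meas
    hρ.test.integrable (contDiff_timeHat h a).continuous.measurable
    (integrable_timeHat hh a)).const_mul _

lemma bddMeas_regErr (hμ : IsLevyMeasure μ) (H : IsCylSol μ φ T M u₀ w) (hφ : Continuous φ)
    (hB : ∀ s, |s| ≤ M → |φ s| ≤ B) (hρ : IsMollifier ρ κ) (hh : 0 < h) (hr : 0 < r)
    (hr1 : r ≤ 1) (a : ℝ) : IsBddMeas (regErr μ r ρ h φ w a) := by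
  have := hμ.isFiniteMeasure_levyTail hr
  exact (bddMeas_stAvg (H.measurable_flux hφ) (fun p => hB _ (H.bdd p))
    ((hμ.measurable_lop hρ.test).sub hρ.test.bddMeas.jumpOp.meas)
    (hμ.integrable_lop_sub hρ.test hr hr1) (contDiff_timeHat h a).continuous.measurable
    (integrable_timeHat hh a)).const_mul _

lemma abs_regErr_le (hμ : IsLevyMeasure μ) (H : IsCylSol μ φ T M u₀ w)
    (hB : ∀ s, |s| ≤ M → |φ s| ≤ B) (hρ : IsMollifier ρ κ) (hh : 0 < h) (hr : 0 < r)
    (hr1 : r ≤ 1) (a : ℝ) (x : Euc N) :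
    |regErr μ r ρ h φ w a x| ≤ B * ∫ y, |Lop μ ρ y - jumpOp (levyTail μ r) ρ y| := by
  have h1 := abs_stAvg_le (f := fun p => φ (w p)) (fun p => hB _ (H.bdd p))
    (hμ.integrable_lop_sub hρ.test hr hr1) (integrable_timeHat hh a) x
  simp only [abs_of_nonneg (timeHat_nonneg h a _), integral_timeHat hh] at h1
  rw [regErr, abs_mul, abs_of_pos (inv_pos.2 hh), inv_mul_le_iff₀ hh]
  calc _ ≤ _ := h1
    _ = _ := by ring

lemma stAvg_derivTimeHat (H : IsCylSol μ φ T M u₀ w) (hρ : IsMollifier ρ κ) (hh : 0 < h)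
    (a : ℝ) (x : Euc N) : stAvg ρ (fun s => timeBump h (a - 1) s - timeBump h a s) w x
      = regSol ρ h w (a - 1) x - regSol ρ h w a x := by
  unfold regSol stAvg
  rw [← integral_sub
    (integrable_mul_stKernel H.meas H.bdd hρ.test.integrable (integrable_timeBump hh _) x)
    (integrable_mul_stKernel H.meas H.bdd hρ.test.integrable (integrable_timeBump hh _) x)]
  congr 1; ext p; ring

/-- The regularised solution performs a perturbed explicit step. -/
lemma regSol_sub (hμ : IsLevyMeasure μ) (H : IsCylSol μ φ T M u₀ w) (hφ : Continuous φ)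
    (hB : ∀ s, |s| ≤ M → |φ s| ≤ B) (hρ : IsMollifier ρ κ) (hh : 0 < h) (hr : 0 < r)
    {a : ℝ} (ha : 1 ≤ a) (haT : (a + 1) * h < T) (x : Euc N) :
    regSol ρ h w a x - regSol ρ h w (a - 1) x
      = h * (jumpOp (levyTail μ r) (regFlux ρ h φ w a) x + regErr μ r ρ h φ w a x) := by
  have := hμ.isFiniteMeasure_levyTail hr
  have hw := H.weak ρ hρ.test (timeHat h a) (fun s => timeBump h (a - 1) s - timeBump h a s)
    ((a - 1) * h) ((a + 1) * h) (contDiff_timeHat h a) (fun s hs => timeHat_eq_zero hh hs) haT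
    (hasDerivAt_timeHat h a) x
  have ha0 : 0 ≤ (a - 1) * h := mul_nonneg (by linarith) hh.le
  have h0 : timeHat h a 0 = 0 := timeHat_eq_zero hh fun hs => by linarith [hs.1]
  have hind : (Ioo 0 T).indicator (timeHat h a) = timeHat h a := by
    refine indicator_eq_self.2 fun s hs => ?_
    by_contra hcon
    refine hs (timeHat_eq_zero hh fun hs' => hcon ⟨by linarith [hs'.1], by linarith [hs'.2]⟩)
  rw [h0, mul_zero, add_zero, hind, H.stAvg_derivTimeHat hρ hh] at hw
  have hfm := H.measurable_flux hφ
  have hfB : ∀ p, |φ (w p)| ≤ B := fun p => hB _ (H.bdd p)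
  have hJ := jumpOp_stAvg (hμ.map_neg_levyTail r) hfm hfB hρ.test.bddMeas hρ.test.integrable
    (contDiff_timeHat h a).continuous.measurable (integrable_timeHat hh a) x
  have hJ' : jumpOp (levyTail μ r) (regFlux ρ h φ w a) x
      = h⁻¹ * jumpOp (levyTail μ r) (stAvg ρ (timeHat h a) (fun p => φ (w p))) x := by
    unfold regFlux jumpOp avgOp
    rw [integral_const_mul]; ring
  have hE := stAvg_sub hfm hfB (hμ.integrable_lop hρ.test) (integrable_jumpOp (ν := levyTail μ r)
    hρ.test.bddMeas.meas hρ.test.integrable) (integrable_timeHat hh a) x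
  rw [hJ', hJ, regErr, hE]
  field_simp
  linarith

/-- The first regularised state is close to the mollified initial datum. -/
lemma abs_regSol_zero_sub_le (hμ : IsLevyMeasure μ) (H : IsCylSol μ φ T M u₀ w)
    (hB : ∀ s, |s| ≤ M → |φ s| ≤ B) (hρ : IsMollifier ρ κ) (hh : 0 < h) (hhT : h < T)
    (x : Euc N) : |regSol ρ h w 0 x - molInit ρ u₀ x| ≤ h * (B * ∫ y, |Lop μ ρ y|) := by
  have hw := H.weak ρ hρ.test (timeHat h 0) (fun s => timeBump h (0 - 1) s - timeBump h 0 s)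
    ((0 - 1) * h) ((0 + 1) * h) (contDiff_timeHat h 0) (fun s hs => timeHat_eq_zero hh hs)
    (by linarith) (hasDerivAt_timeHat h 0) x
  have h0 : timeHat h 0 0 = 1 := by simp [timeHat]
  have h1 : regSol ρ h w (0 - 1) x = 0 := by
    unfold regSol stAvg
    refine integral_eq_zero_of_ae (Eventually.of_forall fun p => ?_)
    simp only [Pi.zero_apply]
    by_cases hp : p.2 ∈ Ioo 0 T
    · rw [timeBump_eq_zero hh fun hs => by linarith [hs.2, hp.1]]; ring
    · rw [H.zero_off p hp]; ring
  rw [h0, mul_one, H.stAvg_derivTimeHat hρ hh, h1] at hw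
  have hki : Integrable ((Ioo 0 T).indicator (timeHat h 0)) :=
    (integrable_timeHat hh 0).indicator measurableSet_Ioo
  have hB0 : 0 ≤ B := (abs_nonneg _).trans (hB _ (H.bdd 0))
  have h2 := abs_stAvg_le (f := fun p => φ (w p)) (fun p => hB _ (H.bdd p))
    (hμ.integrable_lop hρ.test) hki x
  have h3 : ∫ s, |(Ioo 0 T).indicator (timeHat h 0) s| ≤ h := by
    refine (integral_mono (g := timeHat h 0) hki.abs (integrable_timeHat hh 0) fun s => ?_).trans
        (integral_timeHat hh 0).le
    simp only
    rw [abs_of_nonneg (indicator_nonneg (fun s _ => timeHat_nonneg h 0 s) s)]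
    exact indicator_le_self' (fun s _ => timeHat_nonneg h 0 s) s
  have h4 : regSol ρ h w 0 x - molInit ρ u₀ x
      = stAvg (Lop μ ρ) ((Ioo 0 T).indicator (timeHat h 0)) (fun p => φ (w p)) x := by
    unfold molInit; linarith
  rw [h4]
  have h5 : 0 ≤ ∫ y, |Lop μ ρ y| := integral_nonneg fun _ => abs_nonneg _
  calc _ ≤ _ := h2
    _ ≤ B * ((∫ y, |Lop μ ρ y|) * h) := by gcongr
    _ = _ := by ring

end IsCylSol

end Regularisation

noncomputable section Oscillation

variable {N : ℕ}

instance isAddHaarMeasure_volume_prod :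
    (volume : Measure (Euc N × ℝ)).IsAddHaarMeasure :=
  inferInstanceAs ((volume : Measure (Euc N)).prod (volume : Measure ℝ)).IsAddHaarMeasure

/-- Translations are continuous in `L¹`. -/
lemma exists_lintegral_translate_le {E : Type*} [NormedAddCommGroup E] [MeasurableSpace E]
    [BorelSpace E] [ProperSpace E] {m : Measure E} [m.IsAddHaarMeasure] {w : E → ℝ}
    (hw : Integrable w m) {ω : ℝ} (hω : 0 < ω) : ∃ τ > 0, ∀ d : E, ‖d‖ ≤ τ →
      ∫⁻ q, ENNReal.ofReal |w (q + d) - w q| ∂m ≤ ENNReal.ofReal ω := by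
  have hw1 : MemLp w 1 m := memLp_one_iff_integrable.2 hw
  have : Fact ((1 : ENNReal) ≠ ⊤) := ⟨ENNReal.one_ne_top⟩
  have hc : Continuous fun d : E => DomAddAct.mk d +ᵥ hw1.toLp w := by
    have : Continuous (fun d : E => DomAddAct.mk d) := DomAddAct.continuous_mk
    exact this.vadd continuous_const
  have ht := (hc.tendsto 0).edist (tendsto_const_nhds (x := hw1.toLp w))
  have h0 : DomAddAct.mk (0 : E) +ᵥ hw1.toLp w = hw1.toLp w := by
    rw [DomAddAct.mk_zero, zero_vadd]
  rw [h0, edist_self] at ht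
  have hev := ht.eventually_le_const (ENNReal.ofReal_pos.2 hω)
  obtain ⟨τ, hτ, hτ'⟩ := Metric.eventually_nhds_iff.1 hev
  refine ⟨τ / 2, by positivity, fun d hd => ?_⟩
  have := hτ' (y := d) (by rw [dist_zero_right]; linarith)
  rw [DomAddAct.mk_vadd_toLp, Lp.edist_toLp_toLp, eLpNorm_one_eq_lintegral_enorm] at this
  refine le_trans (le_of_eq ?_) this
  congr 1; ext q
  rw [← Real.norm_eq_abs, ofReal_norm]
  simp [add_comm d q]

/-- The averaged oscillation of `w` around `(x, a h)`. -/
def oscInt (ρ : Euc N → ℝ) (h : ℝ) (w : Euc N × ℝ → ℝ) (a : ℝ) (x : Euc N) : ENNReal :=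
  ∫⁻ p : Euc N × ℝ, ∫⁻ q : Euc N × ℝ, ENNReal.ofReal |w p - w q| *
    (ENNReal.ofReal (ρ (q.1 - x)) * ENNReal.ofReal (timeBump h a q.2)) *
    (ENNReal.ofReal (ρ (p.1 - x)) * ENNReal.ofReal (timeHat h a p.2))

variable {ρ : Euc N → ℝ} {κ h : ℝ} {w : Euc N × ℝ → ℝ}

lemma IsMollifier.lintegral_eq_one (hρ : IsMollifier ρ κ) : ∫⁻ y, ENNReal.ofReal (ρ y) = 1 := by
  rw [← ofReal_integral_eq_lintegral_ofReal hρ.test.integrable (Eventually.of_forall hρ.nonneg),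
    hρ.integral_eq_one, ENNReal.ofReal_one]

lemma measurable_oscInt (hρ : Measurable ρ) (hw : Measurable w) (a : ℝ) :
    Measurable (oscInt ρ h w a) := by
  have hm1 := (continuous_timeBump h a).measurable
  have hm2 := (contDiff_timeHat h a).continuous.measurable
  refine Measurable.lintegral_prod_right' (ν := volume) (f := fun z : Euc N × (Euc N × ℝ) =>
    ∫⁻ q : Euc N × ℝ, ENNReal.ofReal |w z.2 - w q| *
    (ENNReal.ofReal (ρ (q.1 - z.1)) * ENNReal.ofReal (timeBump h a q.2)) *
    (ENNReal.ofReal (ρ (z.2.1 - z.1)) * ENNReal.ofReal (timeHat h a z.2.2))) ?_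
  refine Measurable.lintegral_prod_right' (ν := volume)
    (f := fun z : (Euc N × (Euc N × ℝ)) × (Euc N × ℝ) => ENNReal.ofReal |w z.1.2 - w z.2| *
    (ENNReal.ofReal (ρ (z.2.1 - z.1.1)) * ENNReal.ofReal (timeBump h a z.2.2)) *
    (ENNReal.ofReal (ρ (z.1.2.1 - z.1.1)) * ENNReal.ofReal (timeHat h a z.1.2.2))) ?_
  fun_prop

/-- Change of variables for the total oscillation. -/
lemma lintegral_oscInt (hρ : Measurable ρ) (hw : Measurable w) (a : ℝ) :
    ∫⁻ x, oscInt ρ h w a x = ∫⁻ y : Euc N, ∫⁻ d : Euc N × ℝ, ∫⁻ q : Euc N × ℝ,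
      ENNReal.ofReal |w (q + d) - w q| *
      (ENNReal.ofReal (ρ y) * ENNReal.ofReal (timeBump h a q.2)) *
      (ENNReal.ofReal (ρ (d.1 + y)) * ENNReal.ofReal (timeHat h a (q.2 + d.2))) := by
  have hm1 := (continuous_timeBump h a).measurable
  have hm2 := (contDiff_timeHat h a).continuous.measurable
  have s1 : ∀ x, oscInt ρ h w a x = ∫⁻ q : Euc N × ℝ, ∫⁻ d : Euc N × ℝ,
      ENNReal.ofReal |w (q + d) - w q| *
      (ENNReal.ofReal (ρ (q.1 - x)) * ENNReal.ofReal (timeBump h a q.2)) *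
      (ENNReal.ofReal (ρ (q.1 + d.1 - x)) * ENNReal.ofReal (timeHat h a (q.2 + d.2))) := fun x => by
    unfold oscInt
    rw [lintegral_lintegral_swap]
    · congr 1; ext q
      rw [← lintegral_add_left_eq_self _ q]
      rfl
    · refine Measurable.aemeasurable ?_
      simp only [Function.uncurry_def]
      fun_prop
  simp only [s1]
  rw [lintegral_lintegral_swap]
  · have s2 : ∀ q : Euc N × ℝ, ∫⁻ x : Euc N, ∫⁻ d : Euc N × ℝ,
        ENNReal.ofReal |w (q + d) - w q| *
        (ENNReal.ofReal (ρ (q.1 - x)) * ENNReal.ofReal (timeBump h a q.2)) *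
        (ENNReal.ofReal (ρ (q.1 + d.1 - x)) * ENNReal.ofReal (timeHat h a (q.2 + d.2)))
        = ∫⁻ y : Euc N, ∫⁻ d : Euc N × ℝ, ENNReal.ofReal |w (q + d) - w q| *
        (ENNReal.ofReal (ρ y) * ENNReal.ofReal (timeBump h a q.2)) *
        (ENNReal.ofReal (ρ (d.1 + y)) * ENNReal.ofReal (timeHat h a (q.2 + d.2))) := fun q => by
      rw [← lintegral_sub_left_eq_self _ q.1]
      have e : ∀ (y : Euc N) (d : Euc N × ℝ), q.1 + d.1 - (q.1 - y) = d.1 + y :=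
        fun y d => by abel
      simp only [sub_sub_cancel, e]
    simp only [s2]
    rw [lintegral_lintegral_swap]
    · congr 1; ext y
      rw [lintegral_lintegral_swap]
      refine Measurable.aemeasurable ?_
      simp only [Function.uncurry_def]
      fun_prop
    · refine Measurable.aemeasurable ?_
      simp only [Function.uncurry_def]
      exact Measurable.lintegral_prod_right' (ν := volume)
        (f := fun z : ((Euc N × ℝ) × Euc N) × (Euc N × ℝ) =>
        ENNReal.ofReal |w (z.1.1 + z.2) - w z.1.1| *
        (ENNReal.ofReal (ρ z.1.2) * ENNReal.ofReal (timeBump h a z.1.1.2)) *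
        (ENNReal.ofReal (ρ (z.2.1 + z.1.2)) * ENNReal.ofReal (timeHat h a (z.1.1.2 + z.2.2))))
        (by fun_prop)
  · refine Measurable.aemeasurable ?_
    simp only [Function.uncurry_def]
    exact Measurable.lintegral_prod_right' (ν := volume)
      (f := fun z : (Euc N × (Euc N × ℝ)) × (Euc N × ℝ) =>
      ENNReal.ofReal |w (z.1.2 + z.2) - w z.1.2| *
      (ENNReal.ofReal (ρ (z.1.2.1 - z.1.1)) * ENNReal.ofReal (timeBump h a z.1.2.2)) *
      (ENNReal.ofReal (ρ (z.1.2.1 + z.2.1 - z.1.1)) *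
        ENNReal.ofReal (timeHat h a (z.1.2.2 + z.2.2)))) (by fun_prop)

lemma sum_lintegral_oscInt_le (hρ : IsMollifier ρ κ) (hw : Measurable w) (hh : 0 < h)
    {C : ℝ} (hC0 : 0 ≤ C) (hC : ∀ s, deriv Real.smoothTransition s ≤ C) {ω : ℝ}
    (hω : ∀ d : Euc N × ℝ, ‖d‖ ≤ 2 * max κ h →
      ∫⁻ q, ENNReal.ofReal |w (q + d) - w q| ≤ ENNReal.ofReal ω) (J : Finset ℕ) :
    ∑ j ∈ J, ∫⁻ x, oscInt ρ h w j x ≤ ENNReal.ofReal (4 * C * ω) := by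
  have hm1 := fun a => (continuous_timeBump h a).measurable
  have hm2 := fun a => (contDiff_timeHat h a).continuous.measurable
  have hρm := hρ.test.bddMeas.meas
  have hI : MeasurableSet (Icc (-(2 * h)) (2 * h)) := measurableSet_Icc
  simp only [lintegral_oscInt hρm hw]
  rw [← lintegral_finsetSum]
  swap
  · intro j _
    exact Measurable.lintegral_prod_right' (ν := volume) (f := fun z : Euc N × (Euc N × ℝ) =>
      ∫⁻ q : Euc N × ℝ, ENNReal.ofReal |w (q + z.2) - w q| *
      (ENNReal.ofReal (ρ z.1) * ENNReal.ofReal (timeBump h j q.2)) *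
      (ENNReal.ofReal (ρ (z.2.1 + z.1)) * ENNReal.ofReal (timeHat h j (q.2 + z.2.2))))
      (Measurable.lintegral_prod_right' (ν := volume)
      (f := fun z : (Euc N × (Euc N × ℝ)) × (Euc N × ℝ) =>
      ENNReal.ofReal |w (z.2 + z.1.2) - w z.2| *
      (ENNReal.ofReal (ρ z.1.1) * ENNReal.ofReal (timeBump h j z.2.2)) *
      (ENNReal.ofReal (ρ (z.1.2.1 + z.1.1)) * ENNReal.ofReal (timeHat h j (z.2.2 + z.1.2.2))))
      (by fun_prop))
  have key : ∀ (y : Euc N) (d : Euc N × ℝ), ∑ j ∈ J, ∫⁻ q : Euc N × ℝ,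
      ENNReal.ofReal |w (q + d) - w q| *
      (ENNReal.ofReal (ρ y) * ENNReal.ofReal (timeBump h j q.2)) *
      (ENNReal.ofReal (ρ (d.1 + y)) * ENNReal.ofReal (timeHat h j (q.2 + d.2)))
      ≤ ENNReal.ofReal ω * ENNReal.ofReal (ρ y) * (ENNReal.ofReal (ρ (d.1 + y)) *
        (Icc (-(2 * h)) (2 * h)).indicator (fun _ => ENNReal.ofReal (C / h)) d.2) := by
    intro y d
    rw [← lintegral_finsetSum]
    swap
    · intro j _; fun_prop
    have hpt : ∀ q : Euc N × ℝ, ∑ j ∈ J, ENNReal.ofReal |w (q + d) - w q| *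
        (ENNReal.ofReal (ρ y) * ENNReal.ofReal (timeBump h j q.2)) *
        (ENNReal.ofReal (ρ (d.1 + y)) * ENNReal.ofReal (timeHat h j (q.2 + d.2)))
        ≤ ENNReal.ofReal |w (q + d) - w q| * (ENNReal.ofReal (ρ y) * (ENNReal.ofReal (ρ (d.1 + y))
          * (Icc (-(2 * h)) (2 * h)).indicator (fun _ => ENNReal.ofReal (C / h)) d.2)) := by
      intro q
      have e : ∑ j ∈ J, ENNReal.ofReal |w (q + d) - w q| *
        (ENNReal.ofReal (ρ y) * ENNReal.ofReal (timeBump h j q.2)) *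
        (ENNReal.ofReal (ρ (d.1 + y)) * ENNReal.ofReal (timeHat h j (q.2 + d.2)))
        = ENNReal.ofReal |w (q + d) - w q| * (ENNReal.ofReal (ρ y) * (ENNReal.ofReal (ρ (d.1 + y))
          * ∑ j ∈ J, ENNReal.ofReal (timeHat h j (q.2 + d.2) * timeBump h j q.2))) := by
        simp only [Finset.mul_sum]
        refine Finset.sum_congr rfl fun j _ => ?_
        rw [ENNReal.ofReal_mul (timeHat_nonneg _ _ _)]
        ring
      rw [e, ← ENNReal.ofReal_sum_of_nonneg fun j _ =>
        mul_nonneg (timeHat_nonneg _ _ _) (timeBump_nonneg hh _ _)]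
      gcongr
      have := sum_timeHat_mul_timeBump_le hh hC0 hC J q.2 d.2
      by_cases hd : d.2 ∈ Icc (-(2 * h)) (2 * h)
      · rw [indicator_of_mem hd] at this ⊢
        exact ENNReal.ofReal_le_ofReal this
      · rw [indicator_of_notMem hd] at this ⊢
        rw [ENNReal.ofReal_of_nonpos this]
    refine (lintegral_mono hpt).trans ?_
    rw [lintegral_mul_const _ (by fun_prop)]
    by_cases hy : ‖y‖ ≤ κ
    · by_cases hdy : ‖d.1 + y‖ ≤ κ
      · by_cases hd : d.2 ∈ Icc (-(2 * h)) (2 * h)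
        · have hd1 : ‖d‖ ≤ 2 * max κ h := by
            rw [Prod.norm_def]
            refine max_le ?_ ?_
            · have : ‖d.1‖ ≤ ‖d.1 + y‖ + ‖y‖ := by
                simpa using norm_sub_le (d.1 + y) y
              linarith [le_max_left κ h]
            · rw [Real.norm_eq_abs]
              have := abs_le.2 ⟨hd.1, hd.2⟩
              linarith [le_max_right κ h]
          rw [mul_assoc (ENNReal.ofReal ω)]
          gcongr
          exact hω d hd1
        · simp [indicator_of_notMem hd]
      · simp [hρ.zero_off _ (not_le.1 hdy)]
    · simp [hρ.zero_off _ (not_le.1 hy)]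
  have hind : Measurable fun s : ℝ =>
      (Icc (-(2 * h)) (2 * h)).indicator (fun _ => ENNReal.ofReal (C / h)) s :=
    measurable_const.indicator hI
  have hinner : ∀ y : Euc N, ∫⁻ d : Euc N × ℝ, ENNReal.ofReal (ρ (d.1 + y)) *
      (Icc (-(2 * h)) (2 * h)).indicator (fun _ => ENNReal.ofReal (C / h)) d.2
      = ENNReal.ofReal (4 * C) := fun y => by
    rw [Measure.volume_eq_prod, lintegral_prod_mul (f := fun y' => ENNReal.ofReal (ρ (y' + y)))
      (g := (Icc (-(2 * h)) (2 * h)).indicator (fun _ => ENNReal.ofReal (C / h)))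
      (by fun_prop) hind.aemeasurable,
      lintegral_add_right_eq_self (fun y => ENNReal.ofReal (ρ y)), hρ.lintegral_eq_one, one_mul,
      lintegral_indicator hI, setLIntegral_const, Real.volume_Icc,
          ← ENNReal.ofReal_mul (by positivity)]
    congr 1
    field_simp
    ring
  calc _ ≤ ∫⁻ y : Euc N, ∫⁻ d : Euc N × ℝ, ENNReal.ofReal ω * ENNReal.ofReal (ρ y) *
        (ENNReal.ofReal (ρ (d.1 + y)) *
        (Icc (-(2 * h)) (2 * h)).indicator (fun _ => ENNReal.ofReal (C / h)) d.2) := by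
        refine lintegral_mono fun y => ?_
        rw [← lintegral_finsetSum]
        · exact lintegral_mono (key y)
        · intro j _
          exact Measurable.lintegral_prod_right' (ν := volume)
            (f := fun z : (Euc N × ℝ) × (Euc N × ℝ) => ENNReal.ofReal |w (z.2 + z.1) - w z.2| *
            (ENNReal.ofReal (ρ y) * ENNReal.ofReal (timeBump h j z.2.2)) *
            (ENNReal.ofReal (ρ (z.1.1 + y)) * ENNReal.ofReal (timeHat h j (z.2.2 + z.1.2))))
            (by fun_prop)
    _ = ∫⁻ y : Euc N, ENNReal.ofReal ω * ENNReal.ofReal (ρ y) * ENNReal.ofReal (4 * C) := by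
        congr 1; ext y
        rw [lintegral_const_mul, hinner]
        fun_prop
    _ = ENNReal.ofReal ω * ENNReal.ofReal (4 * C) := by
        rw [lintegral_mul_const _ (by fun_prop), lintegral_const_mul _ (by fun_prop),
          hρ.lintegral_eq_one, mul_one]
    _ = _ := by rw [mul_comm, ← ENNReal.ofReal_mul (by positivity)]

end Oscillation

noncomputable section FluxError

variable {N : ℕ}

namespace IsCylSol

variable {μ : Measure (Euc N)} {φ : ℝ → ℝ} {T M : ℝ} {u₀ : Euc N → ℝ} {w : Euc N × ℝ → ℝ}
  {ρ : Euc N → ℝ} {κ h B δ K C : ℝ}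

lemma ofReal_abs_sub_regSol_le (H : IsCylSol μ φ T M u₀ w) (hρ : IsMollifier ρ κ) (hh : 0 < h)
    (a : ℝ) (x : Euc N) (p : Euc N × ℝ) :
    ENNReal.ofReal |w p - regSol ρ h w a x| ≤ ∫⁻ q : Euc N × ℝ, ENNReal.ofReal |w p - w q| *
      (ENNReal.ofReal (ρ (q.1 - x)) * ENNReal.ofReal (timeBump h a q.2)) := by
  have hk := integrable_stKernel hρ.test.integrable (integrable_timeBump hh a) x
  have hk1 : ∫ q : Euc N × ℝ, ρ (q.1 - x) * timeBump h a q.2 = 1 := by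
    rw [integral_stKernel, hρ.integral_eq_one, integral_timeBump hh, one_mul]
  have hnn : ∀ q : Euc N × ℝ, 0 ≤ ρ (q.1 - x) * timeBump h a q.2 := fun q =>
    mul_nonneg (hρ.nonneg _) (timeBump_nonneg hh _ _)
  have hi := integrable_mul_stKernel H.meas H.bdd hρ.test.integrable (integrable_timeBump hh a) x
  have e : w p - regSol ρ h w a x
      = ∫ q : Euc N × ℝ, (w p - w q) * (ρ (q.1 - x) * timeBump h a q.2) := by
    simp only [sub_mul]
    rw [integral_sub (hk.const_mul _) hi, integral_const_mul, hk1, mul_one]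
    rfl
  rw [e, ← Real.norm_eq_abs, ofReal_norm]
  refine (enorm_integral_le_lintegral_enorm _).trans (lintegral_mono fun q => ?_)
  rw [enorm_mul, ← ofReal_norm, ← ofReal_norm, Real.norm_eq_abs, Real.norm_of_nonneg (hnn q),
    ENNReal.ofReal_mul (hρ.nonneg _)]

lemma oscInt_le (H : IsCylSol μ φ T M u₀ w) (hρ : IsMollifier ρ κ) (hh : 0 < h) (a : ℝ)
    (x : Euc N) : oscInt ρ h w a x ≤ ENNReal.ofReal (2 * M) * ENNReal.ofReal h := by
  have hwm := H.meas
  have hρm := hρ.test.bddMeas.meas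
  have hm1 := (continuous_timeBump h a).measurable
  have hm2 := (contDiff_timeHat h a).continuous.measurable
  have hb : ∀ p q, |w p - w q| ≤ 2 * M := fun p q =>
    (abs_sub _ _).trans (by linarith [H.bdd p, H.bdd q])
  have e1 : ∫⁻ q : Euc N × ℝ, ENNReal.ofReal (ρ (q.1 - x)) * ENNReal.ofReal (timeBump h a q.2)
      = 1 := by
    rw [Measure.volume_eq_prod, lintegral_prod_mul (f := fun y => ENNReal.ofReal (ρ (y - x)))
      (g := fun s => ENNReal.ofReal (timeBump h a s)) (by fun_prop) (by fun_prop),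
      lintegral_sub_right_eq_self (fun y => ENNReal.ofReal (ρ y)), hρ.lintegral_eq_one,
      ← ofReal_integral_eq_lintegral_ofReal (integrable_timeBump hh a)
      (Eventually.of_forall (timeBump_nonneg hh a)), integral_timeBump hh]
    simp
  have e2 : ∫⁻ q : Euc N × ℝ, ENNReal.ofReal (ρ (q.1 - x)) * ENNReal.ofReal (timeHat h a q.2)
      = ENNReal.ofReal h := by
    rw [Measure.volume_eq_prod, lintegral_prod_mul (f := fun y => ENNReal.ofReal (ρ (y - x)))
      (g := fun s => ENNReal.ofReal (timeHat h a s)) (by fun_prop) (by fun_prop),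
      lintegral_sub_right_eq_self (fun y => ENNReal.ofReal (ρ y)), hρ.lintegral_eq_one,
      ← ofReal_integral_eq_lintegral_ofReal (integrable_timeHat hh a)
      (Eventually.of_forall (timeHat_nonneg h a)), integral_timeHat hh, one_mul]
  calc oscInt ρ h w a x ≤ ∫⁻ p : Euc N × ℝ, ENNReal.ofReal (2 * M) *
        (ENNReal.ofReal (ρ (p.1 - x)) * ENNReal.ofReal (timeHat h a p.2)) := by
        refine lintegral_mono fun p => ?_
        rw [lintegral_mul_const _ (by fun_prop)]
        gcongr
        calc _ ≤ ∫⁻ q : Euc N × ℝ, ENNReal.ofReal (2 * M) *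
              (ENNReal.ofReal (ρ (q.1 - x)) * ENNReal.ofReal (timeBump h a q.2)) := by
              refine lintegral_mono fun q => ?_
              gcongr
              exact hb p q
          _ = _ := by rw [lintegral_const_mul _ (by fun_prop), e1, mul_one]
    _ = _ := by rw [lintegral_const_mul _ (by fun_prop), e2]

/-- The regularised flux differs from the flux of the regularised solution by an oscillation. -/
lemma abs_regFlux_sub_le (H : IsCylSol μ φ T M u₀ w) (hφ : Continuous φ)
    (hB : ∀ s, |s| ≤ M → |φ s| ≤ B) (hK : 0 ≤ K)
    (hmod : ∀ a b, |a| ≤ M → |b| ≤ M → |φ a - φ b| ≤ δ + K * |a - b|)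
    (hρ : IsMollifier ρ κ) (hh : 0 < h) (a : ℝ) (x : Euc N) :
    |regFlux ρ h φ w a x - φ (regSol ρ h w a x)|
      ≤ δ + K * (h⁻¹ * (oscInt ρ h w a x).toReal) := by
  set U := regSol ρ h w a x with hU
  have hUM : |U| ≤ M := H.abs_regSol_le hρ hh a x
  have hk := integrable_stKernel hρ.test.integrable (integrable_timeHat hh a) x
  have hk1 : ∫ p : Euc N × ℝ, ρ (p.1 - x) * timeHat h a p.2 = h := by
    rw [integral_stKernel, hρ.integral_eq_one, integral_timeHat hh, one_mul]
  have hnn : ∀ p : Euc N × ℝ, 0 ≤ ρ (p.1 - x) * timeHat h a p.2 := fun p =>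
    mul_nonneg (hρ.nonneg _) (timeHat_nonneg _ _ _)
  have hi := integrable_mul_stKernel (f := fun p => φ (w p)) (H.measurable_flux hφ)
    (fun p => hB _ (H.bdd p)) hρ.test.integrable (integrable_timeHat hh a) x
  have hwU : Measurable fun p => |w p - U| := (H.meas.sub_const U).abs
  have hi2 : Integrable fun p : Euc N × ℝ => |w p - U| * (ρ (p.1 - x) * timeHat h a p.2) :=
    integrable_mul_stKernel (C := 2 * M) hwU (fun p => by
      rw [abs_abs]; exact (abs_sub _ _).trans (by linarith [H.bdd p]))
      hρ.test.integrable (integrable_timeHat hh a) x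
  have hosc : ∫ p : Euc N × ℝ, |w p - U| * (ρ (p.1 - x) * timeHat h a p.2)
      ≤ (oscInt ρ h w a x).toReal := by
    have hfin : oscInt ρ h w a x ≠ ⊤ := ne_top_of_le_ne_top (by finiteness) (H.oscInt_le hρ hh a x)
    rw [← ENNReal.ofReal_le_iff_le_toReal hfin, ofReal_integral_eq_lintegral_ofReal hi2
      (Eventually.of_forall fun p => mul_nonneg (abs_nonneg _) (hnn p)), oscInt]
    refine lintegral_mono fun p => ?_
    have hρm := hρ.test.bddMeas.meas
    have hm1 := (continuous_timeBump h a).measurable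
    have hwm := H.meas
    rw [lintegral_mul_const _ (by fun_prop), ENNReal.ofReal_mul (abs_nonneg _),
      ENNReal.ofReal_mul (hρ.nonneg _)]
    gcongr
    exact H.ofReal_abs_sub_regSol_le hρ hh a x p
  have e : regFlux ρ h φ w a x - φ U
      = h⁻¹ * ∫ p : Euc N × ℝ, (φ (w p) - φ U) * (ρ (p.1 - x) * timeHat h a p.2) := by
    simp only [sub_mul]
    rw [integral_sub hi (hk.const_mul _), integral_const_mul, hk1, regFlux, stAvg]
    field_simp
  have hmain : |∫ p : Euc N × ℝ, (φ (w p) - φ U) * (ρ (p.1 - x) * timeHat h a p.2)|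
      ≤ δ * h + K * (oscInt ρ h w a x).toReal := by
    calc _ ≤ ∫ p : Euc N × ℝ, (δ * (ρ (p.1 - x) * timeHat h a p.2)
          + K * (|w p - U| * (ρ (p.1 - x) * timeHat h a p.2))) := by
          rw [← Real.norm_eq_abs]
          refine norm_integral_le_of_norm_le ((hk.const_mul δ).add (hi2.const_mul K))
            (Eventually.of_forall fun p => ?_)
          rw [norm_mul, Real.norm_eq_abs, Real.norm_of_nonneg (hnn p)]
          calc _ ≤ (δ + K * |w p - U|) * (ρ (p.1 - x) * timeHat h a p.2) :=
                mul_le_mul_of_nonneg_right (hmod _ _ (H.bdd p) hUM) (hnn p)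
            _ = _ := by ring
      _ = δ * h + K * ∫ p : Euc N × ℝ, |w p - U| * (ρ (p.1 - x) * timeHat h a p.2) := by
          rw [integral_add (hk.const_mul δ) (hi2.const_mul K), integral_const_mul,
            integral_const_mul, hk1]
      _ ≤ _ := by gcongr
  rw [e, abs_mul, abs_of_pos (inv_pos.2 hh), inv_mul_le_iff₀ hh]
  refine hmain.trans (le_of_eq ?_)
  field_simp

lemma integrable_oscInt (H : IsCylSol μ φ T M u₀ w) (hρ : IsMollifier ρ κ) (a : ℝ)
    (hfin : ∫⁻ x, oscInt ρ h w a x ≠ ⊤) : Integrable fun x => (oscInt ρ h w a x).toReal :=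
  integrable_toReal_of_lintegral_ne_top
    (measurable_oscInt hρ.test.bddMeas.meas H.meas a).aemeasurable hfin

lemma sum_integral_oscInt_le (H : IsCylSol μ φ T M u₀ w) (hρ : IsMollifier ρ κ) (hh : 0 < h)
    (hC0 : 0 ≤ C) (hC : ∀ s, deriv Real.smoothTransition s ≤ C) {ω : ℝ} (hω0 : 0 ≤ ω)
    (hω : ∀ d : Euc N × ℝ, ‖d‖ ≤ 2 * max κ h →
      ∫⁻ q, ENNReal.ofReal |w (q + d) - w q| ≤ ENNReal.ofReal ω) (J : Finset ℕ) :
    ∑ j ∈ J, ∫ x, (oscInt ρ h w j x).toReal ≤ 4 * C * ω := by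
  have hs := sum_lintegral_oscInt_le hρ H.meas hh hC0 hC hω J
  have e : ∀ j : ℕ, ∫ x, (oscInt ρ h w j x).toReal = (∫⁻ x, oscInt ρ h w j x).toReal := fun j =>
    integral_toReal (measurable_oscInt hρ.test.bddMeas.meas H.meas _).aemeasurable
      (Eventually.of_forall fun x => lt_of_le_of_lt (H.oscInt_le hρ hh j x) (by finiteness))
  simp only [e]
  rw [← ENNReal.toReal_sum fun j hj => ne_top_of_le_ne_top ENNReal.ofReal_ne_top
    ((Finset.single_le_sum (f := fun j : ℕ => ∫⁻ x, oscInt ρ h w j x)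
      (fun _ _ => zero_le) hj).trans hs)]
  exact ENNReal.toReal_le_of_le_ofReal (by positivity) hs

lemma lintegral_oscInt_ne_top (H : IsCylSol μ φ T M u₀ w) (hρ : IsMollifier ρ κ) (hh : 0 < h)
    (hC0 : 0 ≤ C) (hC : ∀ s, deriv Real.smoothTransition s ≤ C) {ω : ℝ}
    (hω : ∀ d : Euc N × ℝ, ‖d‖ ≤ 2 * max κ h →
      ∫⁻ q, ENNReal.ofReal |w (q + d) - w q| ≤ ENNReal.ofReal ω) (j : ℕ) :
    ∫⁻ x, oscInt ρ h w j x ≠ ⊤ := by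
  have hs := sum_lintegral_oscInt_le hρ H.meas hh hC0 hC hω {j}
  rw [Finset.sum_singleton] at hs
  exact ne_top_of_le_ne_top ENNReal.ofReal_ne_top hs

lemma sum_integral_abs_regSol_le (H : IsCylSol μ φ T M u₀ w) (hρ : IsMollifier ρ κ) (hh : 0 < h)
    (hC0 : 0 ≤ C) (hC : ∀ s, deriv Real.smoothTransition s ≤ C) (J : Finset ℕ) :
    h * ∑ j ∈ J, ∫ x, |regSol ρ h w j x| ≤ C * ∫ p, |w p| := by
  have hi : ∀ j : ℕ, Integrable fun p : Euc N × ℝ => |w p| * timeBump h j p.2 := fun j => by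
    obtain ⟨D, hD⟩ := exists_timeBump_le hh (j : ℝ)
    have := (continuous_timeBump h j).measurable
    exact H.integrable.abs.mul_bdd (c := D) (by fun_prop : Measurable _).aestronglyMeasurable
      (Eventually.of_forall fun p => hD p.2)
  have h1 : ∑ j ∈ J, ∫ x, |regSol ρ h w j x| ≤ ∫ p, |w p| * (C / h) := by
    calc _ ≤ ∑ j ∈ J, ∫ p : Euc N × ℝ, |w p| * timeBump h j p.2 :=
          Finset.sum_le_sum fun j _ => H.integral_abs_regSol_le hρ hh j
      _ = ∫ p : Euc N × ℝ, ∑ j ∈ J, |w p| * timeBump h j p.2 :=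
          (integral_finsetSum _ fun j _ => hi j).symm
      _ ≤ _ := by
          refine integral_mono (integrable_finsetSum _ fun j _ => hi j)
            (H.integrable.abs.mul_const _) fun p => ?_
          simp only
          rw [← Finset.mul_sum]
          exact mul_le_mul_of_nonneg_left (sum_timeBump_le hh hC0 hC J p.2) (abs_nonneg _)
  rw [integral_mul_const] at h1
  calc _ ≤ h * ((∫ p, |w p|) * (C / h)) := by gcongr
    _ = _ := by field_simp

lemma mul_integral_abs_regSol_zero_le (H : IsCylSol μ φ T M u₀ w) (hρ : IsMollifier ρ κ)
    (hh : 0 < h) (hC : ∀ s, deriv Real.smoothTransition s ≤ C) :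
    h * ∫ x, |regSol ρ h w 0 x| ≤ C * ∫ p in {p : Euc N × ℝ | p.2 ∈ Ioo 0 h}, |w p| := by
  have hS : MeasurableSet {p : Euc N × ℝ | p.2 ∈ Ioo 0 h} := measurable_snd measurableSet_Ioo
  have h1 : ∫ p : Euc N × ℝ, |w p| * timeBump h 0 p.2
      ≤ ∫ p : Euc N × ℝ, C / h * {p : Euc N × ℝ | p.2 ∈ Ioo 0 h}.indicator (fun p => |w p|) p := by
    refine integral_mono_of_nonneg (Eventually.of_forall fun p =>
      mul_nonneg (abs_nonneg _) (timeBump_nonneg hh _ _))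
      ((H.integrable.abs.indicator hS).const_mul _) (Eventually.of_forall fun p => ?_)
    simp only
    by_cases hp : p.2 ∈ Ioo 0 h
    · rw [indicator_of_mem (by exact hp), mul_comm]
      exact mul_le_mul_of_nonneg_right (div_le_div_of_nonneg_right (hC _) hh.le) (abs_nonneg _)
    · rw [indicator_of_notMem (by exact hp), timeBump_eq_zero hh (by simpa using hp)]
      simp
  rw [integral_const_mul, integral_indicator hS] at h1
  calc _ ≤ h * (C / h * ∫ p in {p : Euc N × ℝ | p.2 ∈ Ioo 0 h}, |w p|) := by
        gcongr
        exact (H.integral_abs_regSol_le hρ hh 0).trans h1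
    _ = _ := by field_simp

lemma tendsto_initial_layer (H : IsCylSol μ φ T M u₀ w) :
    Tendsto (fun h : ℝ => ∫ p in {p : Euc N × ℝ | p.2 ∈ Ioo 0 h}, |w p|) (𝓝[>] 0) (𝓝 0) := by
  have hS : ∀ h : ℝ, MeasurableSet {p : Euc N × ℝ | p.2 ∈ Ioo 0 h} :=
    fun h => measurable_snd measurableSet_Ioo
  simp only [← integral_indicator (hS _)]
  rw [show 𝓝 (0 : ℝ) = 𝓝 (∫ _ : Euc N × ℝ, (0 : ℝ)) by simp]
  refine tendsto_integral_filter_of_dominated_convergence (fun p => |w p|)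
    (Eventually.of_forall fun h => (H.meas.abs.indicator (hS h)).aestronglyMeasurable)
    (Eventually.of_forall fun h => Eventually.of_forall fun p => ?_) H.integrable.abs
    (Eventually.of_forall fun p => ?_)
  · rw [Real.norm_of_nonneg (indicator_nonneg (fun _ _ => abs_nonneg _) _)]
    exact indicator_le_self' (fun _ _ => abs_nonneg _) _
  · refine tendsto_const_nhds.congr' ?_
    by_cases hp : 0 < p.2
    · filter_upwards [Ioo_mem_nhdsGT hp] with h hh
      rw [indicator_of_notMem]
      exact fun hm => absurd hm.2 (not_lt.2 hh.2.le)
    · exact Eventually.of_forall fun h => by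
        simp only
        rw [indicator_of_notMem]
        exact fun hm => hp hm.1

end IsCylSol

end FluxError

noncomputable section Energy

variable {N : ℕ}

/-- A discrete Gronwall inequality for implicit increments. -/
lemma le_two_mul_of_implicit_increments {E a : ℕ → ℝ} {b : ℝ} (ha : ∀ j, 0 ≤ a j)
    (hb : 0 ≤ b) (hE : ∀ j, 0 ≤ E j) {n : ℕ} (hbn : b * n ≤ 1 / 2)
    (hstep : ∀ j < n, E (j + 1) - E j ≤ a j + b * E (j + 1)) :
    E n ≤ 2 * (E 0 + ∑ j ∈ Finset.range n, a j) := by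
  obtain ⟨m, hm, hmax⟩ := (Finset.range (n + 1)).exists_max_image E ⟨0, by simp⟩
  have hmn : m ≤ n := by simpa [Nat.lt_succ_iff] using hm
  have h1 : E m - E 0 ≤ ∑ j ∈ Finset.range m, (a j + b * E m) := by
    rw [← Finset.sum_range_sub]
    refine Finset.sum_le_sum fun j hj => ?_
    have hjm := Finset.mem_range.1 hj
    refine (hstep j (by omega)).trans ?_
    gcongr
    exact hmax _ (Finset.mem_range.2 (by omega))
  have h2 : ∑ j ∈ Finset.range m, a j ≤ ∑ j ∈ Finset.range n, a j :=
    Finset.sum_le_sum_of_subset_of_nonneg (Finset.range_mono hmn) fun j _ _ => ha j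
  have h3 : (m : ℝ) * (b * E m) ≤ 1 / 2 * E m := by
    have : b * (m : ℝ) ≤ 1 / 2 := (mul_le_mul_of_nonneg_left (Nat.cast_le.2 hmn) hb).trans hbn
    nlinarith [hE m]
  rw [Finset.sum_add_distrib, Finset.sum_const, Finset.card_range, nsmul_eq_mul] at h1
  have h4 := hmax n (by simp)
  linarith

lemma integral_abs_molInit_le {ρ f : Euc N → ℝ} {κ : ℝ} (hρ : IsMollifier ρ κ)
    (hf : Measurable f) (hfi : Integrable f) : ∫ x, |molInit ρ f x| ≤ ∫ x, |f x| := by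
  have hs : ∀ g : Euc N → ℝ, Integrable g →
      ∫ x, |g x| = (∫ x, max (g x - 0) 0) + ∫ x, max (0 - g x) 0 := fun g hg => by
    rw [← integral_add (by simpa using hg.pos_part) (by simpa using hg.neg_part)]
    congr 1; ext x
    rcases le_total 0 (g x) with h | h
    · simp [h, abs_of_nonneg h]
    · simp [h, abs_of_nonpos h]
  have h0 : ∀ x, molInit ρ (fun _ => (0 : ℝ)) x = 0 := fun x => by simp [molInit]
  have h1 := integral_posPart_molInit_sub_le (g := fun _ => 0) hρ hf hfi measurable_const
    (integrable_zero _ ℝ _)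
  have h2 := integral_posPart_molInit_sub_le (f := fun _ => 0) hρ measurable_const
    (integrable_zero _ ℝ _) hf hfi
  simp only [h0] at h1 h2
  rw [hs _ (integrable_molInit hρ hf hfi), hs _ hfi]
  exact add_le_add h1 h2

namespace IsCylSol

variable {μ : Measure (Euc N)} {φ ψ : ℝ → ℝ} {T M : ℝ} {u₀ : Euc N → ℝ} {w : Euc N × ℝ → ℝ}
  {ρ : Euc N → ℝ} {κ h r B δ K C c ε ω : ℝ}

/-- The discrepancy between the regularised solution and the Euler scheme. -/
def _root_.schemeErr (μ : Measure (Euc N)) (r : ℝ) (ψ : ℝ → ℝ) (ρ : Euc N → ℝ) (h : ℝ)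
    (u₀ : Euc N → ℝ) (w : Euc N × ℝ → ℝ) (j : ℕ) (x : Euc N) : ℝ :=
  regSol ρ h w j x - (eulerStep (levyTail μ r) ψ h)^[j] (molInit ρ u₀) x

lemma bddMeas_schemeErr (hμ : IsLevyMeasure μ) (H : IsCylSol μ φ T M u₀ w)
    (hρ : IsMollifier ρ κ) (hh : 0 < h) (hr : 0 < r) (hS : IsCFL (levyTail μ r) ψ K h) (j : ℕ) :
    IsBddMeas (schemeErr μ r ψ ρ h u₀ w j) := by
  have := hμ.isFiniteMeasure_levyTail hr
  exact (H.bddMeas_regSol hρ hh j).sub (hS.iterate_bddMeas (bddMeas_molInit hρ H.meas₀ H.bdd₀) j)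

lemma integrable_schemeErr (hμ : IsLevyMeasure μ) (H : IsCylSol μ φ T M u₀ w)
    (hρ : IsMollifier ρ κ) (hh : 0 < h) (hr : 0 < r) (hS : IsCFL (levyTail μ r) ψ K h) (j : ℕ) :
    Integrable (schemeErr μ r ψ ρ h u₀ w j) := by
  have := hμ.isFiniteMeasure_levyTail hr
  exact (H.integrable_regSol hρ hh j).sub (hS.iterate_integrable
    (bddMeas_molInit hρ H.meas₀ H.bdd₀) (integrable_molInit hρ H.meas₀ H.integrable₀) j)

lemma abs_schemeErr_le (hμ : IsLevyMeasure μ) (H : IsCylSol μ φ T M u₀ w)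
    (hρ : IsMollifier ρ κ) (hh : 0 < h) (hr : 0 < r) (hS : IsCFL (levyTail μ r) ψ K h) (j : ℕ)
    (x : Euc N) : |schemeErr μ r ψ ρ h u₀ w j x| ≤ 2 * M := by
  have := hμ.isFiniteMeasure_levyTail hr
  have h1 := H.abs_regSol_le hρ hh j x
  have h2 := hS.abs_iterate_le (bddMeas_molInit hρ H.meas₀ H.bdd₀) (abs_molInit_le hρ H.bdd₀) j x
  exact (abs_sub _ _).trans (by linarith)

lemma integral_abs_schemeErr_le (hμ : IsLevyMeasure μ) (H : IsCylSol μ φ T M u₀ w)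
    (hρ : IsMollifier ρ κ) (hh : 0 < h) (hr : 0 < r) (hS : IsCFL (levyTail μ r) ψ K h) (j : ℕ) :
    ∫ x, |schemeErr μ r ψ ρ h u₀ w j x| ≤ (∫ x, |regSol ρ h w j x|) + ∫ x, |u₀ x| := by
  have := hμ.isFiniteMeasure_levyTail hr
  have hm := bddMeas_molInit hρ H.meas₀ H.bdd₀
  have hi := integrable_molInit hρ H.meas₀ H.integrable₀
  have h1 := (hS.integral_abs_iterate_le hm hi j).trans
    (integral_abs_molInit_le hρ H.meas₀ H.integrable₀)
  have i1 := (H.integrable_regSol hρ hh j).abs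
  have i2 := (hS.iterate_integrable hm hi j).abs
  calc _ ≤ ∫ x, (|regSol ρ h w j x| + |(eulerStep (levyTail μ r) ψ h)^[j] (molInit ρ u₀) x|) :=
        integral_mono (H.integrable_schemeErr hμ hρ hh hr hS j).abs (i1.add i2)
          fun x => abs_sub _ _
    _ ≤ _ := by rw [integral_add i1 i2]; gcongr

lemma schemeErr_sub (hμ : IsLevyMeasure μ) (H : IsCylSol μ φ T M u₀ w) (hφ : Continuous φ)
    (hB : ∀ s, |s| ≤ M → |φ s| ≤ B) (hρ : IsMollifier ρ κ) (hh : 0 < h) (hr : 0 < r)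
    (hS : IsCFL (levyTail μ r) ψ K h) (c : ℝ) {j : ℕ} (hj : ((j : ℝ) + 2) * h < T) (x : Euc N) :
    schemeErr μ r ψ ρ h u₀ w (j + 1) x - schemeErr μ r ψ ρ h u₀ w j x
      = h * (jumpOp (levyTail μ r) (fun y => (regFlux ρ h φ w (j + 1 : ℕ) y - c)
        - ψ ((eulerStep (levyTail μ r) ψ h)^[j] (molInit ρ u₀) y)) x
        + regErr μ r ρ h φ w (j + 1 : ℕ) x) := by
  have := hμ.isFiniteMeasure_levyTail hr
  have hm := bddMeas_molInit hρ H.meas₀ H.bdd₀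
  have hG := H.bddMeas_regFlux hφ hB hρ hh (j + 1 : ℕ)
  have h1 := H.regSol_sub hμ hφ hB hρ hh hr (a := (j + 1 : ℕ)) (by simp)
    (by push_cast; linarith) x
  rw [show ((j + 1 : ℕ) : ℝ) - 1 = j by push_cast; ring] at h1
  rw [jumpOp_sub (hG.sub (IsBddMeas.const c)) (hS.comp (hS.iterate_bddMeas hm j)),
    jumpOp_sub hG (IsBddMeas.const c), jumpOp_const]
  unfold schemeErr
  rw [Function.iterate_succ_apply']
  have h2 : eulerStep (levyTail μ r) ψ h ((eulerStep (levyTail μ r) ψ h)^[j] (molInit ρ u₀)) x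
    = (eulerStep (levyTail μ r) ψ h)^[j] (molInit ρ u₀) x + h * jumpOp (levyTail μ r)
      (fun y => ψ ((eulerStep (levyTail μ r) ψ h)^[j] (molInit ρ u₀) y)) x := rfl
  rw [h2]
  linear_combination h1

/-- The resolvent energy of the discrepancy is controlled by the regularisation parameters. -/
lemma exists_schemeErr_energy_le (hμ : IsLevyMeasure μ) (H : IsCylSol μ φ T M u₀ w)
    (hφ : Continuous φ) (hφm : Monotone φ) (hB : ∀ s, |s| ≤ M → |φ s| ≤ B) (hδ : 0 ≤ δ)
    (hK : 0 < K) (hmod : ∀ a b, |a| ≤ M → |b| ≤ M → |φ a - φ b| ≤ δ + K * |a - b|)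
    (hψ : ∀ s, |s| ≤ M → |φ s - c - ψ s| ≤ δ) (hε : 0 < ε) (hKεT : K * ε * T ≤ 1 / 2)
    (hρ : IsMollifier ρ κ) (hr : 0 < r) (hr1 : r ≤ 1) (hh : 0 < h)
    (hS : IsCFL (levyTail μ r) ψ K h) (hC0 : 0 ≤ C)
    (hC : ∀ s, deriv Real.smoothTransition s ≤ C) (hω0 : 0 ≤ ω)
    (hω : ∀ d : Euc N × ℝ, ‖d‖ ≤ 2 * max κ h →
      ∫⁻ q, ENNReal.ofReal |w (q + d) - w q| ≤ ENNReal.ofReal ω)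
    {k : ℕ} (hk : ((k : ℝ) + 1) * h < T) :
    ∃ g, IsBddMeas g ∧ Integrable g ∧
      (∀ x, ε * g x - jumpOp (levyTail μ r) g x = schemeErr μ r ψ ρ h u₀ w k x) ∧
      ∫ x, g x * schemeErr μ r ψ ρ h u₀ w k x
        ≤ 2 * (ε⁻¹ * (B * ∫ y, |Lop μ ρ y|) * (C * (∫ p in {p : Euc N × ℝ | p.2 ∈ Ioo 0 h}, |w p|)
            + h * ∫ x, |u₀ x|)
          + 2 * ((8 * δ + B * (∫ y, |Lop μ ρ y - jumpOp (levyTail μ r) ρ y|) / ε)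
              * (C * (∫ p, |w p|) + T * ∫ x, |u₀ x|)
            + 4 * M * (K * (4 * C * ω)
              + K * (T * (2 * h * (levyTail μ r).real univ * K * ∫ x, |u₀ x|))))) := by
  have := hμ.isFiniteMeasure_levyTail hr
  have hν := hμ.map_neg_levyTail r
  have hm := bddMeas_molInit hρ H.meas₀ H.bdd₀
  have hi := integrable_molInit hρ H.meas₀ H.integrable₀
  have hM : 0 ≤ M := (abs_nonneg _).trans (H.bdd₀ 0)
  have hT : 0 < T := lt_trans (by positivity) hk
  have hhT : h < T := by nlinarith [Nat.cast_nonneg (α := ℝ) k]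
  have hkT : (k : ℝ) * h ≤ T := by linarith
  set ν := levyTail μ r with hνdef
  set W := schemeErr μ r ψ ρ h u₀ w with hWdef
  set z : ℕ → Euc N → ℝ := fun j => (eulerStep ν ψ h)^[j] (molInit ρ u₀) with hz
  set η := B * ∫ y, |Lop μ ρ y - jumpOp ν ρ y| with hη
  set U0 := ∫ x, |u₀ x| with hU0
  have hU0' : 0 ≤ U0 := integral_nonneg fun _ => abs_nonneg _
  have hzb : ∀ j, IsBddMeas (z j) := fun j => hS.iterate_bddMeas hm j
  have hzi : ∀ j, Integrable (z j) := fun j => hS.iterate_integrable hm hi j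
  have hzM : ∀ j x, |z j x| ≤ M := fun j x => hS.abs_iterate_le hm (abs_molInit_le hρ H.bdd₀) j x
  have hz1 : ∀ j, ∫ x, |z j x| ≤ U0 := fun j =>
    (hS.integral_abs_iterate_le hm hi j).trans (integral_abs_molInit_le hρ H.meas₀ H.integrable₀)
  have hWb : ∀ j, IsBddMeas (W j) := fun j => H.bddMeas_schemeErr hμ hρ hh hr hS j
  have hWi : ∀ j, Integrable (W j) := fun j => H.integrable_schemeErr hμ hρ hh hr hS j
  choose g hgb hgi hgW hgM hg1 using fun j => exists_resolvent (ν := ν) hε (hWb j) (hWi j)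
    (fun x => H.abs_schemeErr_le hμ hρ hh hr hS j x)
  refine ⟨g k, hgb k, hgi k, hgW k, ?_⟩
  set O : ℕ → Euc N → ℝ := fun j x => (oscInt ρ h w j x).toReal with hO
  have hOi : ∀ j, Integrable (O j) := fun j =>
    H.integrable_oscInt hρ _ (H.lintegral_oscInt_ne_top hρ hh hC0 hC hω j)
  set R : ℕ → Euc N → ℝ := fun j x => K * (h⁻¹ * O (j + 1) x) + K * |z (j + 1) x - z j x| with hR
  have hRi1 : ∀ j, Integrable fun x => K * (h⁻¹ * O (j + 1) x) := fun j =>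
    ((hOi _).const_mul _).const_mul _
  have hRi2 : ∀ j, Integrable fun x => K * |z (j + 1) x - z j x| := fun j =>
    ((hzi _).sub (hzi _)).abs.const_mul _
  have hRi : ∀ j, Integrable (R j) := fun j => (hRi1 j).add (hRi2 j)
  have hR0 : ∀ j x, 0 ≤ R j x := fun j x => by
    have : 0 ≤ O (j + 1) x := ENNReal.toReal_nonneg
    simp only [hR]; positivity
  have hη0 : 0 ≤ η := (abs_nonneg _).trans (H.abs_regErr_le hμ hB hρ hh hr hr1 0 0)
  have hB0 : 0 ≤ B := (abs_nonneg _).trans (hB 0 (by simpa using hM))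
  have hA0 : 0 ≤ 8 * δ + η / ε := by positivity
  set E : ℕ → ℝ := fun j => ∫ x, g j x * W j x with hE
  have hE0 : ∀ j, 0 ≤ E j := fun j => by
    have h1 := resolvent_form_coercive (ν := ν) (ε := ε) (hgb j) (hgi j)
    simp only [hgW] at h1
    exact (mul_nonneg hε.le (integral_nonneg fun _ => sq_nonneg _)).trans h1
  have hstep : ∀ j < k, E (j + 1) - E j ≤ 2 * h * ((8 * δ + η / ε) * (∫ x, |W (j + 1) x|)
      + 4 * M * ∫ x, R j x) + h * K * ε * E (j + 1) := by
    intro j hj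
    have hjk : ((j : ℝ) + 2) * h < T := by
      have : (j : ℝ) + 1 ≤ k := by exact_mod_cast hj
      nlinarith
    have hres : E (j + 1) - E j ≤ 2 * h * ((8 * δ + η / ε) * (∫ x, |W (j + 1) x|)
        + 4 * M * (∫ x, R j x) + K / 2 * ε * E (j + 1)) :=
              resolvent_energy_step hν hε hφm hδ hK hmod
      (fun x => H.abs_regSol_le hρ hh (j + 1 : ℕ) x) (hzM (j + 1)) (fun x => rfl) (hWb (j + 1))
      (hWi (j + 1)) (hWb j) (hgb (j + 1)) (hgi (j + 1)) (hgb j) (hgi j) (hgW (j + 1)) (hgW j)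
      (hgM (j + 1)) (hg1 (j + 1)) hh.le
      (((H.bddMeas_regFlux hφ hB hρ hh (j + 1 : ℕ)).sub (IsBddMeas.const c)).sub
        (hS.comp (hzb j)))
      (H.bddMeas_regErr hμ hφ hB hρ hh hr hr1 (j + 1 : ℕ))
      (fun x => H.abs_regErr_le hμ hB hρ hh hr hr1 (j + 1 : ℕ) x)
      (fun x => H.schemeErr_sub hμ hφ hB hρ hh hr hS c hjk x) (hRi j) (hR0 j) (fun x => by
        have h1 := H.abs_regFlux_sub_le hφ hB hK.le hmod hρ hh (j + 1 : ℕ) x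
        have h2 := hψ _ (hzM (j + 1) x)
        have h3 := hS.lip (z (j + 1) x) (z j x)
        have e : regFlux ρ h φ w (j + 1 : ℕ) x - c - ψ (z j x)
            - (φ (regSol ρ h w (j + 1 : ℕ) x) - φ (z (j + 1) x))
            = (regFlux ρ h φ w (j + 1 : ℕ) x - φ (regSol ρ h w (j + 1 : ℕ) x))
              + (φ (z (j + 1) x) - c - ψ (z (j + 1) x)) + (ψ (z (j + 1) x) - ψ (z j x)) := by ring
        simp only [hR]
        rw [e]
        refine (abs_add_three _ _ _).trans ?_
        linarith)
    refine hres.trans (le_of_eq ?_)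
    ring
  have hgron := le_two_mul_of_implicit_increments (E := E) (a := fun j =>
    2 * h * ((8 * δ + η / ε) * (∫ x, |W (j + 1) x|) + 4 * M * ∫ x, R j x)) (b := h * K * ε)
    (fun j => by
      have h1 : 0 ≤ ∫ x, |W (j + 1) x| := integral_nonneg fun _ => abs_nonneg _
      have h2 : 0 ≤ ∫ x, R j x := integral_nonneg (hR0 j)
      positivity) (by positivity) hE0 (n := k) (by
      calc h * K * ε * k = K * ε * (k * h) := by ring
        _ ≤ K * ε * T := by gcongr
        _ ≤ _ := hKεT) hstep
  refine hgron.trans ?_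
  have hfirst : E 0 ≤ ε⁻¹ * (B * ∫ y, |Lop μ ρ y|)
      * (C * (∫ p in {p : Euc N × ℝ | p.2 ∈ Ioo 0 h}, |w p|) + h * U0) := by
    set L := B * ∫ y, |Lop μ ρ y| with hL
    have hL0 : 0 ≤ L := mul_nonneg hB0 (integral_nonneg fun _ => abs_nonneg _)
    have hW0 : ∀ x, |W 0 x| ≤ h * L := fun x => by
      have := H.abs_regSol_zero_sub_le hμ hB hρ hh hhT x
      simpa [hWdef, schemeErr] using this
    have h1 : E 0 ≤ (∫ x, |g 0 x|) * (h * L) := by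
      rw [← integral_mul_const]
      refine integral_mono ((hWb 0).integrable_mul (hgi 0)) ((hgi 0).abs.mul_const _) fun x => ?_
      refine (le_abs_self _).trans ?_
      simp only
      rw [abs_mul]
      gcongr
      exact hW0 x
    have h2 : ∫ x, |g 0 x| ≤ ε⁻¹ * ((∫ x, |regSol ρ h w 0 x|) + U0) := by
      rw [le_inv_mul_iff₀ hε]
      have := H.integral_abs_schemeErr_le hμ hρ hh hr hS 0
      rw [Nat.cast_zero] at this
      exact (hg1 0).trans this
    have h3 := H.mul_integral_abs_regSol_zero_le hρ hh hC
    calc E 0 ≤ ε⁻¹ * ((∫ x, |regSol ρ h w 0 x|) + U0) * (h * L) := h1.trans (by gcongr)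
      _ = ε⁻¹ * L * (h * (∫ x, |regSol ρ h w 0 x|) + h * U0) := by ring
      _ ≤ _ := by gcongr
  have hsum1 : h * ∑ j ∈ Finset.range k, ∫ x, |W (j + 1) x| ≤ C * (∫ p, |w p|) + T * U0 := by
    have h1 : ∑ j ∈ Finset.range k, ∫ x, |W (j + 1) x|
        ≤ (∑ j ∈ (Finset.range k).map ⟨Nat.succ, Nat.succ_injective⟩, ∫ x, |regSol ρ h w j x|)
          + k * U0 := by
      rw [Finset.sum_map]
      calc _ ≤ ∑ j ∈ Finset.range k, ((∫ x, |regSol ρ h w (j + 1 : ℕ) x|) + U0) :=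
            Finset.sum_le_sum fun j _ => H.integral_abs_schemeErr_le hμ hρ hh hr hS (j + 1)
        _ = _ := by
            rw [Finset.sum_add_distrib, Finset.sum_const, Finset.card_range, nsmul_eq_mul]
            rfl
    have h2 := H.sum_integral_abs_regSol_le hρ hh hC0 hC
      ((Finset.range k).map ⟨Nat.succ, Nat.succ_injective⟩)
    have h3 := mul_le_mul_of_nonneg_left h1 hh.le
    have h4 := mul_le_mul_of_nonneg_right hkT hU0'
    linarith
  have hsum2 : h * ∑ j ∈ Finset.range k, ∫ x, R j x
      ≤ K * (4 * C * ω) + K * (T * (2 * h * ν.real univ * K * U0)) := by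
    have h0 : ∀ j, ∫ x, R j x ≤ K * h⁻¹ * (∫ x, O (j + 1) x) + K * (2 * h * ν.real univ * K * U0) :=
      fun j => by
      simp only [hR]
      rw [integral_add (hRi1 j) (hRi2 j), integral_const_mul, integral_const_mul,
        integral_const_mul, mul_assoc]
      gcongr
      have := hS.integral_abs_eulerStep_sub_le (hzb j) (hzi j)
      simp only [hz, Function.iterate_succ_apply']
      refine this.trans ?_
      have := hS.lip_nonneg
      gcongr
      exact hz1 j
    have h1 := Finset.sum_le_sum fun j (_ : j ∈ Finset.range k) => h0 j
    rw [Finset.sum_add_distrib, ← Finset.mul_sum, Finset.sum_const, Finset.card_range,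
      nsmul_eq_mul] at h1
    have h2 := H.sum_integral_oscInt_le hρ hh hC0 hC hω0 hω
      ((Finset.range k).map ⟨Nat.succ, Nat.succ_injective⟩)
    rw [Finset.sum_map] at h2
    have h2' : ∑ j ∈ Finset.range k, ∫ x, O (j + 1) x ≤ 4 * C * ω := h2
    calc _ ≤ h * (K * h⁻¹ * (∑ j ∈ Finset.range k, ∫ x, O (j + 1) x)
          + k * (K * (2 * h * ν.real univ * K * U0))) := by gcongr
      _ = K * (∑ j ∈ Finset.range k, ∫ x, O (j + 1) x)
          + K * ((k * h) * (2 * h * ν.real univ * K * U0)) := by field_simp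
      _ ≤ _ := by gcongr
  have hs : ∑ j ∈ Finset.range k, 2 * h * ((8 * δ + η / ε) * (∫ x, |W (j + 1) x|)
      + 4 * M * ∫ x, R j x)
      = 2 * ((8 * δ + η / ε) * (h * ∑ j ∈ Finset.range k, ∫ x, |W (j + 1) x|)
        + 4 * M * (h * ∑ j ∈ Finset.range k, ∫ x, R j x)) := by
    rw [← Finset.mul_sum, Finset.sum_add_distrib, ← Finset.mul_sum, ← Finset.mul_sum]
    ring
  rw [hs]
  gcongr

end IsCylSol

end Energy

noncomputable section Convergence

variable {N : ℕ}

lemma tendsto_id_nhdsGT_zero : Tendsto (fun r : ℝ => r) (𝓝[>] 0) (𝓝 0) :=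
  tendsto_id.mono_left nhdsWithin_le_nhds

lemma eventually_isCFL (ν : Measure (Euc N)) {K : ℝ} :
    ∀ᶠ h in 𝓝[>] (0 : ℝ), ∀ ψ : ℝ → ℝ, Monotone ψ → (∀ a b, |ψ a - ψ b| ≤ K * |a - b|) →
      ψ 0 = 0 → IsCFL ν ψ K h := by
  have h1 : Tendsto (fun h : ℝ => h * ν.real univ * K) (𝓝[>] 0) (𝓝 0) := by
    simpa using (tendsto_id_nhdsGT_zero.mul_const (ν.real univ)).mul_const K
  filter_upwards [h1.eventually_le_const one_pos, self_mem_nhdsWithin] with h hh hpos ψ h1 h2 h3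
  exact ⟨h1, h2, h3, le_of_lt hpos, hh⟩

namespace IsCylSol

variable {μ : Measure (Euc N)} {φ : ℝ → ℝ} {T M : ℝ} {u₀ : Euc N → ℝ} {w : Euc N × ℝ → ℝ}
  {B ζ : ℝ}

/-- The discrepancy between the regularised solution and the Euler scheme vanishes weakly when the
parameters go to zero one after the other. -/
lemma eventually_abs_integral_schemeErr_le (hμ : IsLevyMeasure μ) (H : IsCylSol μ φ T M u₀ w)
    (hφ : Continuous φ) (hφm : Monotone φ) (hB : ∀ s, |s| ≤ M → |φ s| ≤ B)
    {θ : Euc N → ℝ} (hθ : IsTestFn θ) (hζ : 0 < ζ) :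
    ∀ᶠ δ in 𝓝[>] (0 : ℝ), ∀ K, 0 < K →
      (∀ a b, |a| ≤ M → |b| ≤ M → |φ a - φ b| ≤ δ + K * |a - b|) → ∀ ε, 0 < ε → ε ≤ 1 →
      K * ε * T ≤ 1 / 2 → ∀ᶠ κ in 𝓝[>] (0 : ℝ), ∀ ρ, IsMollifier ρ κ →
      ∀ᶠ r in 𝓝[>] (0 : ℝ), ∀ᶠ h in 𝓝[>] (0 : ℝ), ∀ ψ c, Monotone ψ →
      (∀ a b, |ψ a - ψ b| ≤ K * |a - b|) → ψ 0 = 0 → (∀ s, |s| ≤ M → |φ s - c - ψ s| ≤ δ) →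
      ∀ k : ℕ, ((k : ℝ) + 1) * h < T → |∫ x, θ x * schemeErr μ r ψ ρ h u₀ w k x| ≤ ζ := by
  obtain ⟨D, hD0, hD⟩ := hμ.eventually_dirichlet_le hθ
  obtain ⟨C, hC0, hC⟩ := exists_deriv_smoothTransition_le
  have hM : 0 ≤ M := (abs_nonneg _).trans (H.bdd₀ 0)
  set S := C * (∫ p, |w p|) + T * ∫ x, |u₀ x| with hS
  have hζ2 : 0 < ζ ^ 2 / 4 := by positivity
  have t1 : Tendsto (fun δ : ℝ => 2 * (2 * (8 * δ * S)) * D) (𝓝[>] 0) (𝓝 0) := by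
    simpa using ((((tendsto_id_nhdsGT_zero.const_mul 8).mul_const S).const_mul 2).const_mul
      2).mul_const D
  filter_upwards [t1.eventually_le_const hζ2, self_mem_nhdsWithin] with δ hδ hδ0 K hK hmod ε hε
    hε1 hKε
  obtain ⟨ω, hω0, hω⟩ : ∃ ω > 0, 2 * (2 * (4 * M * (K * (4 * C * ω)))) * D ≤ ζ ^ 2 / 4 := by
    have t2 : Tendsto (fun ω : ℝ => 2 * (2 * (4 * M * (K * (4 * C * ω)))) * D) (𝓝[>] 0) (𝓝 0) := by
      simpa using (((((tendsto_id_nhdsGT_zero.const_mul (4 * C)).const_mul K).const_mul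
        (4 * M)).const_mul 2).const_mul 2).mul_const D
    obtain ⟨ω, h1, h2⟩ := ((t2.eventually_le_const hζ2).and self_mem_nhdsWithin).exists
    exact ⟨ω, h2, h1⟩
  obtain ⟨τ, hτ0, hτ⟩ := exists_lintegral_translate_le H.integrable hω0
  filter_upwards [Ioc_mem_nhdsGT (half_pos hτ0)] with κ hκ ρ hρ
  have t3 : Tendsto (fun r => 2 * (2 * (B * (∫ y, |Lop μ ρ y - jumpOp (levyTail μ r) ρ y|) / ε
      * S)) * D) (𝓝[>] 0) (𝓝 0) := by
    simpa using ((((((hμ.tendsto_integral_abs_lop_sub hρ.test).const_mul B).div_const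
      ε).mul_const S).const_mul 2).const_mul 2).mul_const D
  filter_upwards [t3.eventually_le_const hζ2, hD, Ioc_mem_nhdsGT one_pos] with r hr hrD hr1
  set A := ε⁻¹ * (B * ∫ y, |Lop μ ρ y|) with hA
  set ν := levyTail μ r with hν
  have t4 : Tendsto (fun h : ℝ => 2 * (A * (C * (∫ p in {p : Euc N × ℝ | p.2 ∈ Ioo 0 h}, |w p|)
      + h * ∫ x, |u₀ x|) + 2 * (4 * M * (K * (T * (2 * h * ν.real univ * K * ∫ x, |u₀ x|))))) * D)
      (𝓝[>] 0) (𝓝 0) := by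
    have a1 := ((H.tendsto_initial_layer.const_mul C).add
      (tendsto_id_nhdsGT_zero.mul_const (∫ x, |u₀ x|))).const_mul A
    have a2 := (((((((tendsto_id_nhdsGT_zero.const_mul 2).mul_const (ν.real univ)).mul_const
      K).mul_const (∫ x, |u₀ x|)).const_mul T).const_mul K).const_mul (4 * M)).const_mul 2
    simpa using ((a1.add a2).const_mul 2).mul_const D
  filter_upwards [t4.eventually_le_const hζ2, eventually_isCFL ν (K := K),
    Ioc_mem_nhdsGT (half_pos hτ0)] with h hh hcfl hhτ ψ c hψ1 hψ2 hψ3 hψ4 k hk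
  have hCFL := hcfl ψ hψ1 hψ2 hψ3
  obtain ⟨g, hgb, hgi, hgW, hE⟩ := H.exists_schemeErr_energy_le hμ hφ hφm hB (le_of_lt hδ0) hK
    hmod hψ4 hε hKε hρ hr1.1 hr1.2 hhτ.1 hCFL hC0.le hC hω0.le (fun d hd => hτ d (hd.trans (by
      rcases max_cases κ h with ⟨e, -⟩ | ⟨e, -⟩ <;> rw [e] <;> [linarith [hκ.2]; linarith [hhτ.2]])))
    hk
  have := hμ.isFiniteMeasure_levyTail hr1.1
  have hsq := sq_integral_mul_le_resolvent_energy (hμ.map_neg_levyTail r) hε.le hgb hgi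
    (H.bddMeas_schemeErr hμ hρ hhτ.1 hr1.1 hCFL k) hgW hθ.bddMeas hθ.integrable
  have hE0 : 0 ≤ ∫ x, g x * schemeErr μ r ψ ρ h u₀ w k x := by
    have h1 := resolvent_form_coercive (ν := levyTail μ r) (ε := ε) hgb hgi
    simp only [hgW] at h1
    exact (mul_nonneg hε.le (integral_nonneg fun _ => sq_nonneg _)).trans h1
  refine abs_le_of_sq_le_sq (hsq.trans ?_) hζ.le
  calc _ ≤ (∫ x, g x * schemeErr μ r ψ ρ h u₀ w k x) * D := by
        gcongr
        exact hrD ε hε.le hε1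
    _ ≤ _ := mul_le_mul_of_nonneg_right hE hD0
    _ ≤ ζ ^ 2 := by rw [← hA, ← hS, ← hν]; linarith

end IsCylSol

/-- Approximate contraction for the regularised solutions. -/
lemma exists_mollifier_integral_regSol_sub_le {μ : Measure (Euc N)} {φ : ℝ → ℝ} {T M ζ : ℝ}
    {u₀ v₀ : Euc N → ℝ} {u v : Euc N × ℝ → ℝ} (hμ : IsLevyMeasure μ)
    (hu : IsCylSol μ φ T M u₀ u) (hv : IsCylSol μ φ T M v₀ v) (hφ : Continuous φ)
    (hφm : Monotone φ) (hT : 0 < T) {θ : Euc N → ℝ} (hθ : IsTestFn θ)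
    (hθ0 : ∀ x, 0 ≤ θ x) (hθ1 : ∀ x, θ x ≤ 1) (hζ : 0 < ζ) :
    ∀ᶠ κ in 𝓝[>] (0 : ℝ), ∀ ρ : Euc N → ℝ, IsMollifier ρ κ → ∀ᶠ h in 𝓝[>] (0 : ℝ),
      ∀ k : ℕ, ((k : ℝ) + 1) * h < T →
      ∫ x, θ x * (regSol ρ h u k x - regSol ρ h v k x) ≤ (∫ x, max (u₀ x - v₀ x) 0) + ζ := by
  obtain ⟨B, hB⟩ : ∃ B, ∀ s, |s| ≤ M → |φ s| ≤ B := by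
    obtain ⟨B, hB⟩ := (isCompact_Icc (a := -M) (b := M)).exists_bound_of_continuousOn
      hφ.continuousOn
    exact ⟨B, fun s hs => hB s (abs_le.1 hs)⟩
  have hM : 0 ≤ M := (abs_nonneg _).trans (hu.bdd₀ 0)
  have hζ2 := half_pos hζ
  obtain ⟨δ, ⟨hδu, hδv⟩, hδ0⟩ :=
    (((hu.eventually_abs_integral_schemeErr_le hμ hφ hφm hB hθ hζ2).and
    (hv.eventually_abs_integral_schemeErr_le hμ hφ hφm hB hθ hζ2)).and self_mem_nhdsWithin).exists
  obtain ⟨K, hK, hmod⟩ := exists_affine_modulus hφ M hδ0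
  have hKT : 0 < 1 / (2 * K * T) := by positivity
  obtain ⟨ε, hε0, hε1, hKε⟩ : ∃ ε, 0 < ε ∧ ε ≤ 1 ∧ K * ε * T ≤ 1 / 2 := by
    refine ⟨min 1 (1 / (2 * K * T)), lt_min one_pos hKT, min_le_left _ _, ?_⟩
    calc _ ≤ K * (1 / (2 * K * T)) * T := by gcongr; exact min_le_right _ _
      _ = _ := by field_simp
  obtain ⟨ψ, c, hψ1, hψ2, hψ3, hψ4⟩ :=
      exists_monotone_lipschitz_approx hφm hM (le_of_lt hδ0) hK hmod
  filter_upwards [hδu K hK hmod ε hε0 hε1 hKε, hδv K hK hmod ε hε0 hε1 hKε] with κ hκu hκv ρ hρ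
  obtain ⟨r, ⟨hru, hrv⟩, hr0⟩ := (((hκu ρ hρ).and (hκv ρ hρ)).and self_mem_nhdsWithin).exists
  filter_upwards [hru, hrv, eventually_isCFL (levyTail μ r) (K := K), self_mem_nhdsWithin] with h
    hhu hhv hcfl hh k hk
  have hS := hcfl ψ hψ1 hψ2 hψ3
  have := hμ.isFiniteMeasure_levyTail hr0
  have hu1 := hhu ψ c hψ1 hψ2 hψ3 hψ4 k hk
  have hv1 := hhv ψ c hψ1 hψ2 hψ3 hψ4 k hk
  set zu := (eulerStep (levyTail μ r) ψ h)^[k] (molInit ρ u₀) with hzu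
  set zv := (eulerStep (levyTail μ r) ψ h)^[k] (molInit ρ v₀) with hzv
  have hmu := bddMeas_molInit hρ hu.meas₀ hu.bdd₀
  have hmv := bddMeas_molInit hρ hv.meas₀ hv.bdd₀
  have hiu := integrable_molInit hρ hu.meas₀ hu.integrable₀
  have hiv := integrable_molInit hρ hv.meas₀ hv.integrable₀
  have hzi : Integrable fun x => zu x - zv x :=
    (hS.iterate_integrable hmu hiu k).sub (hS.iterate_integrable hmv hiv k)
  have hz : ∫ x, θ x * (zu x - zv x) ≤ ∫ x, max (u₀ x - v₀ x) 0 := by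
    calc _ ≤ ∫ x, max (zu x - zv x) 0 := by
          refine integral_mono (hθ.bddMeas.integrable_mul hzi |>.congr
            (Eventually.of_forall fun x => mul_comm _ _)) hzi.pos_part fun x => ?_
          calc _ ≤ θ x * max (zu x - zv x) 0 :=
                mul_le_mul_of_nonneg_left (le_max_left _ _) (hθ0 x)
            _ ≤ 1 * max (zu x - zv x) 0 :=
                mul_le_mul_of_nonneg_right (hθ1 x) (le_max_right _ _)
            _ = _ := one_mul _
      _ ≤ _ := hS.integral_posPart_iterate_le hmu hiu hmv hiv k
      _ ≤ _ := integral_posPart_molInit_sub_le hρ hu.meas₀ hu.integrable₀ hv.meas₀ hv.integrable₀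
  have hθm : ∀ {f : Euc N → ℝ}, Integrable f → Integrable fun x => θ x * f x := fun hf =>
    (hθ.bddMeas.integrable_mul hf).congr (Eventually.of_forall fun x => mul_comm _ _)
  have iu := hθm (hu.integrable_schemeErr hμ hρ hh hr0 hS k)
  have iv := hθm (hv.integrable_schemeErr hμ hρ hh hr0 hS k)
  have iz := hθm hzi
  have e : ∀ x, θ x * (regSol ρ h u k x - regSol ρ h v k x)
      = (θ x * schemeErr μ r ψ ρ h u₀ u k x - θ x * schemeErr μ r ψ ρ h v₀ v k x)
        + θ x * (zu x - zv x) := fun x => by simp only [schemeErr, ← hzu, ← hzv]; ring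
  have iuv : Integrable fun x =>
    θ x * schemeErr μ r ψ ρ h u₀ u k x - θ x * schemeErr μ r ψ ρ h v₀ v k x := iu.sub iv
  simp only [e]
  rw [integral_add iuv iz, integral_sub iu iv]
  have h1 := le_of_abs_le hu1
  have h2 := neg_le_of_abs_le hv1
  linarith

end Convergence

noncomputable section Trace

variable {N : ℕ} {T M κ h : ℝ} {u : Euc N → ℝ → ℝ} {ρ θ : Euc N → ℝ}

lemma IsMollifier.comp_neg (hρ : IsMollifier ρ κ) : IsMollifier (fun z => ρ (-z)) κ where
  test := ⟨hρ.test.1.comp contDiff_neg, hρ.test.2.comp_homeomorph (Homeomorph.neg _)⟩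
  nonneg y := hρ.nonneg _
  integral_eq_one := by rw [integral_neg_eq_self ρ volume, hρ.integral_eq_one]
  zero_off y hy := hρ.zero_off _ (by rwa [norm_neg])

lemma abs_molInit_sub_le (hρ : IsMollifier ρ κ) (hθ : IsTestFn θ) {ζ : ℝ}
    (hζ : ∀ x y, ‖x - y‖ ≤ κ → |θ x - θ y| ≤ ζ) (x : Euc N) : |molInit ρ θ x - θ x| ≤ ζ := by
  have i1 : Integrable fun y => ρ (y - x) := hρ.test.integrable.comp_sub_right x
  have e1 : ∫ y, ρ (y - x) = 1 := by rw [integral_sub_right_eq_self ρ x, hρ.integral_eq_one]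
  have e : molInit ρ θ x - θ x = ∫ y, (θ y - θ x) * ρ (y - x) := by
    simp only [sub_mul]
    rw [integral_sub (integrable_mul_mollifier hρ hθ.integrable x) (i1.const_mul _),
      integral_const_mul, e1, mul_one, molInit]
  rw [e, ← Real.norm_eq_abs]
  refine (norm_integral_le_of_norm_le (i1.const_mul ζ) (Eventually.of_forall fun y => ?_)).trans
    (le_of_eq ?_)
  · rw [norm_mul, Real.norm_of_nonneg (hρ.nonneg _), Real.norm_eq_abs]
    by_cases hy : ‖y - x‖ ≤ κ
    · exact mul_le_mul_of_nonneg_right (hζ _ _ hy) (hρ.nonneg _)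
    · simp [hρ.zero_off _ (not_le.1 hy)]
  · rw [integral_const_mul, e1, mul_one]

lemma molInit_eq_zero (hρ : IsMollifier ρ κ) {x : Euc N}
    (hx : x ∉ Metric.cthickening κ (tsupport θ)) : molInit ρ θ x = 0 := by
  refine integral_eq_zero_of_ae (Eventually.of_forall fun y => ?_)
  simp only [Pi.zero_apply]
  by_cases hy : y ∈ tsupport θ
  · rw [hρ.zero_off, mul_zero]
    by_contra hle
    refine hx (Metric.mem_cthickening_of_dist_le x y κ _ hy ?_)
    rw [dist_comm, dist_eq_norm]
    exact not_lt.1 hle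
  · rw [image_eq_zero_of_notMem_tsupport hy, zero_mul]

namespace IsCylSol

variable {μ : Measure (Euc N)} {φ : ℝ → ℝ} {u₀ : Euc N → ℝ} {w : Euc N × ℝ → ℝ}

lemma integral_mul_regSol (H : IsCylSol μ φ T M u₀ w) (hρ : IsMollifier ρ κ) (hh : 0 < h)
    (hθ : IsTestFn θ) (a : ℝ) :
    ∫ x, θ x * regSol ρ h w a x
      = ∫ s, ∫ y, w (y, s) * (molInit (fun z => ρ (-z)) θ y * timeBump h a s) := by
  obtain ⟨D, hD⟩ := exists_timeBump_le hh a
  obtain ⟨Cθ, hCθ⟩ := hθ.bddMeas.bdd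
  have hθm := hθ.bddMeas.meas
  have hbm := (continuous_timeBump h a).measurable
  have hi := integrable_prod_stKernel H.meas H.integrable hρ.test.bddMeas.meas hρ.test.integrable
    hbm hD
  have hi2 : Integrable (fun q : Euc N × (Euc N × ℝ) =>
      w q.2 * (ρ (q.2.1 - q.1) * timeBump h a q.2.2) * θ q.1) (volume.prod volume) :=
    hi.mul_bdd (c := Cθ) (by fun_prop : Measurable _).aestronglyMeasurable
      (Eventually.of_forall fun q => hCθ _)
  have hΘ := bddMeas_molInit hρ.comp_neg hθm hCθ
  have hΘm := hΘ.meas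
  obtain ⟨CΘ, hCΘ⟩ := hΘ.bdd
  have hi3 : Integrable (fun p : Euc N × ℝ =>
      w p * (molInit (fun z => ρ (-z)) θ p.1 * timeBump h a p.2)) (volume.prod volume) := by
    refine H.integrable.mul_bdd (c := CΘ * D)
      (by fun_prop : Measurable _).aestronglyMeasurable (Eventually.of_forall fun p => ?_)
    rw [norm_mul]
    exact mul_le_mul (hCΘ _) (hD _) (norm_nonneg _) ((abs_nonneg _).trans (hCΘ 0))
  calc ∫ x, θ x * regSol ρ h w a x
      = ∫ x, ∫ p : Euc N × ℝ, w p * (ρ (p.1 - x) * timeBump h a p.2) * θ x := by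
        congr 1; ext x
        rw [integral_mul_const, mul_comm]; rfl
    _ = ∫ p : Euc N × ℝ, ∫ x, w p * (ρ (p.1 - x) * timeBump h a p.2) * θ x :=
        integral_integral_swap hi2
    _ = ∫ p : Euc N × ℝ, w p * (molInit (fun z => ρ (-z)) θ p.1 * timeBump h a p.2) := by
        congr 1; ext p
        have e : ∀ x, w p * (ρ (p.1 - x) * timeBump h a p.2) * θ x
            = w p * timeBump h a p.2 * (θ x * ρ (-(x - p.1))) := fun x => by
          rw [neg_sub]; ring
        simp only [e]
        rw [integral_const_mul, molInit]
        ring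
    _ = _ := by rw [Measure.volume_eq_prod, integral_prod_symm _ hi3]

lemma ae_slice_eq (hw : ∀ᵐ p ∂(QTvol N T), w p = u p.1 p.2) :
    ∀ᵐ s : ℝ, s ∈ Ioo 0 T → ∀ᵐ y : Euc N, w (y, s) = u y s := by
  rw [← ae_restrict_iff' measurableSet_Ioo]
  have h1 : ∀ᵐ q ∂((volume : Measure ℝ).restrict (Ioo 0 T)).prod (volume : Measure (Euc N)),
      w q.swap = u q.2 q.1 :=
    Measure.measurePreserving_swap.quasiMeasurePreserving.ae hw
  exact Measure.ae_ae_of_ae_prod h1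

end IsCylSol

end Trace

noncomputable section TraceLimit

variable {N : ℕ} {T M κ h : ℝ} {u v : Euc N → ℝ → ℝ} {ρ θ : Euc N → ℝ}

namespace MemCL1loc

variable {K : Set (Euc N)} {Θ : Euc N → ℝ} {s t D : ℝ}

lemma integrable_mul (hC : MemCL1loc T u) (hK : IsCompact K) (hs : s ∈ Icc 0 T)
    (hΘ : IsBddMeas Θ) (h0 : ∀ x, x ∉ K → Θ x = 0) : Integrable fun x => u x s * Θ x := by
  have h1 := hΘ.integrable_mul ((hC K hK).1 s hs)
  refine (integrableOn_iff_integrable_of_support_subset (s := K) fun x hx => ?_).1 h1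
  by_contra hxK
  exact hx (by simp [h0 x hxK])

lemma abs_integral_mul_sub_le (hC : MemCL1loc T u) (hK : IsCompact K) (hs : s ∈ Icc 0 T)
    (ht : t ∈ Icc 0 T) (hΘ : IsBddMeas Θ) (h0 : ∀ x, x ∉ K → Θ x = 0) (hD : ∀ x, |Θ x| ≤ D) :
    |(∫ x, u x s * Θ x) - ∫ x, u x t * Θ x| ≤ D * ∫ x in K, |u x s - u x t| := by
  have i1 := ((hC K hK).1 s hs).sub ((hC K hK).1 t ht)
  rw [← integral_sub (hC.integrable_mul hK hs hΘ h0) (hC.integrable_mul hK ht hΘ h0),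
    ← setIntegral_eq_integral_of_forall_compl_eq_zero (s := K) (fun x hx => by simp [h0 x hx]),
    ← integral_const_mul, ← Real.norm_eq_abs]
  refine norm_integral_le_of_norm_le (i1.abs.const_mul D) (Eventually.of_forall fun x => ?_)
  rw [← sub_mul, norm_mul, mul_comm]
  exact mul_le_mul_of_nonneg_right (hD x) (abs_nonneg _)

lemma tendsto_integral_mul (hC : MemCL1loc T u) (ht : t ∈ Icc 0 T) (hθ : IsTestFn θ) :
    Tendsto (fun s => ∫ x, u x s * θ x) (𝓝[Icc 0 T] t) (𝓝 (∫ x, u x t * θ x)) := by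
  obtain ⟨D, hD⟩ := hθ.bddMeas.bdd
  have h1 := ((hC _ hθ.2.isCompact).2 t ht).const_mul D
  rw [mul_zero] at h1
  rw [tendsto_iff_dist_tendsto_zero]
  refine squeeze_zero' (Eventually.of_forall fun _ => dist_nonneg) ?_ h1
  filter_upwards [self_mem_nhdsWithin] with s hs
  exact hC.abs_integral_mul_sub_le hθ.2.isCompact hs ht hθ.bddMeas
    (fun x hx => image_eq_zero_of_notMem_tsupport hx) hD

end MemCL1loc

namespace IsCylSol

variable {μ : Measure (Euc N)} {φ : ℝ → ℝ} {u₀ : Euc N → ℝ} {w : Euc N × ℝ → ℝ}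

/-- The regularised solutions converge weakly to the continuous-in-time representative. -/
lemma eventually_abs_integral_regSol_sub_le (H : IsCylSol μ φ T M u₀ w) (hC : MemCL1loc T u)
    (hw : ∀ᵐ p ∂(QTvol N T), w p = u p.1 p.2) {t : ℝ} (ht : t ∈ Ioo 0 T) (hθ : IsTestFn θ)
    {ζ : ℝ} (hζ : 0 < ζ) :
    ∀ᶠ κ in 𝓝[>] (0 : ℝ), ∀ ρ : Euc N → ℝ, IsMollifier ρ κ → ∀ᶠ h in 𝓝[>] (0 : ℝ), ∀ k : ℕ,
      (k : ℝ) * h ≤ t → t < (k + 1) * h →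
      |(∫ x, θ x * regSol ρ h w k x) - ∫ x, u x t * θ x| ≤ ζ := by
  have htI := Ioo_subset_Icc_self ht
  set K := Metric.cthickening 1 (tsupport θ) with hKdef
  have hK : IsCompact K := hθ.2.isCompact.cthickening
  obtain ⟨D, hD⟩ := hθ.bddMeas.bdd
  have hD0 : 0 ≤ D := (abs_nonneg _).trans (hD 0)
  set A := ∫ x in K, |u x t| with hA
  have hA0 : 0 ≤ A := integral_nonneg fun _ => abs_nonneg _
  obtain ⟨α, hα0, hα⟩ : ∃ α > 0, α * A ≤ ζ / 2 :=
    ⟨ζ / 2 / (A + 1), by positivity, by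
      rw [div_mul_eq_mul_div, div_le_iff₀ (by positivity)]; nlinarith⟩
  obtain ⟨τ, hτ0, hτ⟩ := Metric.uniformContinuous_iff.1
    (hθ.2.uniformContinuous_of_continuous hθ.1.continuous) α hα0
  filter_upwards [Ioo_mem_nhdsGT (lt_min hτ0 one_pos)] with κ hκ ρ hρ
  have hκ1 : κ < 1 := hκ.2.trans_le (min_le_right _ _)
  set Θ := molInit (fun z => ρ (-z)) θ with hΘdef
  have hΘ : IsBddMeas Θ := bddMeas_molInit hρ.comp_neg hθ.bddMeas.meas hD
  have hΘD : ∀ x, |Θ x| ≤ D := abs_molInit_le hρ.comp_neg hD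
  have hΘK : ∀ x, x ∉ K → Θ x = 0 := fun x hx => molInit_eq_zero hρ.comp_neg fun hx' =>
    hx (Metric.cthickening_mono hκ1.le _ hx')
  have hθK : ∀ x, x ∉ K → θ x = 0 := fun x hx => image_eq_zero_of_notMem_tsupport fun hx' =>
    hx (Metric.self_subset_cthickening _ hx')
  have hΘθ : ∀ x, |Θ x - θ x| ≤ α := abs_molInit_sub_le hρ.comp_neg hθ fun x y hxy => by
    have := hτ (a := x) (b := y) (by
      rw [dist_eq_norm]; exact lt_of_le_of_lt hxy (hκ.2.trans_le (min_le_left _ _)))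
    rw [Real.dist_eq] at this
    exact this.le
  have hlim := ((hC K hK).2 t htI).const_mul D
  rw [mul_zero] at hlim
  have hev := hlim.eventually_le_const (half_pos hζ)
  have hev' : ∀ᶠ s in 𝓝 t, s ∈ Ioo 0 T ∧ D * ∫ x in K, |u x s - u x t| ≤ ζ / 2 := by
    rw [nhdsWithin_eq_nhds.2 (Icc_mem_nhds ht.1 ht.2)] at hev
    have h0 : ∀ᶠ s in 𝓝 t, s ∈ Ioo 0 T := Ioo_mem_nhds ht.1 ht.2
    exact h0.and hev
  obtain ⟨σ, hσ0, hσ⟩ := Metric.eventually_nhds_iff.1 hev'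
  filter_upwards [Ioo_mem_nhdsGT hσ0] with h hh k hk1 hk2
  have hh0 : 0 < h := hh.1
  have hnear : ∀ s, timeBump h k s ≠ 0 → dist s t < σ := fun s hs => by
    have : s ∈ Ioo ((k : ℝ) * h) ((k + 1) * h) := by
      by_contra hn; exact hs (timeBump_eq_zero hh0 hn)
    rw [Real.dist_eq, abs_lt]
    constructor <;> nlinarith [this.1, this.2, hh.2]
  set F := ∫ x, u x t * Θ x with hF
  have hb := integrable_timeBump hh0 (k : ℝ)
  set G : ℝ → ℝ := fun s => ∫ y, w (y, s) * (Θ y * timeBump h k s) with hG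
  have hpt : ∀ᵐ s : ℝ, ‖G s - timeBump h k s * F‖ ≤ timeBump h k s * (ζ / 2) := by
    filter_upwards [ae_slice_eq hw] with s hs
    by_cases hbs : timeBump h k s = 0
    · simp [hG, hbs]
    · have hs1 := hσ (hnear s hbs)
      have e : G s = timeBump h k s * ∫ y, u y s * Θ y := by
        rw [← integral_const_mul]
        refine integral_congr_ae ?_
        filter_upwards [hs hs1.1] with y hy
        rw [hy]; ring
      rw [e, ← mul_sub, norm_mul, Real.norm_of_nonneg (timeBump_nonneg hh0 _ _)]
      refine mul_le_mul_of_nonneg_left ?_ (timeBump_nonneg hh0 _ _)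
      exact (hC.abs_integral_mul_sub_le hK (Ioo_subset_Icc_self hs1.1) htI hΘ hΘK hΘD).trans hs1.2
  have hGm : AEStronglyMeasurable G volume := by
    have hwm := H.meas
    have hΘm := hΘ.meas
    have hbm := (continuous_timeBump h k).measurable
    exact (StronglyMeasurable.integral_prod_right' (f := fun q : ℝ × Euc N =>
      w (q.2, q.1) * (Θ q.2 * timeBump h k q.1))
      (by fun_prop : Measurable _).stronglyMeasurable).aestronglyMeasurable
  have hGF : Integrable fun s => G s - timeBump h k s * F :=
    (hb.mul_const (ζ / 2)).mono' (hGm.sub (hb.mul_const F).aestronglyMeasurable) hpt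
  have hGi : Integrable G := by
    refine (hGF.add (hb.mul_const F)).congr (Eventually.of_forall fun s => ?_)
    simp
  have h1 : |(∫ s, G s) - F| ≤ ζ / 2 := by
    have := norm_integral_le_of_norm_le (hb.mul_const (ζ / 2)) hpt
    rwa [integral_sub hGi (hb.mul_const F), integral_mul_const, integral_mul_const,
      integral_timeBump hh0, one_mul, one_mul, Real.norm_eq_abs] at this
  have h2 : |F - ∫ x, u x t * θ x| ≤ ζ / 2 := by
    refine le_trans ?_ hα
    rw [hF, ← integral_sub (hC.integrable_mul hK htI hΘ hΘK)
      (hC.integrable_mul hK htI hθ.bddMeas hθK),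
      ← setIntegral_eq_integral_of_forall_compl_eq_zero (s := K)
        (fun x hx => by simp [hΘK x hx, hθK x hx]), hA, ← integral_const_mul, ← Real.norm_eq_abs]
    refine norm_integral_le_of_norm_le (((hC K hK).1 t htI).abs.const_mul α)
      (Eventually.of_forall fun x => ?_)
    rw [← mul_sub, norm_mul, mul_comm]
    exact mul_le_mul_of_nonneg_right (hΘθ x) (abs_nonneg _)
  rw [H.integral_mul_regSol hρ hh0 hθ]
  calc _ ≤ |(∫ s, G s) - F| + |F - ∫ x, u x t * θ x| := abs_sub_le _ _ _
    _ ≤ ζ := by linarith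

end IsCylSol

end TraceLimit

noncomputable section Contraction

variable {N : ℕ}

/-- Indicators of bounded measurable sets are a.e. limits of test functions with values in
`[0, 1]`, supported in a fixed ball. -/
lemma exists_seq_isTestFn_tendsto_indicator {s : Set (Euc N)} {R : ℝ} (hs : MeasurableSet s)
    (hsR : s ⊆ Metric.closedBall 0 R) :
    ∃ θ : ℕ → Euc N → ℝ, (∀ j, IsTestFn (θ j)) ∧ (∀ j x, 0 ≤ θ j x) ∧ (∀ j x, θ j x ≤ 1) ∧
      (∀ j x, x ∉ Metric.closedBall (0 : Euc N) (R + 1) → θ j x = 0) ∧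
      ∀ᵐ x, Tendsto (fun j => θ j x) atTop (𝓝 (s.indicator (fun _ => (1 : ℝ)) x)) := by
  set χ : Euc N → ℝ := s.indicator fun _ => (1 : ℝ) with hχ
  have hpos : ∀ j : ℕ, (0 : ℝ) < 1 / ((j : ℝ) + 1) := fun j => Nat.one_div_pos_of_nat
  let b : ℕ → ContDiffBump (0 : Euc N) := fun j =>
    ⟨1 / ((j : ℝ) + 1) / 2, 1 / ((j : ℝ) + 1), half_pos (hpos j), half_lt_self (hpos j)⟩
  have hrout : ∀ j, (b j).rOut ≤ 1 := fun j => by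
    change 1 / ((j : ℝ) + 1) ≤ 1
    rw [div_le_one (by positivity)]
    linarith [(Nat.cast_nonneg j : (0 : ℝ) ≤ j)]
  have hχ0 : ∀ x, 0 ≤ χ x := fun x => indicator_nonneg (fun _ _ => zero_le_one) x
  have hχ1 : ∀ x, χ x ≤ 1 := fun x => indicator_le_self' (fun _ _ => zero_le_one) x
  have hfin : volume s ≠ ⊤ :=
    ((measure_mono hsR).trans_lt measure_closedBall_lt_top).ne
  have hχi : Integrable χ := (integrable_indicator_iff hs).2 (integrableOn_const hfin)
  let θ : ℕ → Euc N → ℝ := fun j =>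
    MeasureTheory.convolution ((b j).normed volume) χ (ContinuousLinearMap.lsmul ℝ ℝ) volume
  have hθ : ∀ j x, θ j x = ∫ t, (b j).normed volume t * χ (x - t) := fun j x => rfl
  have hzero : ∀ j x, x ∉ Metric.closedBall (0 : Euc N) (R + 1) → θ j x = 0 := fun j x hx => by
    rw [hθ]
    refine integral_eq_zero_of_ae (Eventually.of_forall fun t => ?_)
    by_contra hne
    have h1 : t ∈ Function.support ((b j).normed volume) := left_ne_zero_of_mul hne
    have h2 : x - t ∈ s := by
      by_contra hn
      exact right_ne_zero_of_mul hne (indicator_of_notMem hn _)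
    rw [ContDiffBump.support_normed_eq] at h1
    have h3 := hsR h2
    simp only [Metric.mem_closedBall, Metric.mem_ball, dist_zero_right] at h1 h3 hx
    have h4 := norm_add_le (x - t) t
    rw [sub_add_cancel] at h4
    linarith [hrout j]
  refine ⟨θ, fun j => ⟨?_, ?_⟩, fun j x => ?_, fun j x => ?_, hzero, ?_⟩
  · exact (b j).hasCompactSupport_normed.contDiff_convolution_left _ (b j).contDiff_normed
      hχi.locallyIntegrable
  · exact HasCompactSupport.intro (isCompact_closedBall 0 (R + 1)) fun x hx => hzero j x hx
  · rw [hθ]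
    exact integral_nonneg fun t => mul_nonneg ((b j).nonneg_normed t) (hχ0 _)
  · rw [hθ, ← (b j).integral_normed (μ := volume)]
    refine integral_mono_of_nonneg
      (Eventually.of_forall fun t => mul_nonneg ((b j).nonneg_normed t) (hχ0 _))
      (b j).integrable_normed (Eventually.of_forall fun t => ?_)
    exact mul_le_of_le_one_right ((b j).nonneg_normed t) (hχ1 _)
  · refine ContDiffBump.ae_convolution_tendsto_right_of_locallyIntegrable (K := 2)
      tendsto_one_div_add_atTop_nhds_zero_nat (Eventually.of_forall fun j => ?_)
      hχi.locallyIntegrable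
    change 1 / ((j : ℝ) + 1) ≤ 2 * (1 / ((j : ℝ) + 1) / 2)
    linarith

/-- A bound on the pairings of `f` with test functions valued in `[0, 1]` bounds the integral of
the positive part of `f`. -/
lemma integral_max_zero_le_of_forall_isTestFn {f : Euc N → ℝ} {I : ℝ} (hf : LocallyIntegrable f)
    (hI : 0 ≤ I) (H : ∀ θ : Euc N → ℝ, IsTestFn θ → (∀ x, 0 ≤ θ x) → (∀ x, θ x ≤ 1) →
      ∫ x, f x * θ x ≤ I) : ∫ x, max (f x) 0 ≤ I := by
  by_cases hInt : Integrable fun x => max (f x) 0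
  swap
  · rwa [integral_undef hInt]
  have hm : AEStronglyMeasurable f volume := hf.aestronglyMeasurable
  set g := hm.mk f with hg
  have hgm : Measurable g := hm.stronglyMeasurable_mk.measurable
  let s : ℕ → Set (Euc N) := fun n => {x | 0 < g x} ∩ Metric.closedBall 0 n
  have hs : ∀ n, MeasurableSet (s n) := fun n =>
    (measurableSet_lt measurable_const hgm).inter measurableSet_closedBall
  have key : ∀ n, ∫ x, f x * (s n).indicator (fun _ => (1 : ℝ)) x ≤ I := fun n => by
    obtain ⟨θ, hθ, hθ0, hθ1, hz, hlim⟩ :=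
      exists_seq_isTestFn_tendsto_indicator (hs n) inter_subset_right
    have hfi : IntegrableOn f (Metric.closedBall (0 : Euc N) (n + 1)) :=
      hf.integrableOn_isCompact (isCompact_closedBall _ _)
    refine le_of_tendsto (tendsto_integral_of_dominated_convergence
      ((Metric.closedBall (0 : Euc N) (n + 1)).indicator fun x => |f x|)
      (F := fun j x => f x * θ j x) (fun j => ?_) ?_ (fun j => Eventually.of_forall fun x => ?_) ?_)
      (Eventually.of_forall fun j => H _ (hθ j) (hθ0 j) (hθ1 j))
    · exact hm.mul (hθ j).1.continuous.aestronglyMeasurable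
    · exact IntegrableOn.integrable_indicator hfi.abs measurableSet_closedBall
    · by_cases hx : x ∈ Metric.closedBall (0 : Euc N) (n + 1)
      · rw [indicator_of_mem hx, norm_mul, Real.norm_eq_abs, Real.norm_eq_abs,
          abs_of_nonneg (hθ0 j x)]
        exact mul_le_of_le_one_right (abs_nonneg _) (hθ1 j x)
      · rw [indicator_of_notMem hx, hz j x hx, mul_zero, norm_zero]
    · filter_upwards [hlim] with x hx using hx.const_mul _
  refine le_of_tendsto (tendsto_integral_of_dominated_convergence (fun x => max (f x) 0)
    (F := fun (n : ℕ) x => f x * (s n).indicator (fun _ => (1 : ℝ)) x) (fun n => ?_) hInt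
    (fun n => ?_) ?_) (Eventually.of_forall key)
  · exact hm.mul (measurable_const.indicator (hs n)).aestronglyMeasurable
  · filter_upwards [hm.ae_eq_mk] with x hx
    by_cases hxs : x ∈ s n
    · have : 0 < f x := by rw [hx]; exact hxs.1
      rw [indicator_of_mem hxs, mul_one, Real.norm_eq_abs, abs_of_pos this]
      exact le_max_left _ _
    · rw [indicator_of_notMem hxs, mul_zero, norm_zero]
      exact le_max_right _ _
  · filter_upwards [hm.ae_eq_mk] with x hx
    refine tendsto_const_nhds.congr' ?_
    filter_upwards [eventually_ge_atTop ⌈‖x‖⌉₊] with n hn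
    by_cases hx0 : 0 < f x
    · have hxs : x ∈ s n := ⟨show 0 < g x by rw [hg, ← hx]; exact hx0, by
        simpa using Nat.ceil_le.1 hn⟩
      rw [indicator_of_mem hxs, mul_one, max_eq_left hx0.le]
    · have hxs : x ∉ s n := fun h => hx0 (by rw [hx]; exact h.1)
      rw [indicator_of_notMem hxs, mul_zero, max_eq_right (not_lt.1 hx0)]

section Slices

variable {μ : Measure (Euc N)} {φ : ℝ → ℝ} {T M : ℝ} {u₀ v₀ θ : Euc N → ℝ}
  {u v : Euc N → ℝ → ℝ} {w z : Euc N × ℝ → ℝ}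

lemma integral_mul_test_sub_le_of_mem_Ioo (hμ : IsLevyMeasure μ) (hφ : Continuous φ)
    (hφm : Monotone φ) (hw : IsCylSol μ φ T M u₀ w) (hz : IsCylSol μ φ T M v₀ z)
    (huC : MemCL1loc T u) (hvC : MemCL1loc T v) (hwu : ∀ᵐ p ∂(QTvol N T), w p = u p.1 p.2)
    (hzv : ∀ᵐ p ∂(QTvol N T), z p = v p.1 p.2) (hθ : IsTestFn θ) (hθ0 : ∀ x, 0 ≤ θ x)
    (hθ1 : ∀ x, θ x ≤ 1) {t : ℝ} (ht : t ∈ Ioo 0 T) :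
    (∫ x, u x t * θ x) - ∫ x, v x t * θ x ≤ ∫ x, max (u₀ x - v₀ x) 0 := by
  refine le_of_forall_pos_le_add fun ε hε => ?_
  have hζ : 0 < ε / 3 := by positivity
  have hT : 0 < T := ht.1.trans ht.2
  obtain ⟨κ, ⟨⟨h1, h2⟩, h3⟩, hκ⟩ :=
    ((((exists_mollifier_integral_regSol_sub_le hμ hw hz hφ hφm hT hθ hθ0 hθ1 hζ).and
      (hw.eventually_abs_integral_regSol_sub_le huC hwu ht hθ hζ)).and
      (hz.eventually_abs_integral_regSol_sub_le hvC hzv ht hθ hζ)).and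
      self_mem_nhdsWithin).exists
  obtain ⟨ρ, hρ⟩ := exists_isMollifier (N := N) hκ
  have hsmall : ∀ᶠ h in 𝓝[>] (0 : ℝ), h ∈ Ioo 0 (T - t) := Ioo_mem_nhdsGT (sub_pos.2 ht.2)
  obtain ⟨h, ⟨⟨h1, h2⟩, h3⟩, hh⟩ := ((((h1 ρ hρ).and (h2 ρ hρ)).and (h3 ρ hρ)).and hsmall).exists
  have hh0 : 0 < h := hh.1
  set k := ⌊t / h⌋₊ with hk
  have hk1 : (k : ℝ) * h ≤ t :=
    (le_div_iff₀ hh0).1 (Nat.floor_le (div_nonneg ht.1.le hh0.le))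
  have hk2 : t < ((k : ℝ) + 1) * h := (div_lt_iff₀ hh0).1 (Nat.lt_floor_add_one _)
  have hi : ∀ {u₀ : Euc N → ℝ} {w}, IsCylSol μ φ T M u₀ w →
      Integrable fun x => θ x * regSol ρ h w k x := fun H => by
    simpa only [mul_comm] using hθ.bddMeas.integrable_mul (H.integrable_regSol hρ hh0 k)
  have h1 := h1 k (by linarith [hh.2])
  have h2 := abs_le.1 (h2 k hk1 hk2)
  have h3 := abs_le.1 (h3 k hk1 hk2)
  simp only [mul_sub] at h1
  rw [integral_sub (hi hw) (hi hz)] at h1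
  linarith [h2.1, h3.2]

lemma integral_mul_test_sub_le (hμ : IsLevyMeasure μ) (hφ : Continuous φ) (hφm : Monotone φ)
    (hT : 0 < T) (hw : IsCylSol μ φ T M u₀ w) (hz : IsCylSol μ φ T M v₀ z)
    (huC : MemCL1loc T u) (hvC : MemCL1loc T v) (hwu : ∀ᵐ p ∂(QTvol N T), w p = u p.1 p.2)
    (hzv : ∀ᵐ p ∂(QTvol N T), z p = v p.1 p.2) (hθ : IsTestFn θ) (hθ0 : ∀ x, 0 ≤ θ x)
    (hθ1 : ∀ x, θ x ≤ 1) {t : ℝ} (ht : t ∈ Icc 0 T) :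
    (∫ x, u x t * θ x) - ∫ x, v x t * θ x ≤ ∫ x, max (u₀ x - v₀ x) 0 := by
  have hne : (𝓝[Ioo 0 T] t).NeBot := by
    rw [← mem_closure_iff_nhdsWithin_neBot, closure_Ioo hT.ne]
    exact ht
  refine le_of_tendsto (((huC.tendsto_integral_mul ht hθ).sub
    (hvC.tendsto_integral_mul ht hθ)).mono_left (nhdsWithin_mono _ Ioo_subset_Icc_self)) ?_
  filter_upwards [self_mem_nhdsWithin] with s hs
  exact integral_mul_test_sub_le_of_mem_Ioo hμ hφ hφm hw hz huC hvC hwu hzv hθ hθ0 hθ1 hs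

end Slices

end Contraction

/-- `L¹`-contraction (Theorem 2.6 (a)). -/
theorem L1_contraction
    (N : ℕ) (hN : 0 < N) (T : ℝ) (hT : 0 < T)
    (φ : ℝ → ℝ) (hφc : Continuous φ) (hφm : Monotone φ)
    (μ : Measure (Euc N)) (hμ : IsLevyMeasure μ)
    (u0 v0 : Euc N → ℝ)
    (hu0inf : MemLinfRn u0) (hu01 : Integrable u0 (volume : Measure (Euc N)))
    (hv0inf : MemLinfRn v0) (hv01 : Integrable v0 (volume : Measure (Euc N)))
    (u v : Euc N → ℝ → ℝ)
    (huinf : MemLinfQT T u) (hu1 : MemL1QT T u) (huC : MemCL1loc T u)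
    (hvinf : MemLinfQT T v) (hv1 : MemL1QT T v) (hvC : MemCL1loc T v)
    (husol : IsDistSolOp T (Lop μ) φ u0 u)
    (hvsol : IsDistSolOp T (Lop μ) φ v0 v) :
    ∀ t ∈ Set.Icc (0 : ℝ) T,
      ∫ x, max (u x t - v x t) 0 ≤ ∫ x, max (u0 x - v0 x) 0 := by
  intro t ht
  obtain ⟨M₁, h₁⟩ := exists_isCylSol hμ hφc hu0inf hu01 huinf hu1 husol
  obtain ⟨M₂, h₂⟩ := exists_isCylSol hμ hφc hv0inf hv01 hvinf hv1 hvsol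
  obtain ⟨w₀, w, hw, hw0, hwu⟩ := h₁ (max M₁ M₂) (le_max_left _ _)
  obtain ⟨z₀, z, hz, hz0, hzv⟩ := h₂ (max M₁ M₂) (le_max_right _ _)
  have h0 : ∫ x, max (w₀ x - z₀ x) 0 = ∫ x, max (u0 x - v0 x) 0 := by
    refine integral_congr_ae ?_
    filter_upwards [hw0, hz0] with x h1 h2
    rw [h1, h2]
  rw [← h0]
  have hloc : LocallyIntegrable fun x => u x t - v x t := locallyIntegrable_iff.2 fun K hK =>
    ((huC K hK).1 t ht).sub ((hvC K hK).1 t ht)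
  refine integral_max_zero_le_of_forall_isTestFn hloc
    (integral_nonneg fun x => le_max_right _ _) fun θ hθ hθ0 hθ1 => ?_
  have hzero : ∀ x, x ∉ tsupport θ → θ x = 0 := fun x hx => image_eq_zero_of_notMem_tsupport hx
  simp only [sub_mul]
  rw [integral_sub (huC.integrable_mul hθ.2.isCompact ht hθ.bddMeas hzero)
    (hvC.integrable_mul hθ.2.isCompact ht hθ.bddMeas hzero)]
  exact integral_mul_test_sub_le hμ hφc hφm hT hw hz huC hvC hwu hzv hθ hθ0 hθ1 ht
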